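/- Extremal points of the coercive Hellinger–Kantorovich energy ball: Let Ω ⊂ ℝ^d be the closure of a bounded domain and α,β,δ > 0. Let 𝓑 := {(ρ,m,μ) ∈ M_Ω : J_{α,β,δ}(ρ,m,μ) ≤ 1}. Then the set of extremal points of 𝓑 equals 𝒞 ∪ {0}, where 𝒞 is the set of triples (ρ,m,μ) of the form ρ = h(t) dt ⊗ δ_{γ(t)}, m = γ'(t) ρ, μ = h'(t) dt ⊗ δ_{γ(t)} with: (a) t ↦ h(t)δ_{γ(t)} ∈ H_Ω, (b) the set {h>0} := {t ∈ [0,1] : h(t)>0} is connected, and (c) J_{α,β,δ}(ρ,m,μ) = 1. -/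

import Mathlib

open MeasureTheory Set Filter Topology
open scoped ENNReal NNReal

noncomputable section

namespace Paper

abbrev Euc (d : ℕ) : Type := EuclideanSpace ℝ (Fin d)

abbrev XX (d : ℕ) : Type := ℝ × Euc d

variable {d : ℕ}

/-- `Ω` is the closure of a bounded domain (a nonempty bounded open connected set). -/
def IsClosureOfBoundedDomain (Ω : Set (Euc d)) : Prop :=
  ∃ U : Set (Euc d), IsOpen U ∧ U.Nonempty ∧ IsConnected U ∧
    Bornology.IsBounded U ∧ Ω = closure U

/-- `Ω` is the closure of a bounded convex domain. -/
def IsClosureOfBoundedConvexDomain (Ω : Set (Euc d)) : Prop :=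
  ∃ U : Set (Euc d), IsOpen U ∧ U.Nonempty ∧ Convex ℝ U ∧
    Bornology.IsBounded U ∧ Ω = closure U

/-- clamping of `ℝ` onto `[0,1]`. -/
def clamp (t : ℝ) : ℝ := max 0 (min 1 t)

/-- `t ↦ ρ t` is a narrowly continuous curve (on `[0,1]`) of finite positive
measures concentrated on `Ω`, i.e. an element of `C_w([0,1]; M⁺(Ω))`. -/
def NarrowCurve (Ω : Set (Euc d)) (ρ : ℝ → Measure (Euc d)) : Prop :=
  (∀ t ∈ Icc (0:ℝ) 1, ρ t Ωᶜ = 0 ∧ ρ t Set.univ ≠ ⊤) ∧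
  (∀ φ : Euc d → ℝ, Continuous φ →
      ContinuousOn (fun t => ∫ x, φ x ∂(ρ t)) (Icc (0:ℝ) 1))

/-- Test functions for the continuity equation on `X_Ω = (0,1) × Ω` (no-flux form:
compact support in time, free at the spatial boundary). -/
def IsTest (φ : XX d → ℝ) : Prop :=
  ContDiff ℝ (⊤ : ℕ∞) φ ∧ HasCompactSupport φ ∧
    tsupport φ ⊆ Ioo (0:ℝ) 1 ×ˢ (Set.univ : Set (Euc d))

/-- Distributional solution of `∂ₜ ρ + div (v ρ) = g ρ`. -/
def SolvesCE (ρ : ℝ → Measure (Euc d)) (v : XX d → Euc d) (g : XX d → ℝ) : Prop :=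
  ∀ φ : XX d → ℝ, IsTest φ →
    (∫ t in Ioo (0:ℝ) 1,
      ∫ x, (fderiv ℝ φ (t, x) (1, v (t, x)) + φ (t, x) * g (t, x)) ∂(ρ t)) = 0

/-- The Hellinger–Kantorovich energy `∫₀¹ ∫ (|v|² + g²) dρ_t dt`. -/
def EnergyVG (ρ : ℝ → Measure (Euc d)) (v : XX d → Euc d) (g : XX d → ℝ) : ℝ≥0∞ :=
  ∫⁻ t in Ioo (0:ℝ) 1, ∫⁻ x, ENNReal.ofReal (‖v (t, x)‖ ^ 2 + g (t, x) ^ 2) ∂(ρ t)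

/-- The class `D_{v,g}` of finite-energy narrowly continuous solutions. -/
def Dvg (Ω : Set (Euc d)) (v : XX d → Euc d) (g : XX d → ℝ)
    (ρ : ℝ → Measure (Euc d)) : Prop :=
  NarrowCurve Ω ρ ∧ SolvesCE ρ v g ∧ EnergyVG ρ v g < ⊤

/-- total variation `‖ρ‖_{M(X_Ω)}` of `ρ = dt ⊗ ρ_t`. -/
def TVcurve (ρ : ℝ → Measure (Euc d)) : ℝ≥0∞ :=
  ∫⁻ t in Ioo (0:ℝ) 1, ρ t Set.univ

/-- The cone `𝒞_V = {h δ_γ : h ≥ 0, γ ∈ V}` of weighted Dirac masses. -/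
def coneSet (V : Set (Euc d)) : Set (Measure (Euc d)) :=
  {μ | ∃ (a : ℝ) (x : Euc d), 0 ≤ a ∧ x ∈ V ∧ μ = ENNReal.ofReal a • Measure.dirac x}

/-- The space `𝒮_V` of narrowly continuous curves `[0,1] → 𝒞_V`
(extended to `ℝ` by clamping). -/
structure SCurve (V : Set (Euc d)) where
  toFun : ℝ → Measure (Euc d)
  clamped : ∀ t, toFun t = toFun (clamp t)
  cone : ∀ t, toFun t ∈ coneSet V
  narrow : ∀ φ : Euc d → ℝ, Continuous φ → Continuous fun t => ∫ x, φ x ∂(toFun t)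

/-- The flat distance `D_F` between measures. -/
def flatDist (μ ν : Measure (Euc d)) : ℝ :=
  sSup {r : ℝ | ∃ φ : Euc d → ℝ, Continuous φ ∧ (∀ x, |φ x| ≤ 1) ∧ LipschitzWith 1 φ ∧
        r = (∫ x, φ x ∂μ) - ∫ x, φ x ∂ν}

/-- The supremum distance `D` on `𝒮_V`. -/
def Ddist {V : Set (Euc d)} (η₁ η₂ : SCurve V) : ℝ :=
  sSup {r : ℝ | ∃ t ∈ Icc (0:ℝ) 1, r = flatDist (η₁.toFun t) (η₂.toFun t)}

/-- The topology of `(𝒮_V, D)`, generated by the open `D`-balls. -/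
def Stop (V : Set (Euc d)) : TopologicalSpace (SCurve V) :=
  TopologicalSpace.generateFrom
    {s | ∃ (η₀ : SCurve V) (ε : ℝ), 0 < ε ∧ s = {η | Ddist η₀ η < ε}}

/-- The Borel σ-algebra of `(𝒮_V, D)`. -/
def Sborel (V : Set (Euc d)) : MeasurableSpace (SCurve V) := @borel _ (Stop V)

instance (V : Set (Euc d)) : MeasurableSpace (SCurve V) := Sborel V

/-- `‖h‖_∞` for a curve `ρ_t = h(t) δ_{γ(t)} ∈ 𝒮_V`. -/
def supMass {V : Set (Euc d)} (η : SCurve V) : ℝ≥0∞ :=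
  ⨆ t ∈ Icc (0:ℝ) 1, η.toFun t Set.univ

/-- `AC²[0,1]`: absolutely continuous on `[0,1]` with a.e. derivative in `L²`. -/
def AC2 {F : Type*} [NormedAddCommGroup F] [NormedSpace ℝ F] (f : ℝ → F) : Prop :=
  ∃ f' : ℝ → F, IntegrableOn f' (Icc (0:ℝ) 1) ∧
    IntegrableOn (fun t => ‖f' t‖ ^ 2) (Icc (0:ℝ) 1) ∧
    ∀ t ∈ Icc (0:ℝ) 1, f t = f 0 + ∫ s in (0:ℝ)..t, f' s

/-- `(γ, h)` represents the curve `η ∈ 𝒮_V`, i.e. `η_t = h(t) δ_{γ(t)}` on `[0,1]`. -/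
def Represents {V : Set (Euc d)} (η : SCurve V) (γ : ℝ → Euc d) (h : ℝ → ℝ) : Prop :=
  ∀ t ∈ Icc (0:ℝ) 1, 0 ≤ h t ∧ γ t ∈ V ∧
    η.toFun t = ENNReal.ofReal (h t) • Measure.dirac (γ t)

/-- The set `H_V ⊆ 𝒮_V` of curves `h(t)δ_{γ(t)}` with `h, √h ∈ AC²[0,1]`,
`√h γ ∈ AC²([0,1];ℝ^d)`. -/
def MemH (V : Set (Euc d)) (η : SCurve V) : Prop :=
  ∃ (γ : ℝ → Euc d) (h : ℝ → ℝ), Represents η γ h ∧ AC2 h ∧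
    AC2 (fun t => Real.sqrt (h t)) ∧ AC2 (fun t => Real.sqrt (h t) • γ t)

/-- The set `H_V^{v,g}`: curves in `H_V` solving the characteristic system
`γ' = v(t,γ)` a.e. on `{h>0}` and `h' = g(t,γ) h` a.e. on `(0,1)`. -/
def MemHvg (V : Set (Euc d)) (v : XX d → Euc d) (g : XX d → ℝ) (η : SCurve V) : Prop :=
  ∃ (γ : ℝ → Euc d) (h : ℝ → ℝ), Represents η γ h ∧ AC2 h ∧
    AC2 (fun t => Real.sqrt (h t)) ∧ AC2 (fun t => Real.sqrt (h t) • γ t) ∧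
    (∀ᵐ t ∂(volume.restrict {t | t ∈ Ioo (0:ℝ) 1 ∧ 0 < h t}),
        HasDerivAt γ (v (t, γ t)) t) ∧
    (∀ᵐ t ∂(volume.restrict (Ioo (0:ℝ) 1)),
        HasDerivAt h (g (t, γ t) * h t) t)

/-- The set `𝒮*_V` of curves whose positivity set `{h > 0}` is `[0,1] ∩ (-∞, τ)`. -/
def MemSstar {V : Set (Euc d)} (η : SCurve V) : Prop :=
  ∃ τ : ℝ, {t | t ∈ Icc (0:ℝ) 1 ∧ η.toFun t Set.univ ≠ 0} = Icc (0:ℝ) 1 ∩ Iio τ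

/-- The vanishing time `τ(γ,h) = min { t ∈ [0,1] : h(t) = 0 }` (`∞` if none). -/
def tauS {V : Set (Euc d)} (η : SCurve V) : ℝ≥0∞ :=
  sInf {c : ℝ≥0∞ | ∃ t ∈ Icc (0:ℝ) 1, η.toFun t Set.univ = 0 ∧ c = ENNReal.ofReal t}


open Classical in
/-- The integrand `Ψ_δ(t,x,y)`. -/
def Psi (δ : ℝ) (t : ℝ) (x : Euc d) (y : ℝ) : ℝ≥0∞ :=
  if 0 < t then ENNReal.ofReal ((‖x‖ ^ 2 + δ ^ 2 * y ^ 2) / (2 * t))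
  else if t = 0 ∧ x = 0 ∧ y = 0 then 0 else ⊤

/-- `u` is a density of the signed measure `σ` with respect to `lam`. -/
def IsDensityS (σ : SignedMeasure (XX d)) (lam : Measure (XX d)) (u : XX d → ℝ) : Prop :=
  ∀ s : Set (XX d), MeasurableSet s → σ s = ∫ x in s, u x ∂lam

/-- `w` is a density of the vector measure `m` with respect to `lam`. -/
def IsDensityV (m : VectorMeasure (XX d) (Euc d)) (lam : Measure (XX d))
    (w : XX d → Euc d) : Prop :=
  ∀ s : Set (XX d), MeasurableSet s → m s = ∫ x in s, w x ∂lam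

/-- `r` is a density of the positive measure `P` with respect to `lam`. -/
def IsDensityP (P : Measure (XX d)) (lam : Measure (XX d)) (r : XX d → ℝ) : Prop :=
  ∀ s : Set (XX d), MeasurableSet s → P s = ∫⁻ x in s, ENNReal.ofReal (r x) ∂lam

/-- `(P, m, μ)` is a measure solution of `∂ₜ ρ + div m = μ` (with `P` positive). -/
def SolvesCEMeas (P : Measure (XX d)) (m : VectorMeasure (XX d) (Euc d))
    (μ : SignedMeasure (XX d)) : Prop :=
  ∀ (lam : Measure (XX d)), IsFiniteMeasure lam →
    ∀ (w : XX d → Euc d) (u : XX d → ℝ), Measurable w → Measurable u →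
      IsDensityV m lam w → IsDensityS μ lam u →
      ∀ φ : XX d → ℝ, IsTest φ →
        ((∫ x, fderiv ℝ φ x ((1:ℝ), (0 : Euc d)) ∂P) +
          (∫ x, fderiv ℝ φ x ((0:ℝ), w x) ∂lam) + ∫ x, φ x * u x ∂lam) = 0

/-- The Wasserstein–Fisher–Rao energy `B_δ(ρ,m,μ)` for a positive `ρ`. -/
def BdeltaMeas (δ : ℝ) (P : Measure (XX d)) (m : VectorMeasure (XX d) (Euc d))
    (μ : SignedMeasure (XX d)) : ℝ≥0∞ :=
  sInf {c : ℝ≥0∞ | ∃ lam : Measure (XX d), IsFiniteMeasure lam ∧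
    ∃ (r : XX d → ℝ) (w : XX d → Euc d) (u : XX d → ℝ),
      Measurable r ∧ Measurable w ∧ Measurable u ∧ (∀ x, 0 ≤ r x) ∧
      IsDensityP P lam r ∧ IsDensityV m lam w ∧ IsDensityS μ lam u ∧
      c = ∫⁻ x, Psi δ (r x) (w x) (u x) ∂lam}

open Classical in
/-- The coercive energy `J_{α,β,δ}(ρ,m,μ)` for a positive `ρ`. -/
def JMeas (α β δ : ℝ) (P : Measure (XX d)) (m : VectorMeasure (XX d) (Euc d))
    (μ : SignedMeasure (XX d)) : ℝ≥0∞ :=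
  if SolvesCEMeas P m μ then
    ENNReal.ofReal β * BdeltaMeas δ P m μ + ENNReal.ofReal α * P Set.univ
  else ⊤

/-- `(ρ, m, μ)` is a measure solution of `∂ₜ ρ + div m = μ` (signed case). -/
def SolvesCESigned (ρ : SignedMeasure (XX d)) (m : VectorMeasure (XX d) (Euc d))
    (μ : SignedMeasure (XX d)) : Prop :=
  ∀ (lam : Measure (XX d)), IsFiniteMeasure lam →
    ∀ (r : XX d → ℝ) (w : XX d → Euc d) (u : XX d → ℝ),
      Measurable r → Measurable w → Measurable u →
      IsDensityS ρ lam r → IsDensityV m lam w → IsDensityS μ lam u →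
      ∀ φ : XX d → ℝ, IsTest φ →
        (∫ x, (fderiv ℝ φ x ((1:ℝ), (0 : Euc d)) * r x
          + fderiv ℝ φ x ((0:ℝ), w x) + φ x * u x) ∂lam) = 0

/-- The Wasserstein–Fisher–Rao energy `B_δ(ρ,m,μ)`, signed case. -/
def BdeltaSigned (δ : ℝ) (ρ : SignedMeasure (XX d)) (m : VectorMeasure (XX d) (Euc d))
    (μ : SignedMeasure (XX d)) : ℝ≥0∞ :=
  sInf {c : ℝ≥0∞ | ∃ lam : Measure (XX d), IsFiniteMeasure lam ∧
    ∃ (r : XX d → ℝ) (w : XX d → Euc d) (u : XX d → ℝ),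
      Measurable r ∧ Measurable w ∧ Measurable u ∧
      IsDensityS ρ lam r ∧ IsDensityV m lam w ∧ IsDensityS μ lam u ∧
      c = ∫⁻ x, Psi δ (r x) (w x) (u x) ∂lam}

open Classical in
/-- The coercive energy `J_{α,β,δ}(ρ,m,μ)`, signed case. -/
def JSigned (α β δ : ℝ) (ρ : SignedMeasure (XX d)) (m : VectorMeasure (XX d) (Euc d))
    (μ : SignedMeasure (XX d)) : ℝ≥0∞ :=
  if SolvesCESigned ρ m μ then
    ENNReal.ofReal β * BdeltaSigned δ ρ m μ
      + ENNReal.ofReal α * ρ.totalVariation Set.univ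
  else ⊤

/-- A signed measure on `X = ℝ × ℝ^d` is concentrated on `X_Ω = (0,1) × Ω`. -/
def ConcS (Ω : Set (Euc d)) (ρ : SignedMeasure (XX d)) : Prop :=
  ∀ s : Set (XX d), MeasurableSet s → s ⊆ (Ioo (0:ℝ) 1 ×ˢ Ω)ᶜ → ρ s = 0

/-- A vector measure on `X = ℝ × ℝ^d` is concentrated on `X_Ω = (0,1) × Ω`. -/
def ConcV (Ω : Set (Euc d)) (m : VectorMeasure (XX d) (Euc d)) : Prop :=
  ∀ s : Set (XX d), MeasurableSet s → s ⊆ (Ioo (0:ℝ) 1 ×ˢ Ω)ᶜ → m s = 0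

/-- Integral of `φ` against a signed measure. -/
def sInt {α : Type*} [MeasurableSpace α] (σ : SignedMeasure α) (φ : α → ℝ) : ℝ :=
  (∫ x, φ x ∂σ.toJordanDecomposition.posPart) -
    ∫ x, φ x ∂σ.toJordanDecomposition.negPart

/-- Triples `(ρ, m, μ) ∈ M(X_Ω) × M(X_Ω; ℝ^d) × M(X_Ω)`. -/
abbrev Mtriple (d : ℕ) : Type :=
  SignedMeasure (XX d) × VectorMeasure (XX d) (Euc d) × SignedMeasure (XX d)

/-- `P` is the measure `dt ⊗ ρ_t` associated with the curve `η ∈ 𝒮_V`. -/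
def CurveMeasure {V : Set (Euc d)} (η : SCurve V) (P : Measure (XX d)) : Prop :=
  ∀ s : Set (XX d), MeasurableSet s →
    P s = ∫⁻ t in Ioo (0:ℝ) 1, η.toFun t {x | (t, x) ∈ s}

/-- `h'` and `γ'` are the a.e. derivatives of `h` on `(0,1)` and of `γ` on `{h>0}`. -/
def HasAEDerivs (γ : ℝ → Euc d) (h : ℝ → ℝ) (γ' : ℝ → Euc d) (h' : ℝ → ℝ) : Prop :=
  (∀ᵐ t ∂(volume.restrict (Ioo (0:ℝ) 1)), HasDerivAt h (h' t) t) ∧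
  (∀ᵐ t ∂(volume.restrict {t | t ∈ Ioo (0:ℝ) 1 ∧ 0 < h t}), HasDerivAt γ (γ' t) t)

/-- The triple `p = (ρ, m, μ)` is of characteristic form
`ρ = h dt ⊗ δ_γ`, `m = γ' ρ`, `μ = h' dt ⊗ δ_γ` with the regularity of `H_Ω`. -/
def CharRepr (Ω : Set (Euc d)) (γ : ℝ → Euc d) (h : ℝ → ℝ) (γ' : ℝ → Euc d)
    (h' : ℝ → ℝ) (p : Mtriple d) : Prop :=
  (∀ t ∈ Icc (0:ℝ) 1, 0 ≤ h t ∧ γ t ∈ Ω) ∧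
  AC2 h ∧ AC2 (fun t => Real.sqrt (h t)) ∧ AC2 (fun t => Real.sqrt (h t) • γ t) ∧
  (∀ φ : Euc d → ℝ, Continuous φ →
      ContinuousOn (fun t => h t * φ (γ t)) (Icc (0:ℝ) 1)) ∧
  HasAEDerivs γ h γ' h' ∧
  (∀ s : Set (XX d), MeasurableSet s →
      p.1 s = ∫ t in Ioo (0:ℝ) 1, Set.indicator {u : ℝ | (u, γ u) ∈ s} h t) ∧
  (∀ s : Set (XX d), MeasurableSet s →
      p.2.1 s = ∫ t in Ioo (0:ℝ) 1,
        Set.indicator {u : ℝ | (u, γ u) ∈ s} (fun u => h u • γ' u) t) ∧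
  (∀ s : Set (XX d), MeasurableSet s →
      p.2.2 s = ∫ t in Ioo (0:ℝ) 1, Set.indicator {u : ℝ | (u, γ u) ∈ s} h' t)

/-- The set `𝒞` of extremal characteristic triples. -/
def MemC (α β δ : ℝ) (Ω : Set (Euc d)) (p : Mtriple d) : Prop :=
  ∃ (γ : ℝ → Euc d) (h : ℝ → ℝ) (γ' : ℝ → Euc d) (h' : ℝ → ℝ),
    CharRepr Ω γ h γ' h' p ∧
    IsPreconnected {t | t ∈ Icc (0:ℝ) 1 ∧ 0 < h t} ∧
    JSigned α β δ p.1 p.2.1 p.2.2 = 1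


/-- Curves in `C_w([0,1]; M(Ω))`: narrowly continuous curves of signed measures
concentrated on `Ω`, extended to `ℝ` by clamping. -/
def IsCwCurve (Ω : Set (Euc d)) (f : ℝ → SignedMeasure (Euc d)) : Prop :=
  (∀ t, f t = f (clamp t)) ∧
  (∀ t, ∀ s : Set (Euc d), MeasurableSet s → s ⊆ Ωᶜ → f t s = 0) ∧
  (∀ φ : Euc d → ℝ, Continuous φ → Continuous fun t => sInt (f t) φ)

/-- `r` is a density with respect to `lam` of the measure `dt ⊗ f_t` on `X`. -/
def CwDensity (f : ℝ → SignedMeasure (Euc d)) (lam : Measure (XX d))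
    (r : XX d → ℝ) : Prop :=
  ∀ s : Set (XX d), MeasurableSet s →
    (∫ t in Ioo (0:ℝ) 1,
        sInt (f t) ({x : Euc d | (t, x) ∈ s}.indicator fun _ => (1:ℝ)))
      = ∫ x in s, r x ∂lam

/-- `(f, m, μ)` is a measure solution of `∂ₜ ρ + div m = μ`, `f` a curve. -/
def SolvesCECw (f : ℝ → SignedMeasure (Euc d)) (m : VectorMeasure (XX d) (Euc d))
    (μ : SignedMeasure (XX d)) : Prop :=
  ∀ (lam : Measure (XX d)), IsFiniteMeasure lam →
    ∀ (w : XX d → Euc d) (u : XX d → ℝ), Measurable w → Measurable u →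
      IsDensityV m lam w → IsDensityS μ lam u →
      ∀ φ : XX d → ℝ, IsTest φ →
        ((∫ t in Ioo (0:ℝ) 1, sInt (f t) fun x => fderiv ℝ φ (t, x) ((1:ℝ), (0 : Euc d)))
          + (∫ x, fderiv ℝ φ x ((0:ℝ), w x) ∂lam) + ∫ x, φ x * u x ∂lam) = 0

/-- `B_δ(dt ⊗ f_t, m, μ)`. -/
def BdeltaCw (δ : ℝ) (f : ℝ → SignedMeasure (Euc d)) (m : VectorMeasure (XX d) (Euc d))
    (μ : SignedMeasure (XX d)) : ℝ≥0∞ :=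
  sInf {c : ℝ≥0∞ | ∃ lam : Measure (XX d), IsFiniteMeasure lam ∧
    ∃ (r : XX d → ℝ) (w : XX d → Euc d) (u : XX d → ℝ),
      Measurable r ∧ Measurable w ∧ Measurable u ∧
      CwDensity f lam r ∧ IsDensityV m lam w ∧ IsDensityS μ lam u ∧
      c = ∫⁻ x, Psi δ (r x) (w x) (u x) ∂lam}

/-- `‖dt ⊗ f_t‖_{M(X_Ω)}`. -/
def TVCw (f : ℝ → SignedMeasure (Euc d)) : ℝ≥0∞ :=
  ∫⁻ t in Ioo (0:ℝ) 1, (f t).totalVariation Set.univ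

open Classical in
/-- `J_{α,β,δ}(dt ⊗ f_t, m, μ)`. -/
def JCw (α β δ : ℝ) (f : ℝ → SignedMeasure (Euc d)) (m : VectorMeasure (XX d) (Euc d))
    (μ : SignedMeasure (XX d)) : ℝ≥0∞ :=
  if SolvesCECw f m μ then
    ENNReal.ofReal β * BdeltaCw δ f m μ + ENNReal.ofReal α * TVCw f
  else ⊤

/-- The set `𝒞` in curve form: `(f, m, μ)` with `f_t = h(t) δ_{γ(t)}`,
`m = h γ' dt ⊗ δ_γ`, `μ = h' dt ⊗ δ_γ`, with `H_Ω`-regularity, connected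
positivity set and unit energy. -/
def MemCCw (α β δ : ℝ) (Ω : Set (Euc d)) (f : ℝ → SignedMeasure (Euc d))
    (m : VectorMeasure (XX d) (Euc d)) (μ : SignedMeasure (XX d)) : Prop :=
  ∃ (γ : ℝ → Euc d) (h : ℝ → ℝ) (γ' : ℝ → Euc d) (h' : ℝ → ℝ),
    (∀ t ∈ Icc (0:ℝ) 1, 0 ≤ h t ∧ γ t ∈ Ω) ∧
    AC2 h ∧ AC2 (fun t => Real.sqrt (h t)) ∧ AC2 (fun t => Real.sqrt (h t) • γ t) ∧
    (∀ φ : Euc d → ℝ, Continuous φ →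
        ContinuousOn (fun t => h t * φ (γ t)) (Icc (0:ℝ) 1)) ∧
    HasAEDerivs γ h γ' h' ∧
    (∀ t, f t = h (clamp t) • (Measure.dirac (γ (clamp t))).toSignedMeasure) ∧
    (∀ s : Set (XX d), MeasurableSet s →
        m s = ∫ t in Ioo (0:ℝ) 1,
          Set.indicator {u : ℝ | (u, γ u) ∈ s} (fun u => h u • γ' u) t) ∧
    (∀ s : Set (XX d), MeasurableSet s →
        μ s = ∫ t in Ioo (0:ℝ) 1, Set.indicator {u : ℝ | (u, γ u) ∈ s} h' t) ∧
    IsPreconnected {t | t ∈ Icc (0:ℝ) 1 ∧ 0 < h t} ∧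
    JCw α β δ f m μ = 1

/-- The mollified density `ρ_t ∗ ξ_ε + ε χ_V`. -/
def mollDens (V : Set (Euc d)) (ρ : ℝ → Measure (Euc d)) (ξ : Euc d → ℝ) (ε : ℝ)
    (t : ℝ) (x : Euc d) : ℝ :=
  (∫ y, (ε ^ d)⁻¹ * ξ (ε⁻¹ • (x - y)) ∂(ρ t)) + ε * V.indicator (fun _ => (1:ℝ)) x

/-- The mollified measure `ρ_t^ε = (ρ_t ∗ ξ_ε + ε χ_V) dx`. -/
def mollRho (V : Set (Euc d)) (ρ : ℝ → Measure (Euc d)) (ξ : Euc d → ℝ) (ε : ℝ) :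
    ℝ → Measure (Euc d) :=
  fun t => volume.withDensity fun x => ENNReal.ofReal (mollDens V ρ ξ ε t x)

open Classical in
/-- The mollified velocity field `v^ε = ((v ρ_t) ∗ ξ_ε) / ρ_t^ε`. -/
def mollV (V : Set (Euc d)) (ρ : ℝ → Measure (Euc d)) (v : XX d → Euc d)
    (ξ : Euc d → ℝ) (ε : ℝ) : XX d → Euc d :=
  fun p => if mollDens V ρ ξ ε p.1 p.2 = 0 then 0 else
    (mollDens V ρ ξ ε p.1 p.2)⁻¹ •
      ∫ y, ((ε ^ d)⁻¹ * ξ (ε⁻¹ • (p.2 - y))) • v (p.1, y) ∂(ρ p.1)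

open Classical in
/-- The mollified growth field `g^ε = ((g ρ_t) ∗ ξ_ε) / ρ_t^ε`. -/
def mollG (V : Set (Euc d)) (ρ : ℝ → Measure (Euc d)) (g : XX d → ℝ)
    (ξ : Euc d → ℝ) (ε : ℝ) : XX d → ℝ :=
  fun p => if mollDens V ρ ξ ε p.1 p.2 = 0 then 0 else
    (mollDens V ρ ξ ε p.1 p.2)⁻¹ *
      ∫ y, ((ε ^ d)⁻¹ * ξ (ε⁻¹ • (p.2 - y))) * g (p.1, y) ∂(ρ p.1)


/-! ### Part A: densities and representations of triples -/

/-- The operator `L φ = ∂ₜ φ + v · ∇φ + g φ`. -/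
def Lop (v : XX d → Euc d) (g : XX d → ℝ) (φ : XX d → ℝ) (x : XX d) : ℝ :=
  fderiv ℝ φ x ((1:ℝ), v x) + φ x * g x

/-- The triple `p` is `(P, v P, g P)`. -/
structure Rep (p : Mtriple d) (P : Measure (XX d)) (v : XX d → Euc d) (g : XX d → ℝ) : Prop where
  fin : IsFiniteMeasure P
  mv : Measurable v
  mg : Measurable g
  iv : Integrable v P
  ig : Integrable g P
  h1 : ∀ s, MeasurableSet s → p.1 s = P.real s
  h2 : ∀ s, MeasurableSet s → p.2.1 s = ∫ x in s, v x ∂P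
  h3 : ∀ s, MeasurableSet s → p.2.2 s = ∫ x in s, g x ∂P

lemma integrable_clm_of_density_aux {X E : Type*} [MeasurableSpace X] [NormedAddCommGroup E]
    [NormedSpace ℝ E] [CompleteSpace E] [MeasurableSpace E] [BorelSpace E]
    [SecondCountableTopology E]
    (σ : VectorMeasure X E) (lam : Measure X) [IsFiniteMeasure lam] (w : X → E)
    (hw : Measurable w) (hσ : ∀ s, MeasurableSet s → σ s = ∫ x in s, w x ∂lam)
    (L : E →L[ℝ] ℝ) : IntegrableOn (fun x => L (w x)) {x | 0 ≤ L (w x)} lam := by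
  set A : ℕ → Set X := fun n => {x | 0 ≤ L (w x)} ∩ {x | ⌊‖w x‖⌋₊ = n} with hA
  have hAm : ∀ n, MeasurableSet (A n) := by
    intro n
    refine (measurableSet_le measurable_const (L.measurable.comp hw)).inter ?_
    exact (Nat.measurable_floor.comp hw.norm) (measurableSet_singleton n)
  have hAu : (⋃ n, A n) = {x | 0 ≤ L (w x)} := by
    ext x; simp [hA]
  have hAd : Pairwise (Function.onFun Disjoint A) := by
    intro i j hij
    refine Set.disjoint_left.2 ?_
    rintro x ⟨_, h1⟩ ⟨_, h2⟩
    exact hij (h1.symm.trans h2)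
  have hbd : ∀ n, ∀ x ∈ A n, ‖w x‖ ≤ n + 1 := by
    rintro n x ⟨_, h1⟩
    have := (Nat.lt_floor_add_one ‖w x‖).le
    have h1' : ⌊‖w x‖⌋₊ = n := h1
    rwa [h1'] at this
  have hi : ∀ n, IntegrableOn w (A n) lam := by
    intro n
    refine Measure.integrableOn_of_bounded (M := (n:ℝ) + 1) (measure_ne_top _ _)
      hw.aestronglyMeasurable ?_
    filter_upwards [ae_restrict_mem (hAm n)] with x hx using hbd n x hx
  rw [← hAu]
  refine integrableOn_iUnion_of_summable_integral_norm ?_ ?_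
  · intro n; exact L.integrable_comp (hi n)
  · have hs := (σ.m_iUnion hAm hAd).mapL L
    refine hs.summable.congr ?_
    intro n
    rw [hσ _ (hAm n), ← L.integral_comp_comm (hi n)]
    refine setIntegral_congr_fun (hAm n) ?_
    intro x hx
    exact (Real.norm_of_nonneg hx.1).symm

lemma integrable_clm_of_density {X E : Type*} [MeasurableSpace X] [NormedAddCommGroup E]
    [NormedSpace ℝ E] [CompleteSpace E] [MeasurableSpace E] [BorelSpace E]
    [SecondCountableTopology E]
    (σ : VectorMeasure X E) (lam : Measure X) [IsFiniteMeasure lam] (w : X → E)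
    (hw : Measurable w) (hσ : ∀ s, MeasurableSet s → σ s = ∫ x in s, w x ∂lam)
    (L : E →L[ℝ] ℝ) : Integrable (fun x => L (w x)) lam := by
  have h1 := integrable_clm_of_density_aux σ lam w hw hσ L
  have h2 := (integrable_clm_of_density_aux σ lam w hw hσ (-L)).neg
  have h3 : IntegrableOn (fun x => L (w x)) {x | 0 ≤ (-L) (w x)} lam := by
    refine h2.congr (ae_of_all _ ?_)
    intro x; simp
  rw [← integrableOn_univ]
  refine (h1.union h3).mono_set ?_
  intro x _
  rcases le_total 0 (L (w x)) with h | h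
  · left; exact h
  · right; simpa using h

lemma IsDensityS.integrable {σ : SignedMeasure (XX d)} {lam : Measure (XX d)}
    [IsFiniteMeasure lam] {u : XX d → ℝ} (h : IsDensityS σ lam u) (hu : Measurable u) :
    Integrable u lam :=
  integrable_clm_of_density σ lam u hu h (ContinuousLinearMap.id ℝ ℝ)

lemma integrable_euc {X : Type*} [MeasurableSpace X] {lam : Measure X} {w : X → Euc d}
    (h : ∀ i, Integrable (fun x => w x i) lam) : Integrable w lam := by
  have h1 : Integrable (fun x => ∑ i, EuclideanSpace.single i (w x i)) lam := by
    refine integrable_finsetSum _ ?_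
    intro i _
    have := (h i).smul_const (EuclideanSpace.single i (1:ℝ) : Euc d)
    refine this.congr (ae_of_all _ ?_)
    intro x
    ext j
    by_cases hj : j = i <;> simp [hj]
  refine h1.congr (ae_of_all _ ?_)
  intro x
  ext j
  simp [Finset.sum_apply]

lemma IsDensityV.integrable {m : VectorMeasure (XX d) (Euc d)} {lam : Measure (XX d)}
    [IsFiniteMeasure lam] {w : XX d → Euc d} (h : IsDensityV m lam w) (hw : Measurable w) :
    Integrable w lam := by
  refine integrable_euc ?_
  intro i
  exact integrable_clm_of_density m lam w hw h (EuclideanSpace.proj i)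

lemma setIntegral_withDensity_ofReal {X E : Type*} [MeasurableSpace X] [NormedAddCommGroup E]
    [NormedSpace ℝ E] (lam : Measure X) (r : X → ℝ) (hr : Measurable r)
    (h0 : 0 ≤ᵐ[lam] r) (f : X → E) (s : Set X) (hs : MeasurableSet s) :
    ∫ x in s, f x ∂(lam.withDensity fun x => ENNReal.ofReal (r x)) = ∫ x in s, r x • f x ∂lam := by
  rw [restrict_withDensity hs,
    integral_withDensity_eq_integral_toReal_smul (by fun_prop) (by simp)]
  refine integral_congr_ae ?_
  filter_upwards [ae_restrict_of_ae h0] with x hx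
  rw [ENNReal.toReal_ofReal hx]

lemma integral_withDensity_ofReal {X E : Type*} [MeasurableSpace X] [NormedAddCommGroup E]
    [NormedSpace ℝ E] (lam : Measure X) (r : X → ℝ) (hr : Measurable r)
    (h0 : 0 ≤ᵐ[lam] r) (f : X → E) :
    ∫ x, f x ∂(lam.withDensity fun x => ENNReal.ofReal (r x)) = ∫ x, r x • f x ∂lam := by
  have := setIntegral_withDensity_ofReal lam r hr h0 f univ MeasurableSet.univ
  simpa using this

lemma integrable_withDensity_ofReal {X E : Type*} [MeasurableSpace X] [NormedAddCommGroup E]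
    [NormedSpace ℝ E] (lam : Measure X) (r : X → ℝ) (hr : Measurable r)
    (h0 : 0 ≤ᵐ[lam] r) (f : X → E) :
    Integrable f (lam.withDensity fun x => ENNReal.ofReal (r x)) ↔
      Integrable (fun x => r x • f x) lam := by
  rw [integrable_withDensity_iff_integrable_smul' (by fun_prop) (by simp)]
  refine integrable_congr ?_
  filter_upwards [h0] with x hx
  rw [ENNReal.toReal_ofReal hx]

lemma Rep.dens {p : Mtriple d} {P : Measure (XX d)} {v : XX d → Euc d} {g : XX d → ℝ}
    (h : Rep p P v g) {lam : Measure (XX d)} (hlam : IsFiniteMeasure lam)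
    {r : XX d → ℝ} {w : XX d → Euc d} {u : XX d → ℝ}
    (hr : Measurable r) (hw : Measurable w) (hu : Measurable u)
    (h1 : IsDensityS p.1 lam r) (h2 : IsDensityV p.2.1 lam w) (h3 : IsDensityS p.2.2 lam u) :
    0 ≤ᵐ[lam] r ∧ P = lam.withDensity (fun x => ENNReal.ofReal (r x)) ∧
      w =ᵐ[lam] (fun x => r x • v x) ∧ u =ᵐ[lam] (fun x => r x * g x) := by
  have hfin := h.fin
  have ir := h1.integrable hr
  have iw := h2.integrable hw
  have iu := h3.integrable hu
  have r0 : 0 ≤ᵐ[lam] r := by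
    refine ae_nonneg_of_forall_setIntegral_nonneg ir ?_
    intro s hs _
    rw [← h1 s hs, h.h1 s hs]
    exact measureReal_nonneg
  have hP : P = lam.withDensity (fun x => ENNReal.ofReal (r x)) := by
    ext s hs
    rw [withDensity_apply _ hs, ← ofReal_integral_eq_lintegral_ofReal ir.integrableOn
      (ae_restrict_of_ae r0), ← h1 s hs, h.h1 s hs, ofReal_measureReal]
  refine ⟨r0, hP, ?_, ?_⟩
  · refine Integrable.ae_eq_of_forall_setIntegral_eq _ _ iw ?_ ?_
    · rw [← integrable_withDensity_ofReal lam r hr r0, ← hP]; exact h.iv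
    · intro s hs _
      rw [← setIntegral_withDensity_ofReal lam r hr r0 _ s hs, ← hP, ← h.h2 s hs, h2 s hs]
  · refine Integrable.ae_eq_of_forall_setIntegral_eq _ _ iu ?_ ?_
    · have := h.ig
      rw [hP, integrable_withDensity_ofReal lam r hr r0] at this
      exact this
    · intro s hs _
      have := setIntegral_withDensity_ofReal lam r hr r0 g s hs
      simp only [smul_eq_mul] at this
      rw [← this, ← hP, ← h.h3 s hs, h3 s hs]

/-- weak continuity equation for `(P, v P, g P)`. -/
def CE (P : Measure (XX d)) (v : XX d → Euc d) (g : XX d → ℝ) : Prop :=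
  ∀ φ : XX d → ℝ, IsTest φ → ∫ x, Lop v g φ x ∂P = 0

lemma fderiv_split (φ : XX d → ℝ) (x : XX d) (a : ℝ) (y : Euc d) :
    fderiv ℝ φ x (a, y) = a * fderiv ℝ φ x ((1:ℝ), (0 : Euc d)) + fderiv ℝ φ x ((0:ℝ), y) := by
  have : ((a, y) : XX d) = a • ((1:ℝ), (0 : Euc d)) + ((0:ℝ), y) := by
    ext <;> simp
  rw [this, map_add, map_smul, smul_eq_mul]

lemma Rep.solves_iff {p : Mtriple d} {P : Measure (XX d)} {v : XX d → Euc d} {g : XX d → ℝ}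
    (h : Rep p P v g) : SolvesCESigned p.1 p.2.1 p.2.2 ↔ CE P v g := by
  have hfin := h.fin
  constructor
  · intro H φ hφ
    have := H P h.fin (fun _ => 1) v g measurable_const h.mv h.mg
      (fun s hs => by simp [h.h1 s hs, Measure.real]) h.h2 h.h3 φ hφ
    rw [← this]
    refine integral_congr_ae (ae_of_all _ ?_)
    intro x
    simp only [Lop]
    rw [fderiv_split φ x 1 (v x)]
    ring
  · intro H lam hlam r w u hr hw hu h1 h2 h3 φ hφ
    obtain ⟨r0, hP, ew, eu⟩ := h.dens hlam hr hw hu h1 h2 h3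
    have := H φ hφ
    rw [hP, integral_withDensity_ofReal lam r hr r0] at this
    refine Eq.trans (integral_congr_ae ?_) this
    filter_upwards [ew, eu] with x e1 e2
    have e3 : (((0:ℝ), r x • v x) : XX d) = r x • ((0:ℝ), v x) := by ext <;> simp
    simp only [Lop, smul_eq_mul]
    rw [e1, e2, e3, map_smul, fderiv_split φ x 1 (v x), smul_eq_mul]
    ring

/-- energy density -/
def eden (δ : ℝ) (v : XX d → Euc d) (g : XX d → ℝ) (x : XX d) : ℝ :=
  (‖v x‖ ^ 2 + δ ^ 2 * g x ^ 2) / 2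

lemma eden_nonneg (δ : ℝ) (v : XX d → Euc d) (g : XX d → ℝ) (x : XX d) : 0 ≤ eden δ v g x := by
  unfold eden; positivity

lemma eden_measurable {δ : ℝ} {v : XX d → Euc d} {g : XX d → ℝ} (hv : Measurable v)
    (hg : Measurable g) : Measurable (eden δ v g) := by
  unfold eden; fun_prop

lemma psi_eq {δ r : ℝ} (hr : 0 ≤ r) (y : Euc d) (z : ℝ) :
    Psi δ r (r • y) (r * z) = ENNReal.ofReal r * ENNReal.ofReal ((‖y‖ ^ 2 + δ ^ 2 * z ^ 2) / 2) := by
  unfold Psi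
  rcases hr.eq_or_lt with h | h
  · subst h; simp
  · rw [if_pos h, ← ENNReal.ofReal_mul hr, norm_smul, Real.norm_of_nonneg hr]
    congr 1
    field_simp

lemma Rep.bdelta {p : Mtriple d} {P : Measure (XX d)} {v : XX d → Euc d} {g : XX d → ℝ}
    (h : Rep p P v g) (δ : ℝ) :
    BdeltaSigned δ p.1 p.2.1 p.2.2 = ∫⁻ x, ENNReal.ofReal (eden δ v g x) ∂P := by
  have hfin := h.fin
  unfold BdeltaSigned
  refine le_antisymm (sInf_le ?_) (le_sInf ?_)
  · refine ⟨P, h.fin, fun _ => 1, v, g, measurable_const, h.mv, h.mg,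
      (fun s hs => by simp [h.h1 s hs, Measure.real]), h.h2, h.h3, ?_⟩
    refine lintegral_congr ?_
    intro x
    have := psi_eq (δ := δ) (zero_le_one) (v x) (g x)
    simp only [one_smul, one_mul, ENNReal.ofReal_one] at this
    rw [this, eden]
  · rintro c ⟨lam, hlam, r, w, u, hr, hw, hu, h1, h2, h3, rfl⟩
    obtain ⟨r0, hP, ew, eu⟩ := h.dens hlam hr hw hu h1 h2 h3
    rw [hP, lintegral_withDensity_eq_lintegral_mul _ (by fun_prop)
      ((eden_measurable h.mv h.mg).ennreal_ofReal)]
    refine le_of_eq (lintegral_congr_ae ?_)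
    filter_upwards [ew, eu, r0] with x e1 e2 e3
    rw [e1, e2, psi_eq e3]
    rfl

lemma Rep.tv {p : Mtriple d} {P : Measure (XX d)} {v : XX d → Euc d} {g : XX d → ℝ}
    (h : Rep p P v g) : p.1.totalVariation Set.univ = P Set.univ := by
  have hfin := h.fin
  have : p.1 = P.toSignedMeasure := by
    ext s hs
    rw [h.h1 s hs, Measure.toSignedMeasure_apply_measurable hs]
  have h2 : P.toSignedMeasure.toJordanDecomposition = JordanDecomposition.mk P 0
      (Measure.MutuallySingular.zero_right) := by
    rw [← JordanDecomposition.toSignedMeasure_injective.eq_iff]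
    rw [SignedMeasure.toSignedMeasure_toJordanDecomposition]
    simp [JordanDecomposition.toSignedMeasure]
  rw [this, SignedMeasure.totalVariation, h2]
  simp

open Classical in
lemma Rep.J_eq {p : Mtriple d} {P : Measure (XX d)} {v : XX d → Euc d} {g : XX d → ℝ}
    (h : Rep p P v g) {α β : ℝ} (hα : 0 < α) (hβ : 0 < β) (δ : ℝ) :
    JSigned α β δ p.1 p.2.1 p.2.2 = if CE P v g then
      ∫⁻ x, ENNReal.ofReal (β * eden δ v g x + α) ∂P else ⊤ := by
  unfold JSigned
  simp only [h.solves_iff]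
  congr 1
  rw [h.bdelta, h.tv]
  have : ∀ x, ENNReal.ofReal (β * eden δ v g x + α) =
      ENNReal.ofReal β * ENNReal.ofReal (eden δ v g x) + ENNReal.ofReal α := by
    intro x
    rw [ENNReal.ofReal_add (mul_nonneg hβ.le (eden_nonneg _ _ _ _)) hα.le,
      ENNReal.ofReal_mul hβ.le]
  simp only [this]
  rw [lintegral_add_right _ measurable_const, lintegral_const_mul _
    ((eden_measurable h.mv h.mg).ennreal_ofReal), lintegral_const]

lemma exists_rep {p : Mtriple d} {α β δ : ℝ} (hα : 0 < α) (hβ : 0 < β) (hδ : 0 < δ)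
    (hJ : JSigned α β δ p.1 p.2.1 p.2.2 ≠ ⊤) :
    ∃ P v g, Rep p P v g := by
  unfold JSigned at hJ
  split_ifs at hJ with hs
  swap
  · exact absurd rfl hJ
  have hB : BdeltaSigned δ p.1 p.2.1 p.2.2 ≠ ⊤ := by
    intro hB
    rw [hB, ENNReal.mul_top (by simpa using hβ), top_add] at hJ
    exact hJ rfl
  have hB2 := lt_top_iff_ne_top.2 hB
  unfold BdeltaSigned at hB2
  rw [sInf_lt_iff] at hB2
  obtain ⟨c, ⟨lam, hlam, r, w, u, hr, hw, hu, h1, h2, h3, rfl⟩, hc⟩ := hB2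
  have ir := h1.integrable hr
  have iw := h2.integrable hw
  have iu := h3.integrable hu
  have hmeas : Measurable fun x => Psi δ (r x) (w x) (u x) := by
    unfold Psi
    refine Measurable.ite (measurableSet_lt measurable_const hr) (by fun_prop) ?_
    refine Measurable.ite ?_ measurable_const measurable_const
    exact (hr (measurableSet_singleton 0)).inter
      ((hw (measurableSet_singleton 0)).inter (hu (measurableSet_singleton 0)))
  have hae := ae_lt_top hmeas hc.ne
  have hkey : ∀ᵐ x ∂lam, 0 ≤ r x ∧ w x = r x • ((r x)⁻¹ • w x) ∧ u x = r x * ((r x)⁻¹ * u x) := by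
    filter_upwards [hae] with x hx
    unfold Psi at hx
    split_ifs at hx with h4 h5
    · refine ⟨h4.le, ?_, ?_⟩
      · rw [smul_smul, mul_inv_cancel₀ h4.ne', one_smul]
      · rw [← mul_assoc, mul_inv_cancel₀ h4.ne', one_mul]
    · obtain ⟨a, b, c⟩ := h5
      simp [a, b, c]
    · simp at hx
  have r0 : 0 ≤ᵐ[lam] r := hkey.mono fun x hx => hx.1
  have hfin : IsFiniteMeasure (lam.withDensity fun x => ENNReal.ofReal (r x)) :=
    isFiniteMeasure_withDensity_ofReal ir.2
  refine ⟨lam.withDensity fun x => ENNReal.ofReal (r x), fun x => (r x)⁻¹ • w x,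
    fun x => (r x)⁻¹ * u x, hfin, by fun_prop, by fun_prop, ?_, ?_, ?_, ?_, ?_⟩
  · rw [integrable_withDensity_ofReal lam r hr r0]
    exact iw.congr (hkey.mono fun x hx => hx.2.1)
  · rw [integrable_withDensity_ofReal lam r hr r0]
    exact iu.congr (hkey.mono fun x hx => hx.2.2)
  · intro s hs
    rw [Measure.real, withDensity_apply _ hs, ← ofReal_integral_eq_lintegral_ofReal ir.integrableOn
      (ae_restrict_of_ae r0), ENNReal.toReal_ofReal, h1 s hs]
    exact integral_nonneg_of_ae (ae_restrict_of_ae r0)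
  · intro s hs
    rw [setIntegral_withDensity_ofReal lam r hr r0 _ s hs, h2 s hs]
    exact integral_congr_ae (ae_restrict_of_ae (hkey.mono fun x hx => hx.2.1))
  · intro s hs
    rw [setIntegral_withDensity_ofReal lam r hr r0 _ s hs, h3 s hs]
    exact integral_congr_ae (ae_restrict_of_ae (hkey.mono fun x hx => hx.2.2))

lemma Rep.ext {p q : Mtriple d} {P : Measure (XX d)} {v : XX d → Euc d} {g : XX d → ℝ}
    (h : Rep p P v g) (h' : Rep q P v g) : p = q := by
  refine Prod.ext ?_ (Prod.ext ?_ ?_)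
  · ext s hs; rw [h.h1 s hs, h'.h1 s hs]
  · ext1 s hs; rw [h.h2 s hs, h'.h2 s hs]
  · ext s hs; rw [h.h3 s hs, h'.h3 s hs]

/-- the triple `f (P, v P, g P)`. -/
def scale (P : Measure (XX d)) (v : XX d → Euc d) (g : XX d → ℝ) (f : XX d → ℝ) : Mtriple d :=
  (P.withDensityᵥ f, P.withDensityᵥ (fun x => f x • v x), P.withDensityᵥ (fun x => f x * g x))

lemma Rep.scale_rep {p : Mtriple d} {P : Measure (XX d)} {v : XX d → Euc d} {g : XX d → ℝ}
    (h : Rep p P v g) {f : XX d → ℝ} (hf : Measurable f) (h0 : ∀ x, 0 ≤ f x) {C : ℝ}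
    (hC : ∀ x, f x ≤ C) :
    Rep (scale P v g f) (P.withDensity fun x => ENNReal.ofReal (f x)) v g := by
  have hfin := h.fin
  have r0 : 0 ≤ᵐ[P] f := ae_of_all _ h0
  have hb : ∀ x, ‖f x‖ ≤ C := fun x => by rw [Real.norm_of_nonneg (h0 x)]; exact hC x
  have iff : Integrable f P := Integrable.of_bound hf.aestronglyMeasurable C (ae_of_all _ hb)
  have iv : Integrable (fun x => f x • v x) P :=
    h.iv.bdd_smul C hf.aestronglyMeasurable (ae_of_all _ hb)
  have ig : Integrable (fun x => f x * g x) P :=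
    h.ig.bdd_mul (c := C) hf.aestronglyMeasurable (ae_of_all _ hb)
  refine ⟨isFiniteMeasure_withDensity_ofReal iff.2, h.mv, h.mg, ?_, ?_, ?_, ?_, ?_⟩
  · rw [integrable_withDensity_ofReal P f hf r0]; exact iv
  · rw [integrable_withDensity_ofReal P f hf r0]; exact ig
  · intro s hs
    rw [Measure.real, withDensity_apply _ hs, ← ofReal_integral_eq_lintegral_ofReal iff.integrableOn
      (ae_restrict_of_ae r0), ENNReal.toReal_ofReal, scale, withDensityᵥ_apply iff hs]
    exact integral_nonneg_of_ae (ae_restrict_of_ae r0)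
  · intro s hs
    rw [setIntegral_withDensity_ofReal P f hf r0 _ s hs, scale, withDensityᵥ_apply iv hs]
  · intro s hs
    rw [setIntegral_withDensity_ofReal P f hf r0 _ s hs, scale, withDensityᵥ_apply ig hs]
    simp

open Classical in
lemma Rep.scale_J {p : Mtriple d} {P : Measure (XX d)} {v : XX d → Euc d} {g : XX d → ℝ}
    (h : Rep p P v g) {f : XX d → ℝ} (hf : Measurable f) (h0 : ∀ x, 0 ≤ f x) {C : ℝ}
    (hC : ∀ x, f x ≤ C) {α β : ℝ} (hα : 0 < α) (hβ : 0 < β) (δ : ℝ) :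
    JSigned α β δ (scale P v g f).1 (scale P v g f).2.1 (scale P v g f).2.2 =
      if (∀ φ, IsTest φ → ∫ x, f x * Lop v g φ x ∂P = 0) then
      ∫⁻ x, ENNReal.ofReal (f x) * ENNReal.ofReal (β * eden δ v g x + α) ∂P else ⊤ := by
  rw [(h.scale_rep hf h0 hC).J_eq hα hβ]
  have e1 : CE (P.withDensity fun x => ENNReal.ofReal (f x)) v g ↔
      (∀ φ, IsTest φ → ∫ x, f x * Lop v g φ x ∂P = 0) := by
    unfold CE
    simp only [integral_withDensity_ofReal P f hf (ae_of_all _ h0), smul_eq_mul]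
  simp only [e1]
  rw [lintegral_withDensity_eq_lintegral_mul _ (by fun_prop)
      (((eden_measurable h.mv h.mg).const_mul β |>.add_const α).ennreal_ofReal)]
  rfl

/-- smooth cutoff of `(0,a)`. -/
def wcut (a : ℝ) (n : ℕ) (t : ℝ) : ℝ :=
  Real.smoothTransition (n * t - 1) * Real.smoothTransition (n * (a - t) - 1)

lemma wcut_contDiff (a : ℝ) (n : ℕ) : ContDiff ℝ (⊤ : ℕ∞) (wcut a n) := by
  unfold wcut
  exact (Real.smoothTransition.contDiff.comp (by fun_prop)).mul
    (Real.smoothTransition.contDiff.comp (by fun_prop))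

lemma wcut_nonneg (a : ℝ) (n : ℕ) (t : ℝ) : 0 ≤ wcut a n t :=
  mul_nonneg (Real.smoothTransition.nonneg _) (Real.smoothTransition.nonneg _)

lemma wcut_le_one (a : ℝ) (n : ℕ) (t : ℝ) : wcut a n t ≤ 1 :=
  mul_le_one₀ (Real.smoothTransition.le_one _) (Real.smoothTransition.nonneg _)
    (Real.smoothTransition.le_one _)

lemma wcut_eq_zero {a : ℝ} {n : ℕ} {t : ℝ} (hn : 0 < n) (h : t ≤ 1 / n ∨ a - 1 / n ≤ t) :
    wcut a n t = 0 := by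
  have hn' : (0:ℝ) < n := by exact_mod_cast hn
  unfold wcut
  rcases h with h | h
  · rw [Real.smoothTransition.zero_of_nonpos, zero_mul]
    have := mul_le_mul_of_nonneg_left h hn'.le
    rw [mul_one_div_cancel hn'.ne'] at this
    linarith
  · rw [Real.smoothTransition.zero_of_nonpos (x := n * (a - t) - 1), mul_zero]
    have : a - t ≤ 1 / n := by linarith
    have := mul_le_mul_of_nonneg_left this hn'.le
    rw [mul_one_div_cancel hn'.ne'] at this
    linarith

lemma wcut_tendsto (a : ℝ) {t : ℝ} (ht : t ∈ Ioo 0 a) :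
    Tendsto (fun n : ℕ => wcut a n t) atTop (𝓝 1) := by
  apply tendsto_const_nhds.congr'
  have h1 := (tendsto_natCast_atTop_atTop (R := ℝ)).atTop_mul_const ht.1
  have h2 := (tendsto_natCast_atTop_atTop (R := ℝ)).atTop_mul_const (sub_pos.2 ht.2)
  filter_upwards [h1.eventually_ge_atTop 2, h2.eventually_ge_atTop 2] with n e1 e2
  unfold wcut
  rw [Real.smoothTransition.one_of_one_le (by linarith),
    Real.smoothTransition.one_of_one_le (by linarith), one_mul]

lemma wcut_tendsto' (a : ℝ) (t : ℝ) :
    Tendsto (fun n : ℕ => wcut a n t) atTop (𝓝 ((Ioo 0 a).indicator (fun _ => (1:ℝ)) t)) := by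
  by_cases ht : t ∈ Ioo 0 a
  · rw [indicator_of_mem ht]; exact wcut_tendsto a ht
  · rw [indicator_of_notMem ht]
    apply tendsto_const_nhds.congr'
    filter_upwards [eventually_gt_atTop 0] with n hn
    rw [wcut_eq_zero hn]
    have : (0:ℝ) < 1 / n := by positivity
    simp only [mem_Ioo, not_and_or, not_lt] at ht
    rcases ht with h | h
    · left; linarith
    · right; linarith

/-- admissible time test functions -/
def IsTest1 (b : ℝ → ℝ) : Prop :=
  ContDiff ℝ (⊤ : ℕ∞) b ∧ HasCompactSupport b ∧ tsupport b ⊆ Ioo (0:ℝ) 1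

lemma tsupport_subset_Icc {b : ℝ → ℝ} {l u : ℝ} (h : ∀ t, t ≤ l ∨ u ≤ t → b t = 0) :
    tsupport b ⊆ Icc l u := by
  refine closure_minimal ?_ isClosed_Icc
  intro t ht
  by_contra hc
  simp only [mem_Icc, not_and_or, not_le] at hc
  apply ht
  apply h
  rcases hc with h | h
  · exact Or.inl h.le
  · exact Or.inr h.le

lemma isTest1_of_Icc {b : ℝ → ℝ} (hb : ContDiff ℝ (⊤ : ℕ∞) b) {l u : ℝ} (hl : 0 < l) (hu : u < 1)
    (h : ∀ t, t ≤ l ∨ u ≤ t → b t = 0) : IsTest1 b := by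
  have := tsupport_subset_Icc h
  exact ⟨hb, isCompact_Icc.of_isClosed_subset (isClosed_tsupport b) this,
    this.trans (Icc_subset_Ioo hl hu)⟩

lemma isTest1_primitive {z : ℝ → ℝ} (hz : ContDiff ℝ (⊤ : ℕ∞) z) {l u : ℝ} (hl : 0 < l) (hu : u < 1)
    (hlu : l ≤ u)
    (h : ∀ t, t ≤ l ∨ u ≤ t → z t = 0) (h0 : ∫ t in (0:ℝ)..1, z t = 0) :
    IsTest1 (fun t => ∫ s in (0:ℝ)..t, z s) ∧ deriv (fun t => ∫ s in (0:ℝ)..t, z s) = z := by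
  have hc : Continuous z := hz.continuous
  have hd : ∀ t, HasDerivAt (fun t => ∫ s in (0:ℝ)..t, z s) (z t) t := fun t =>
    intervalIntegral.integral_hasDerivAt_right (hc.intervalIntegrable _ _)
      (hc.stronglyMeasurableAtFilter _ _) hc.continuousAt
  have hde : deriv (fun t => ∫ s in (0:ℝ)..t, z s) = z := funext fun t => (hd t).deriv
  refine ⟨isTest1_of_Icc ?_ hl hu ?_, hde⟩
  · rw [contDiff_infty_iff_deriv]
    refine ⟨fun t => (hd t).differentiableAt, ?_⟩
    rw [hde]; exact hz
  · have key : ∀ x y, (∀ t ∈ uIcc x y, z t = 0) → ∫ s in x..y, z s = 0 := by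
      intro x y hxy
      rw [intervalIntegral.integral_congr (g := fun _ => (0:ℝ)) hxy]; simp
    intro t ht
    rcases ht with ht | ht
    · apply key
      intro s hs
      apply h; left
      have := hs.2
      refine this.trans ?_
      simp [hl.le, ht]
    · change ∫ s in (0:ℝ)..t, z s = 0
      rw [← intervalIntegral.integral_add_adjacent_intervals (b := 1) (hc.intervalIntegrable _ _)
        (hc.intervalIntegrable _ _), h0, zero_add]
      apply key
      intro s hs
      apply h; right
      refine le_trans ?_ hs.1
      simp [hu.le, ht]

section dBR
variable {X : Type*} [MeasurableSpace X]

/-- the trace function. -/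
def Tr (P : Measure X) (τ A B : X → ℝ) (t : ℝ) : ℝ :=
  (∫ x, (A x - (1 - τ x) * B x) ∂P) + ∫ x in {x | τ x < t}, B x ∂P

lemma dbr_aux (P : Measure X) [IsFiniteMeasure P] {τ A B : X → ℝ} (hτ : Measurable τ)
    (hτ01 : ∀ᵐ x ∂P, τ x ∈ Ioo (0:ℝ) 1) (iA : Integrable A P) (iB : Integrable B P)
    (H : ∀ b, IsTest1 b → ∫ x, (deriv b (τ x) * A x + b (τ x) * B x) ∂P = 0)
    {a : ℝ} (ha : 0 < a) (ha1 : a ≤ 1) :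
    ∫ x, (((Iio a).indicator (fun _ => (1:ℝ)) (τ x) - a) * A x
      + (min (τ x) a - a * τ x) * B x) ∂P = 0 := by
  set I : ℝ → ℕ → ℝ := fun c n => ∫ t in (0:ℝ)..1, wcut c n t with hI
  have hInt : ∀ c, ∀ t ∈ Icc (0:ℝ) 1, 0 < c → c ≤ 1 →
      Tendsto (fun n : ℕ => ∫ s in (0:ℝ)..t, wcut c n s) atTop (𝓝 (min t c)) := by
    intro c t ht hc0 hc1
    have e : ∫ s in (0:ℝ)..t, (Ioo 0 c).indicator (fun _ => (1:ℝ)) s = min t c := by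
      rw [intervalIntegral.integral_of_le ht.1, setIntegral_indicator measurableSet_Ioo]
      have : (Ioc 0 t ∩ Ioo 0 c : Set ℝ) =ᵐ[volume] Ioc 0 (min t c) := by
        have h1 : (Ioc 0 t ∩ Ioo 0 c : Set ℝ) =ᵐ[volume] (Ioc 0 t ∩ Ioc 0 c : Set ℝ) :=
          (ae_eq_refl _).inter Ioo_ae_eq_Ioc
        rw [Ioc_inter_Ioc] at h1
        simpa using h1
      rw [setIntegral_congr_set this]
      simp [ht.1, hc0.le]
    rw [← e]
    refine intervalIntegral.tendsto_integral_filter_of_dominated_convergence (fun _ => (1:ℝ)) ?_ ?_ ?_ ?_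
    · exact Eventually.of_forall fun n => (wcut_contDiff c n).continuous.aestronglyMeasurable
    · refine Eventually.of_forall fun n => ae_of_all _ fun s _ => ?_
      rw [Real.norm_of_nonneg (wcut_nonneg _ _ _)]; exact wcut_le_one _ _ _
    · simp
    · exact ae_of_all _ fun s _ => wcut_tendsto' c s
  have hIa : Tendsto (I a) atTop (𝓝 a) := by
    simpa [ha1] using hInt a 1 (by simp) ha ha1
  have hI1 : Tendsto (I 1) atTop (𝓝 1) := by
    simpa using hInt 1 1 (by simp) one_pos le_rfl
  set c : ℕ → ℝ := fun n => I a n / I 1 n with hc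
  have hct : Tendsto c atTop (𝓝 a) := by
    have := hIa.div hI1 one_ne_zero
    rw [div_one] at this
    exact this
  set z : ℕ → ℝ → ℝ := fun n t => wcut a n t - c n * wcut 1 n t with hz
  set b : ℕ → ℝ → ℝ := fun n t => ∫ s in (0:ℝ)..t, z n s with hb
  have zc : ∀ n, ContDiff ℝ (⊤ : ℕ∞) (z n) := fun n =>
    (wcut_contDiff a n).sub (contDiff_const.mul (wcut_contDiff 1 n))
  have hzero : ∀ᶠ n in atTop, ∫ x, (z n (τ x) * A x + b n (τ x) * B x) ∂P = 0 := by
    filter_upwards [eventually_gt_atTop 2, hI1.eventually_ne one_ne_zero] with n hn hne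
    have hn' : (2:ℝ) < n := by exact_mod_cast hn
    have hnn : (1:ℝ) / n < 1 / 2 := by
      apply one_div_lt_one_div_of_lt <;> linarith
    have hnp : (0:ℝ) < 1 / n := by positivity
    have key := isTest1_primitive (zc n) (l := 1 / n) (u := 1 - 1 / n) hnp (by linarith) (by linarith)
      (by
        intro t ht
        simp only [hz]
        rw [wcut_eq_zero (a := a) (by omega), wcut_eq_zero (a := 1) (by omega) ht]
        · simp
        · rcases ht with h | h
          · exact Or.inl h
          · right; linarith)
      (by
        simp only [hz]
        rw [intervalIntegral.integral_sub
          ((wcut_contDiff a n).continuous.intervalIntegrable _ _)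
          (((wcut_contDiff 1 n).continuous.intervalIntegrable _ _).const_mul (c n)),
          intervalIntegral.integral_const_mul]
        change I a n - c n * I 1 n = 0
        simp only [hc]
        field_simp
        ring)
    have := H _ key.1
    rw [key.2] at this
    exact this
  obtain ⟨K, hK⟩ : ∃ K, ∀ᶠ n in atTop, |c n| ≤ K :=
    ⟨|a| + 1, (hct.abs).eventually_le_const (by linarith)⟩
  have hzb : ∀ᶠ n in atTop, ∀ t, |z n t| ≤ 1 + K := by
    filter_upwards [hK] with n hn t
    simp only [hz]
    have h1 : |wcut a n t| ≤ 1 := by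
      rw [abs_of_nonneg (wcut_nonneg _ _ _)]; exact wcut_le_one _ _ _
    have h2 : |wcut 1 n t| ≤ 1 := by
      rw [abs_of_nonneg (wcut_nonneg _ _ _)]; exact wcut_le_one _ _ _
    calc _ ≤ |wcut a n t| + |c n * wcut 1 n t| := abs_sub _ _
      _ ≤ 1 + K := by
        rw [abs_mul]
        have : |c n| * |wcut 1 n t| ≤ K * 1 :=
          mul_le_mul hn h2 (abs_nonneg _) ((abs_nonneg _).trans hn)
        linarith
  have hlim : Tendsto (fun n => ∫ x, (z n (τ x) * A x + b n (τ x) * B x) ∂P) atTop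
      (𝓝 (∫ x, (((Iio a).indicator (fun _ => (1:ℝ)) (τ x) - a) * A x
      + (min (τ x) a - a * τ x) * B x) ∂P)) := by
    refine tendsto_integral_filter_of_dominated_convergence
      (fun x => (1 + K) * |A x| + (1 + K) * |B x|) ?_ ?_ ?_ ?_
    · refine Eventually.of_forall fun n => ?_
      have bc : Continuous (b n) :=
        intervalIntegral.continuous_primitive (fun _ _ => (zc n).continuous.intervalIntegrable _ _) 0
      exact ((((zc n).continuous.measurable.comp hτ).aestronglyMeasurable).mul iA.1).add
        (((bc.measurable.comp hτ).aestronglyMeasurable).mul iB.1)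
    · filter_upwards [hzb] with n hn
      filter_upwards [hτ01] with x hx
      have hbb : |b n (τ x)| ≤ 1 + K := by
        have := intervalIntegral.norm_integral_le_of_norm_le_const (a := 0) (b := τ x) (f := z n)
          (C := 1 + K) (fun s _ => hn s)
        refine this.trans ?_
        have : |τ x - 0| ≤ 1 := by rw [sub_zero, abs_of_pos hx.1]; exact hx.2.le
        calc (1 + K) * |τ x - 0| ≤ (1 + K) * 1 :=
              mul_le_mul_of_nonneg_left this ((abs_nonneg _).trans (hn 0))
          _ = _ := mul_one _
      refine (norm_add_le _ _).trans ?_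
      simp only [norm_mul, Real.norm_eq_abs]
      gcongr
      exact hn _
    · exact (iA.abs.const_mul _).add (iB.abs.const_mul _)
    · filter_upwards [hτ01] with x hx
      have t1 : Tendsto (fun n => z n (τ x)) atTop (𝓝 ((Iio a).indicator (fun _ => (1:ℝ)) (τ x) - a)) := by
        have := (wcut_tendsto' a (τ x)).sub (hct.mul (wcut_tendsto' 1 (τ x)))
        rw [indicator_of_mem hx, mul_one] at this
        have e : (Ioo 0 a).indicator (fun _ => (1:ℝ)) (τ x) = (Iio a).indicator (fun _ => (1:ℝ)) (τ x) := by
          simp [indicator, hx.1]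
        rw [← e]; exact this
      have t2 : Tendsto (fun n => b n (τ x)) atTop (𝓝 (min (τ x) a - a * τ x)) := by
        have := (hInt a (τ x) ⟨hx.1.le, hx.2.le⟩ ha ha1).sub
          (hct.mul (hInt 1 (τ x) ⟨hx.1.le, hx.2.le⟩ one_pos le_rfl))
        rw [min_eq_left hx.2.le] at this
        refine this.congr fun n => ?_
        simp only [hb, hz]
        rw [intervalIntegral.integral_sub
          ((wcut_contDiff a n).continuous.intervalIntegrable _ _)
          (((wcut_contDiff 1 n).continuous.intervalIntegrable _ _).const_mul (c n)),
          intervalIntegral.integral_const_mul]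
      exact (t1.mul_const _).add (t2.mul_const _)
  exact tendsto_nhds_unique (hlim) (tendsto_const_nhds.congr' (hzero.mono fun n hn => hn.symm))


lemma Tr_measurable (P : Measure X) [IsFiniteMeasure P] {τ A B : X → ℝ} (hτ : Measurable τ)
    (iB : Integrable B P) : Measurable (Tr P τ A B) := by
  have h1 : Tr P τ A B = fun t => (∫ x, (A x - (1 - τ x) * B x) ∂P)
      + ((∫ x in {x | τ x < t}, (|B x| + B x) ∂P) - ∫ x in {x | τ x < t}, |B x| ∂P) := by
    funext t
    unfold Tr
    rw [integral_add iB.abs.integrableOn iB.integrableOn]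
    ring
  have mono : ∀ f : X → ℝ, Integrable f P → (∀ x, 0 ≤ f x) →
      Measurable fun t => ∫ x in {x | τ x < t}, f x ∂P := by
    intro f hf h0
    apply Monotone.measurable
    intro s t hst
    exact setIntegral_mono_set hf.integrableOn (ae_of_all _ h0)
      (HasSubset.Subset.eventuallyLE (fun x hx => lt_of_lt_of_le hx hst))
  rw [h1]
  refine measurable_const.add ((mono _ (iB.abs.add iB) ?_).sub (mono _ iB.abs fun x => abs_nonneg _))
  intro x
  have := neg_abs_le (B x)
  simp only [Pi.add_apply]
  linarith

lemma Tr_bound (P : Measure X) [IsFiniteMeasure P] {τ A B : X → ℝ}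
    (iB : Integrable B P) (t : ℝ) :
    ‖Tr P τ A B t‖ ≤ ‖∫ x, (A x - (1 - τ x) * B x) ∂P‖ + ∫ x, ‖B x‖ ∂P := by
  unfold Tr
  refine (norm_add_le _ _).trans ?_
  gcongr
  refine (norm_integral_le_integral_norm _).trans ?_
  exact setIntegral_le_integral iB.norm (ae_of_all _ fun x => norm_nonneg _)

lemma Tr_integrableOn (P : Measure X) [IsFiniteMeasure P] {τ A B : X → ℝ} (hτ : Measurable τ)
    (iB : Integrable B P) {s : Set ℝ} (hs : volume s ≠ ⊤) : IntegrableOn (Tr P τ A B) s := by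
  have : Fact (volume s < ⊤) := ⟨hs.lt_top⟩
  exact Integrable.of_bound (Tr_measurable P hτ iB).aestronglyMeasurable _
    (ae_of_all _ fun t => Tr_bound P iB t)

lemma dbr_Iio (P : Measure X) [IsFiniteMeasure P] {τ A B : X → ℝ} (hτ : Measurable τ)
    (hτ01 : ∀ᵐ x ∂P, τ x ∈ Ioo (0:ℝ) 1) (iA : Integrable A P) (iB : Integrable B P)
    (H : ∀ b, IsTest1 b → ∫ x, (deriv b (τ x) * A x + b (τ x) * B x) ∂P = 0)
    {a : ℝ} (ha : 0 < a) (ha1 : a ≤ 1) :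
    ∫ x in {x | τ x < a}, A x ∂P = ∫ t in Ioo 0 a, Tr P τ A B t := by
  have h0 := dbr_aux P hτ hτ01 iA iB H ha ha1
  have bdd : ∀ (f : X → ℝ) (C : ℝ), Measurable f → (∀ᵐ x ∂P, |f x| ≤ C) →
      ∀ G : X → ℝ, Integrable G P → Integrable (fun x => f x * G x) P := by
    intro f C hf hC G hG
    exact hG.bdd_mul hf.aestronglyMeasurable hC
  have i1 : Integrable (fun x => (Iio a).indicator (fun _ => (1:ℝ)) (τ x) * A x) P := by
    refine bdd _ 1 ?_ ?_ _ iA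
    · exact (measurable_const.indicator measurableSet_Iio).comp hτ
    · refine ae_of_all _ fun x => ?_
      by_cases h : τ x ∈ Iio a <;> simp [h]
  have i2 : Integrable (fun x => min (τ x) a * B x) P := by
    refine bdd _ 1 (hτ.min measurable_const) ?_ _ iB
    filter_upwards [hτ01] with x hx
    rw [abs_of_pos (lt_min hx.1 ha)]
    exact (min_le_right _ _).trans ha1
  have i3 : Integrable (fun x => τ x * B x) P := by
    refine bdd _ 1 hτ ?_ _ iB
    filter_upwards [hτ01] with x hx
    rw [abs_of_pos hx.1]; exact hx.2.le
  have e1 : ∫ x, (((Iio a).indicator (fun _ => (1:ℝ)) (τ x) - a) * A x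
      + (min (τ x) a - a * τ x) * B x) ∂P
      = (∫ x in {x | τ x < a}, A x ∂P) - a * (∫ x, A x ∂P) + ((∫ x, min (τ x) a * B x ∂P)
        - a * ∫ x, τ x * B x ∂P) := by
    have e0 : ∫ x in {x | τ x < a}, A x ∂P
        = ∫ x, (Iio a).indicator (fun _ => (1:ℝ)) (τ x) * A x ∂P := by
      rw [← integral_indicator (show MeasurableSet {x | τ x < a} from hτ measurableSet_Iio)]
      refine integral_congr_ae (ae_of_all _ fun x => ?_)
      by_cases h : τ x < a <;> simp [indicator, h]
    rw [e0, ← integral_const_mul, ← integral_const_mul, ← integral_sub i1 (iA.const_mul a),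
      ← integral_sub i2 (i3.const_mul a), ← integral_add
        (show Integrable (fun x => (Iio a).indicator (fun _ => (1:ℝ)) (τ x) * A x - a * A x) P from
          i1.sub (iA.const_mul a))
        (show Integrable (fun x => min (τ x) a * B x - a * (τ x * B x)) P from
          i2.sub (i3.const_mul a))]
    refine integral_congr_ae (ae_of_all _ fun x => ?_)
    simp only []
    ring
  have e2 : ∫ t in Ioo 0 a, Tr P τ A B t = a * (∫ x, A x ∂P) - a * (∫ x, B x ∂P)
      + a * (∫ x, τ x * B x ∂P) + (a * (∫ x, B x ∂P) - ∫ x, min (τ x) a * B x ∂P) := by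
    unfold Tr
    have iF : Integrable (Function.uncurry fun (t : ℝ) (x : X) =>
        {x | τ x < t}.indicator B x) ((volume.restrict (Ioo 0 a)).prod P) := by
      have hB : Integrable (fun q : ℝ × X => B q.2) ((volume.restrict (Ioo 0 a)).prod P) :=
        iB.comp_snd _
      have hS : MeasurableSet {q : ℝ × X | τ q.2 < q.1} :=
        measurableSet_lt (hτ.comp measurable_snd) measurable_fst
      refine (hB.indicator hS).congr (ae_of_all _ fun q => ?_)
      simp [Function.uncurry, indicator]
    have e3 : ∫ t in Ioo 0 a, ∫ x in {x | τ x < t}, B x ∂P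
        = a * (∫ x, B x ∂P) - ∫ x, min (τ x) a * B x ∂P := by
      have : ∀ t, ∫ x in {x | τ x < t}, B x ∂P = ∫ x, {x | τ x < t}.indicator B x ∂P := fun t =>
        (integral_indicator (hτ measurableSet_Iio)).symm
      simp only [this]
      rw [integral_integral_swap iF, ← integral_const_mul, ← integral_sub (iB.const_mul a) i2]
      refine integral_congr_ae ?_
      filter_upwards [hτ01] with x hx
      have : (fun t => {x | τ x < t}.indicator B x) = (Ioi (τ x)).indicator (fun _ => B x) := by
        funext t; simp [indicator]
      rw [this, setIntegral_indicator measurableSet_Ioi]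
      have : Ioo 0 a ∩ Ioi (τ x) = Ioo (τ x) a := by
        ext t; simp only [mem_inter_iff, mem_Ioo, mem_Ioi]
        constructor
        · rintro ⟨⟨_, h⟩, h'⟩; exact ⟨h', h⟩
        · rintro ⟨h', h⟩; exact ⟨⟨hx.1.trans h', h⟩, h'⟩
      rw [this]
      rcases le_total (τ x) a with h | h
      · simp [h]; ring
      · simp [h]
    rw [integral_add, e3]
    · have : ∫ x, (A x - (1 - τ x) * B x) ∂P = (∫ x, A x ∂P) - (∫ x, B x ∂P) + ∫ x, τ x * B x ∂P := by
        rw [← integral_sub iA iB, ← integral_add (show Integrable (fun x => A x - B x) P from iA.sub iB) i3]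
        refine integral_congr_ae (ae_of_all _ fun x => ?_)
        simp only [Pi.sub_apply]; ring
      rw [this]
      simp [ha.le]; ring
    · exact integrable_const _
    · have := Tr_integrableOn P (A := fun _ => 0) hτ iB (s := Ioo 0 a) (by simp)
      have h2 := this.sub (integrable_const (μ := volume.restrict (Ioo 0 a))
        (∫ x, ((0:ℝ) - (1 - τ x) * B x) ∂P))
      refine h2.congr (ae_of_all _ fun t => ?_)
      simp [Tr]
  rw [e1] at h0
  rw [e2]
  linarith

lemma dbr_set (P : Measure X) [IsFiniteMeasure P] {τ A B : X → ℝ} (hτ : Measurable τ)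
    (hτ01 : ∀ᵐ x ∂P, τ x ∈ Ioo (0:ℝ) 1) (iA : Integrable A P) (iB : Integrable B P)
    (H : ∀ b, IsTest1 b → ∫ x, (deriv b (τ x) * A x + b (τ x) * B x) ∂P = 0)
    {s : Set ℝ} (hs : MeasurableSet s) :
    ∫ x in τ ⁻¹' s, A x ∂P = ∫ t in s ∩ Ioo 0 1, Tr P τ A B t := by
  have iT : IntegrableOn (Tr P τ A B) (Ioo 0 1) := Tr_integrableOn P hτ iB (by simp)
  have tot : ∫ x, A x ∂P = ∫ t in Ioo 0 1, Tr P τ A B t := by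
    rw [← dbr_Iio P hτ hτ01 iA iB H one_pos le_rfl, ← integral_indicator (show MeasurableSet {x | τ x < 1} from hτ measurableSet_Iio)]
    refine integral_congr_ae ?_
    filter_upwards [hτ01] with x hx
    simp [indicator, hx.2]
  induction s, hs using MeasurableSpace.induction_on_inter (borel_eq_generateFrom_Iio ℝ ▸ BorelSpace.measurable_eq) isPiSystem_Iio with
  | empty => simp
  | basic t ht =>
    obtain ⟨a, rfl⟩ := ht
    rcases le_or_gt a 0 with h | h
    · have e1 : Iio a ∩ Ioo 0 1 = ∅ := by
        ext t; simp only [mem_inter_iff, mem_Iio, mem_Ioo, mem_empty_iff_false, iff_false]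
        rintro ⟨h1, h2, _⟩; linarith
      rw [e1]
      simp only [Measure.restrict_empty, integral_zero_measure]
      rw [← integral_indicator (hτ measurableSet_Iio)]
      rw [← integral_zero X ℝ (μ := P)]
      refine integral_congr_ae ?_
      filter_upwards [hτ01] with x hx
      have : ¬ τ x < a := by have := hx.1; linarith
      simp [indicator, this]
    · rcases le_or_gt a 1 with h1 | h1
      · have e1 : Iio a ∩ Ioo 0 1 = Ioo 0 a := by
          ext t; simp only [mem_inter_iff, mem_Iio, mem_Ioo]
          constructor
          · rintro ⟨h1, h2, _⟩; exact ⟨h2, h1⟩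
          · rintro ⟨h2, h3⟩; exact ⟨h3, h2, h3.trans_le h1⟩
        rw [e1]
        exact dbr_Iio P hτ hτ01 iA iB H h h1
      · have e1 : Iio a ∩ Ioo 0 1 = Ioo 0 1 := by
          apply inter_eq_right.2
          intro t ht; exact ht.2.trans h1
        rw [e1, ← tot, ← integral_indicator (hτ measurableSet_Iio)]
        refine integral_congr_ae ?_
        filter_upwards [hτ01] with x hx
        have := hx.2.trans h1
        simp [indicator, this]
  | compl t ht ih =>
    have h1 := integral_add_compl (hτ ht) iA
    have h2 := integral_inter_add_diff ht iT
    have e : tᶜ ∩ Ioo 0 1 = Ioo 0 1 \ t := by ext x; simp [and_comm]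
    rw [preimage_compl, e]
    rw [inter_comm] at ih
    linarith
  | iUnion f hd hf ih =>
    have h1 := hasSum_integral_iUnion (μ := P) (f := A) (fun i => hτ (hf i))
      (fun i j hij => (hd hij).preimage τ) iA.integrableOn
    have h2 := hasSum_integral_iUnion (μ := volume) (f := Tr P τ A B) (s := fun i => f i ∩ Ioo 0 1)
      (fun i => (hf i).inter measurableSet_Ioo)
      (fun i j hij => (hd hij).mono inter_subset_left inter_subset_left)
      (iT.mono_set (iUnion_subset fun i => inter_subset_right))
    rw [preimage_iUnion, iUnion_inter]
    simp only [ih] at h1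
    exact h1.unique h2

lemma dbr_fun (P : Measure X) [IsFiniteMeasure P] {τ A B : X → ℝ} (hτ : Measurable τ)
    (hτ01 : ∀ᵐ x ∂P, τ x ∈ Ioo (0:ℝ) 1) (iA : Integrable A P) (iB : Integrable B P)
    (H : ∀ b, IsTest1 b → ∫ x, (deriv b (τ x) * A x + b (τ x) * B x) ∂P = 0)
    {w : ℝ → ℝ} (hw : Measurable w) {C : ℝ} (hC : ∀ t, |w t| ≤ C) :
    ∫ x, w (τ x) * A x ∂P = ∫ t in Ioo 0 1, w t * Tr P τ A B t := by
  have iT : IntegrableOn (Tr P τ A B) (Ioo 0 1) := Tr_integrableOn P hτ iB (by simp)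
  have simple : ∀ f : SimpleFunc ℝ ℝ,
      ∫ x, f (τ x) * A x ∂P = ∫ t in Ioo 0 1, f t * Tr P τ A B t := by
    intro f
    induction f using SimpleFunc.induction with
    | const c hs =>
      rename_i s
      have e1 : ∀ x, (SimpleFunc.piecewise s hs (SimpleFunc.const ℝ c) (SimpleFunc.const ℝ 0)) (τ x) * A x
          = (τ ⁻¹' s).indicator (fun x => c * A x) x := by
        intro x; by_cases h : τ x ∈ s <;> simp [h, indicator]
      have e2 : ∀ t, (SimpleFunc.piecewise s hs (SimpleFunc.const ℝ c) (SimpleFunc.const ℝ 0)) t * Tr P τ A B t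
          = s.indicator (fun t => c * Tr P τ A B t) t := by
        intro x; by_cases h : x ∈ s <;> simp [h, indicator]
      simp only [e1, e2]
      rw [integral_indicator (hτ hs), integral_indicator hs, integral_const_mul, integral_const_mul,
        Measure.restrict_restrict hs, dbr_set P hτ hτ01 iA iB H hs]
    | add _ h1 h2 =>
      rename_i f g hfg
      have b1 : ∀ f : SimpleFunc ℝ ℝ, Integrable (fun x => f (τ x) * A x) P := by
        intro f
        obtain ⟨C, hC⟩ := f.exists_forall_norm_le
        exact iA.bdd_mul (f.measurable.comp hτ).aestronglyMeasurable (ae_of_all _ fun x => hC _)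
      have b2 : ∀ f : SimpleFunc ℝ ℝ, Integrable (fun x => f x * Tr P τ A B x) (volume.restrict (Ioo 0 1)) := by
        intro f
        obtain ⟨C, hC⟩ := f.exists_forall_norm_le
        exact iT.bdd_mul (f.measurable).aestronglyMeasurable (ae_of_all _ fun x => hC _)
      simp only [SimpleFunc.coe_add, Pi.add_apply, add_mul]
      rw [integral_add (b1 _) (b1 _), integral_add (b2 _) (b2 _), h1, h2]
  have hsm := hw.stronglyMeasurable
  have C0 : 0 ≤ C := (abs_nonneg _).trans (hC 0)
  set F := hsm.approxBounded C
  have Fl : ∀ t, Tendsto (fun n => F n t) atTop (𝓝 (w t)) := fun t =>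
    hsm.tendsto_approxBounded_of_norm_le (hC t)
  have Fb : ∀ n t, ‖F n t‖ ≤ C := fun n t => hsm.norm_approxBounded_le C0 n t
  have l1 : Tendsto (fun n => ∫ x, F n (τ x) * A x ∂P) atTop (𝓝 (∫ x, w (τ x) * A x ∂P)) := by
    refine tendsto_integral_of_dominated_convergence (fun x => C * ‖A x‖) ?_ (iA.norm.const_mul C) ?_ ?_
    · intro n; exact (((F n).measurable.comp hτ).aestronglyMeasurable).mul iA.1
    · intro n; refine ae_of_all _ fun x => ?_
      rw [norm_mul]; gcongr; exact Fb _ _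
    · exact ae_of_all _ fun x => (Fl _).mul_const _
  have l2 : Tendsto (fun n => ∫ t in Ioo 0 1, F n t * Tr P τ A B t) atTop
      (𝓝 (∫ t in Ioo 0 1, w t * Tr P τ A B t)) := by
    refine tendsto_integral_of_dominated_convergence (fun x => C * ‖Tr P τ A B x‖) ?_ (iT.norm.const_mul C) ?_ ?_
    · intro n; exact (((F n).measurable).aestronglyMeasurable).mul iT.1
    · intro n; refine ae_of_all _ fun x => ?_
      rw [norm_mul]; gcongr; exact Fb _ _
    · exact ae_of_all _ fun x => (Fl _).mul_const _
  simp only [simple] at l1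
  exact tendsto_nhds_unique l1 l2

end dBR

/-- The standing assumptions. -/
structure Setting (Ω : Set (Euc d)) (P : Measure (XX d)) (v : XX d → Euc d) (g : XX d → ℝ) :
    Prop where
  fin : IsFiniteMeasure P
  mv : Measurable v
  mg : Measurable g
  cpt : IsCompact Ω
  conc : P (Ioo (0:ℝ) 1 ×ˢ Ω)ᶜ = 0
  v2 : MemLp v 2 P
  g2 : MemLp g 2 P
  ce : CE P v g

/-- Test functions with compact support in time only. -/
def TestT (Φ : XX d → ℝ) : Prop :=
  ContDiff ℝ (⊤ : ℕ∞) Φ ∧ ∃ l u : ℝ, 0 < l ∧ u < 1 ∧ ∀ x : XX d, x.1 ≤ l ∨ u ≤ x.1 → Φ x = 0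

lemma cutoff {Ω : Set (Euc d)} (hΩ : IsCompact Ω) {Φ : XX d → ℝ} (hΦ : TestT Φ) :
    ∃ φ, IsTest φ ∧ ∀ x : XX d, x.2 ∈ Ω → φ =ᶠ[𝓝 x] Φ := by
  obtain ⟨hs, l, u, hl, hu, h0⟩ := hΦ
  obtain ⟨R, hR0, hR⟩ := hΩ.isBounded.subset_ball_lt 0 (0 : Euc d)
  let χ : ContDiffBump (0 : Euc d) := ⟨R, R + 1, hR0, by linarith⟩
  refine ⟨fun x => χ x.2 * Φ x, ⟨?_, ?_, ?_⟩, ?_⟩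
  · exact (χ.contDiff.comp contDiff_snd).mul hs
  · refine HasCompactSupport.intro (K := Icc l u ×ˢ Metric.closedBall (0 : Euc d) (R + 1))
      (isCompact_Icc.prod (isCompact_closedBall _ _)) ?_
    intro x hx
    simp only [mem_prod, not_and_or] at hx
    rcases hx with hx | hx
    · rw [h0 x, mul_zero]
      simp only [mem_Icc, not_and_or, not_le] at hx
      exact hx.imp le_of_lt le_of_lt
    · have : χ x.2 = 0 := by
        apply χ.zero_of_le_dist
        simp only [Metric.mem_closedBall, not_le] at hx
        exact hx.le
      rw [this, zero_mul]
  · have : tsupport (fun x : XX d => χ x.2 * Φ x) ⊆ Icc l u ×ˢ (Set.univ : Set (Euc d)) := by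
      refine closure_minimal ?_ (isClosed_Icc.prod isClosed_univ)
      intro x hx
      refine ⟨?_, mem_univ _⟩
      by_contra hc
      apply hx
      simp only []
      rw [h0 x, mul_zero]
      simp only [mem_Icc, not_and_or, not_le] at hc
      exact hc.imp le_of_lt le_of_lt
    exact this.trans (prod_mono (Icc_subset_Ioo hl hu) subset_rfl)
  · intro x hx
    have h1 : ∀ᶠ y in 𝓝 x.2, χ y = 1 := χ.eventuallyEq_one_of_mem_ball (hR hx)
    filter_upwards [continuous_snd.continuousAt.eventually h1] with y hy
    rw [hy, one_mul]

lemma Lop_congr {v : XX d → Euc d} {g : XX d → ℝ} {φ ψ : XX d → ℝ} {x : XX d}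
    (h : φ =ᶠ[𝓝 x] ψ) : Lop v g φ x = Lop v g ψ x := by
  unfold Lop
  rw [h.fderiv_eq, h.eq_of_nhds]

lemma Lop_add {v : XX d → Euc d} {g : XX d → ℝ} {φ ψ : XX d → ℝ}
    (h : ContDiff ℝ (⊤ : ℕ∞) φ) (h' : ContDiff ℝ (⊤ : ℕ∞) ψ) (x : XX d) :
    Lop v g (fun x => φ x + ψ x) x = Lop v g φ x + Lop v g ψ x := by
  unfold Lop
  rw [fderiv_fun_add ((h.differentiable (by simp)) x) ((h'.differentiable (by simp)) x)]
  simp; ring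

lemma Lop_mul {v : XX d → Euc d} {g : XX d → ℝ} {φ ψ : XX d → ℝ}
    (h : ContDiff ℝ (⊤ : ℕ∞) φ) (h' : ContDiff ℝ (⊤ : ℕ∞) ψ) (x : XX d) :
    Lop v g (fun x => φ x * ψ x) x = φ x * Lop v g ψ x + fderiv ℝ φ x ((1:ℝ), v x) * ψ x := by
  unfold Lop
  rw [fderiv_fun_mul ((h.differentiable (by simp)) x) ((h'.differentiable (by simp)) x)]
  simp; ring

lemma Lop_const_mul {v : XX d → Euc d} {g : XX d → ℝ} {ψ : XX d → ℝ} (c : ℝ)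
    (h' : ContDiff ℝ (⊤ : ℕ∞) ψ) (x : XX d) :
    Lop v g (fun x => c * ψ x) x = c * Lop v g ψ x := by
  rw [Lop_mul contDiff_const h']
  simp

lemma Lop_comp {v : XX d → Euc d} {g : XX d → ℝ} {ψ : XX d → ℝ} {G : ℝ → ℝ}
    (hG : ContDiff ℝ (⊤ : ℕ∞) G)
    (h' : ContDiff ℝ (⊤ : ℕ∞) ψ) (x : XX d) :
    Lop v g (fun x => G (ψ x)) x =
      deriv G (ψ x) * Lop v g ψ x + g x * (G (ψ x) - ψ x * deriv G (ψ x)) := by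
  unfold Lop
  have h1 : HasFDerivAt (fun x => G (ψ x)) (deriv G (ψ x) • fderiv ℝ ψ x) x :=
    ((hG.differentiable (by simp)) (ψ x)).hasDerivAt.comp_hasFDerivAt x
      ((h'.differentiable (by simp)) x).hasFDerivAt
  rw [h1.fderiv]
  simp; ring

lemma Lop_time {v : XX d → Euc d} {g : XX d → ℝ} {ψ : XX d → ℝ} {b : ℝ → ℝ}
    (hb : ContDiff ℝ (⊤ : ℕ∞) b)
    (h' : ContDiff ℝ (⊤ : ℕ∞) ψ) (x : XX d) :
    Lop v g (fun x => b x.1 * ψ x) x = deriv b x.1 * ψ x + b x.1 * Lop v g ψ x := by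
  have hb1 : ContDiff ℝ (⊤ : ℕ∞) (fun x : XX d => b x.1) := hb.comp contDiff_fst
  rw [Lop_mul hb1 h']
  have h1 : HasFDerivAt (fun x : XX d => b x.1)
      (deriv b x.1 • ContinuousLinearMap.fst ℝ ℝ (Euc d)) x :=
    ((hb.differentiable (by simp)) x.1).hasDerivAt.comp_hasFDerivAt x hasFDerivAt_fst
  rw [h1.fderiv]
  simp; ring

lemma Lop_measurable {v : XX d → Euc d} {g : XX d → ℝ} (hv : Measurable v) (hg : Measurable g)
    {Φ : XX d → ℝ} (hΦ : ContDiff ℝ (⊤ : ℕ∞) Φ) : Measurable (Lop v g Φ) := by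
  have hc : Continuous fun q : XX d × Euc d => fderiv ℝ Φ q.1 ((1:ℝ), q.2) :=
    ((hΦ.continuous_fderiv (by simp)).comp continuous_fst).clm_apply (by fun_prop)
  exact (hc.measurable.comp (measurable_id.prodMk hv)).add (hΦ.continuous.measurable.mul hg)

namespace Setting
variable {Ω : Set (Euc d)} {P : Measure (XX d)} {v : XX d → Euc d} {g : XX d → ℝ}

lemma ae_mem (S : Setting Ω P v g) : ∀ᵐ x ∂P, x.1 ∈ Ioo (0:ℝ) 1 ∧ x.2 ∈ Ω := by
  have := S.conc
  rw [ae_iff]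
  exact this

lemma ae_time (S : Setting Ω P v g) : ∀ᵐ x ∂P, x.1 ∈ Ioo (0:ℝ) 1 := S.ae_mem.mono fun _ h => h.1

lemma exists_bound (S : Setting Ω P v g) {E : Type*} [NormedAddCommGroup E] {Φ : XX d → E}
    (hΦ : Continuous Φ) : ∃ C, 0 ≤ C ∧ ∀ x : XX d, x.1 ∈ Icc (0:ℝ) 1 → x.2 ∈ Ω → ‖Φ x‖ ≤ C := by
  obtain ⟨C, hC⟩ := (isCompact_Icc.prod S.cpt).exists_bound_of_continuousOn
    (f := Φ) (s := Icc (0:ℝ) 1 ×ˢ Ω) hΦ.continuousOn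
  exact ⟨max C 0, le_max_right _ _, fun x h1 h2 => (hC x ⟨h1, h2⟩).trans (le_max_left _ _)⟩

lemma integrable_cont (S : Setting Ω P v g) {Φ : XX d → ℝ} (hΦ : Continuous Φ) :
    Integrable Φ P := by
  have := S.fin
  obtain ⟨C, _, hC⟩ := S.exists_bound hΦ
  refine Integrable.of_bound hΦ.measurable.aestronglyMeasurable C ?_
  filter_upwards [S.ae_mem] with x hx
  exact hC x ⟨hx.1.1.le, hx.1.2.le⟩ hx.2

lemma memLp_Lop (S : Setting Ω P v g) {Φ : XX d → ℝ} (hΦ : ContDiff ℝ (⊤ : ℕ∞) Φ) :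
    MemLp (Lop v g Φ) 2 P := by
  have := S.fin
  obtain ⟨C1, hC10, hC1⟩ := S.exists_bound hΦ.continuous
  obtain ⟨C2, hC20, hC2⟩ := S.exists_bound (hΦ.continuous_fderiv (by simp))
  have h1 : MemLp (fun x => C2 * (1 + ‖v x‖) + C1 * ‖g x‖) 2 P :=
    (((memLp_const (1:ℝ)).add S.v2.norm).const_mul C2).add (S.g2.norm.const_mul C1)
  refine h1.mono' (Lop_measurable S.mv S.mg hΦ).aestronglyMeasurable ?_
  filter_upwards [S.ae_mem] with x hx
  have a1 := hC1 x ⟨hx.1.1.le, hx.1.2.le⟩ hx.2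
  have a2 := hC2 x ⟨hx.1.1.le, hx.1.2.le⟩ hx.2
  unfold Lop
  refine (norm_add_le _ _).trans ?_
  rw [norm_mul]
  gcongr
  refine (ContinuousLinearMap.le_opNorm _ _).trans ?_
  gcongr
  rw [Prod.norm_mk]
  simp

lemma integrable_Lop (S : Setting Ω P v g) {Φ : XX d → ℝ} (hΦ : ContDiff ℝ (⊤ : ℕ∞) Φ) :
    Integrable (Lop v g Φ) P := by
  have := S.fin
  exact (S.memLp_Lop hΦ).integrable (by norm_num)

lemma ceT (S : Setting Ω P v g) {Φ : XX d → ℝ} (hΦ : TestT Φ) : ∫ x, Lop v g Φ x ∂P = 0 := by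
  obtain ⟨φ, h1, h2⟩ := cutoff S.cpt hΦ
  rw [← S.ce φ h1]
  refine integral_congr_ae ?_
  filter_upwards [S.ae_mem] with x hx
  exact (Lop_congr (h2 x hx.2)).symm

lemma testT_mul {b : ℝ → ℝ} (hb : IsTest1 b) {Φ : XX d → ℝ} (hΦ : ContDiff ℝ (⊤ : ℕ∞) Φ) :
    TestT (fun x => b x.1 * Φ x) := by
  obtain ⟨h1, h2, h3⟩ := hb
  refine ⟨(h1.comp contDiff_fst).mul hΦ, ?_⟩
  by_cases hne : (tsupport b).Nonempty
  · obtain ⟨l, hl, hl'⟩ := h2.isCompact.exists_isLeast hne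
    obtain ⟨u, hu, hu'⟩ := h2.isCompact.exists_isGreatest hne
    have l0 := (h3 hl).1
    have u1 := (h3 hu).2
    refine ⟨l / 2, (u + 1) / 2, by linarith, by linarith, ?_⟩
    intro x hx
    have : b x.1 = 0 := by
      apply image_eq_zero_of_notMem_tsupport
      intro hm
      have := hl' hm
      have := hu' hm
      rcases hx with h | h <;> linarith
    simp only [this, zero_mul]
  · rw [not_nonempty_iff_eq_empty, tsupport_eq_empty_iff] at hne
    exact ⟨1/2, 1/2, by norm_num, by norm_num, fun x _ => by simp [hne]⟩

/-- time traces `T_Φ(t) = ∫ Φ(t,·) dρ_t`. -/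
def T (P : Measure (XX d)) (v : XX d → Euc d) (g : XX d → ℝ) (Φ : XX d → ℝ) (t : ℝ) : ℝ :=
  Tr P Prod.fst Φ (Lop v g Φ) t

lemma dbrH (S : Setting Ω P v g) {Φ : XX d → ℝ} (hΦ : ContDiff ℝ (⊤ : ℕ∞) Φ) :
    ∀ b, IsTest1 b → ∫ x : XX d, (deriv b x.1 * Φ x + b x.1 * Lop v g Φ x) ∂P = 0 := by
  intro b hb
  rw [← S.ceT (testT_mul hb hΦ)]
  refine integral_congr_ae (ae_of_all _ fun x => ?_)
  simp only [Lop_time hb.1 hΦ]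

lemma T_fun (S : Setting Ω P v g) {Φ : XX d → ℝ} (hΦ : ContDiff ℝ (⊤ : ℕ∞) Φ)
    {w : ℝ → ℝ} (hw : Measurable w) {C : ℝ} (hC : ∀ t, |w t| ≤ C) :
    ∫ x, w x.1 * Φ x ∂P = ∫ t in Ioo 0 1, w t * T P v g Φ t := by
  have := S.fin
  exact dbr_fun P measurable_fst S.ae_time (S.integrable_cont hΦ.continuous)
    (S.integrable_Lop hΦ) (S.dbrH hΦ) hw hC

lemma T_set (S : Setting Ω P v g) {Φ : XX d → ℝ} (hΦ : ContDiff ℝ (⊤ : ℕ∞) Φ)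
    {s : Set ℝ} (hs : MeasurableSet s) :
    ∫ x in Prod.fst ⁻¹' s, Φ x ∂P = ∫ t in s ∩ Ioo 0 1, T P v g Φ t := by
  have := S.fin
  exact dbr_set P measurable_fst S.ae_time (S.integrable_cont hΦ.continuous)
    (S.integrable_Lop hΦ) (S.dbrH hΦ) hs

lemma atomless (S : Setting Ω P v g) (t : ℝ) : ∀ᵐ x ∂P, x.1 ≠ t := by
  have := S.fin
  have h := S.T_set (Φ := fun _ => 1) contDiff_const (measurableSet_singleton t)
  have h0 : volume ({t} ∩ Ioo (0:ℝ) 1) = 0 :=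
    measure_mono_null inter_subset_left (measure_singleton t)
  rw [setIntegral_measure_zero _ h0] at h
  simp only [integral_const, smul_eq_mul, mul_one, measureReal_restrict_apply_univ] at h
  rw [ae_iff]
  have h3 := (measureReal_eq_zero_iff).1 h
  convert h3 using 2
  ext x; simp

lemma T_continuous (S : Setting Ω P v g) {Φ : XX d → ℝ} (hΦ : ContDiff ℝ (⊤ : ℕ∞) Φ) :
    Continuous (T P v g Φ) := by
  have := S.fin
  unfold T Tr
  refine continuous_const.add ?_
  have hm : ∀ t, MeasurableSet {x : XX d | x.1 < t} := fun t => measurable_fst measurableSet_Iio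
  simp_rw [← integral_indicator (hm _)]
  rw [continuous_iff_continuousAt]
  intro t0
  refine continuousAt_of_dominated (bound := fun x => ‖Lop v g Φ x‖) ?_ ?_
    (S.integrable_Lop hΦ).norm ?_
  · exact Eventually.of_forall fun t => ((S.integrable_Lop hΦ).indicator (hm t)).1
  · exact Eventually.of_forall fun t => ae_of_all _ fun x => norm_indicator_le_norm_self _ _
  · filter_upwards [S.atomless t0] with x hx
    rcases lt_or_gt_of_ne hx with h | h
    · apply continuousAt_const (y := Lop v g Φ x) |>.congr
      filter_upwards [eventually_gt_nhds h] with t ht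
      simp [indicator, ht]
    · apply continuousAt_const (y := (0:ℝ)) |>.congr
      filter_upwards [eventually_lt_nhds h] with t ht
      have : ¬ x.1 < t := by linarith
      simp [indicator, this]

lemma T_unique (S : Setting Ω P v g) {Φ : XX d → ℝ} (hΦ : ContDiff ℝ (⊤ : ℕ∞) Φ) {F : ℝ → ℝ}
    (hF : Continuous F)
    (h : ∀ s, MeasurableSet s → ∫ x in Prod.fst ⁻¹' s, Φ x ∂P = ∫ t in s ∩ Ioo 0 1, F t) :
    EqOn (T P v g Φ) F (Icc 0 1) := by
  have c1 := S.T_continuous hΦ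
  have i1 : IntegrableOn (T P v g Φ) (Ioo 0 1) :=
    (c1.integrableOn_Icc (a := 0) (b := 1)).mono_set Ioo_subset_Icc_self
  have i2 : IntegrableOn F (Ioo 0 1) :=
    (hF.integrableOn_Icc (a := 0) (b := 1)).mono_set Ioo_subset_Icc_self
  have ae : T P v g Φ =ᵐ[volume.restrict (Ioo 0 1)] F := by
    refine Integrable.ae_eq_of_forall_setIntegral_eq _ _ i1 i2 ?_
    intro s hs _
    rw [Measure.restrict_restrict hs, ← S.T_set hΦ hs, h s hs]
  have := Measure.eqOn_Ioo_of_ae_eq volume ae c1.continuousOn hF.continuousOn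
  rw [← closure_Ioo (zero_ne_one (α := ℝ))]
  exact this.closure c1 hF

lemma T_nonneg (S : Setting Ω P v g) {Φ : XX d → ℝ} (hΦ : ContDiff ℝ (⊤ : ℕ∞) Φ)
    (h0 : ∀ x : XX d, x.1 ∈ Ioo (0:ℝ) 1 → x.2 ∈ Ω → 0 ≤ Φ x) {t : ℝ} (ht : t ∈ Icc (0:ℝ) 1) :
    0 ≤ T P v g Φ t := by
  have c1 := S.T_continuous hΦ
  have i1 : IntegrableOn (T P v g Φ) (Ioo 0 1) :=
    (c1.integrableOn_Icc (a := 0) (b := 1)).mono_set Ioo_subset_Icc_self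
  have ae : 0 ≤ᵐ[volume.restrict (Ioo 0 1)] T P v g Φ := by
    refine ae_nonneg_of_forall_setIntegral_nonneg i1 ?_
    intro s hs _
    rw [Measure.restrict_restrict hs, ← S.T_set hΦ hs]
    refine integral_nonneg_of_ae (ae_restrict_of_ae ?_)
    filter_upwards [S.ae_mem] with x hx
    exact h0 x hx.1 hx.2
  have ae' : (fun t => min (T P v g Φ t) 0) =ᵐ[volume.restrict (Ioo 0 1)] fun _ => 0 := by
    filter_upwards [ae] with t ht
    exact min_eq_right ht
  have c2 : Continuous (fun t => min (T P v g Φ t) 0) := c1.min continuous_const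
  have := Measure.eqOn_Ioo_of_ae_eq volume ae' c2.continuousOn continuousOn_const
  have h3 := this.closure c2 continuous_const
  rw [closure_Ioo (zero_ne_one (α := ℝ))] at h3
  have := h3 ht
  simp only [] at this
  exact min_eq_right_iff.1 this

lemma T_add (S : Setting Ω P v g) {Φ Ψ : XX d → ℝ} (hΦ : ContDiff ℝ (⊤ : ℕ∞) Φ)
    (hΨ : ContDiff ℝ (⊤ : ℕ∞) Ψ) {t : ℝ} (ht : t ∈ Icc (0:ℝ) 1) :
    T P v g (fun x => Φ x + Ψ x) t = T P v g Φ t + T P v g Ψ t := by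
  refine S.T_unique (hΦ.add hΨ) (F := fun t => T P v g Φ t + T P v g Ψ t)
    ((S.T_continuous hΦ).add (S.T_continuous hΨ)) ?_ ht
  intro s hs
  have j : ∀ Φ, ContDiff ℝ (⊤ : ℕ∞) Φ → IntegrableOn (T P v g Φ) (s ∩ Ioo 0 1) := fun Φ hΦ =>
    ((S.T_continuous hΦ).integrableOn_Icc (a := 0) (b := 1)).mono_set
      (inter_subset_right.trans Ioo_subset_Icc_self)
  rw [integral_add (S.integrable_cont hΦ.continuous).integrableOn
    (S.integrable_cont hΨ.continuous).integrableOn, integral_add (j _ hΦ) (j _ hΨ),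
    S.T_set hΦ hs, S.T_set hΨ hs]

lemma T_time (S : Setting Ω P v g) {Φ : XX d → ℝ} (hΦ : ContDiff ℝ (⊤ : ℕ∞) Φ) {b : ℝ → ℝ}
    (hb : ContDiff ℝ (⊤ : ℕ∞) b) {t : ℝ} (ht : t ∈ Icc (0:ℝ) 1) :
    T P v g (fun x => b x.1 * Φ x) t = b t * T P v g Φ t := by
  refine S.T_unique ((hb.comp contDiff_fst).mul hΦ) (F := fun t => b t * T P v g Φ t)
    (hb.continuous.mul (S.T_continuous hΦ)) ?_ ht
  intro s hs
  obtain ⟨C, hC⟩ := (isCompact_Icc (a := (0:ℝ)) (b := 1)).exists_bound_of_continuousOn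
    hb.continuous.continuousOn
  have C0 : 0 ≤ C := (norm_nonneg _).trans (hC 0 (by simp))
  have := S.T_fun hΦ (w := (s ∩ Icc 0 1).indicator b)
    (hb.continuous.measurable.indicator (hs.inter measurableSet_Icc)) (C := C) (by
      intro t
      by_cases h : t ∈ s ∩ Icc 0 1
      · rw [indicator_of_mem h]; exact hC t h.2
      · rw [indicator_of_notMem h]; simpa using C0)
  rw [← integral_indicator (measurable_fst hs), ← Measure.restrict_restrict hs,
    ← integral_indicator hs]
  refine Eq.trans ?_ (this.trans ?_)
  · refine integral_congr_ae ?_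
    filter_upwards [S.ae_time] with x hx
    have hx' : x.1 ∈ Icc (0:ℝ) 1 := Ioo_subset_Icc_self hx
    by_cases h : x.1 ∈ s
    · rw [indicator_of_mem (show x ∈ Prod.fst ⁻¹' s from h), indicator_of_mem (show x.1 ∈ s ∩ Icc 0 1 from ⟨h, hx'⟩)]
      rfl
    · rw [indicator_of_notMem (show x ∉ Prod.fst ⁻¹' s from h), indicator_of_notMem (show x.1 ∉ s ∩ Icc 0 1 from fun hh => h hh.1)]
      simp
  · refine setIntegral_congr_fun measurableSet_Ioo ?_
    intro t hx
    have hx' : t ∈ Icc (0:ℝ) 1 := Ioo_subset_Icc_self hx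
    by_cases h : t ∈ s
    · simp only [indicator_of_mem h, indicator_of_mem (show t ∈ s ∩ Icc 0 1 from ⟨h, hx'⟩)]
    · simp only [indicator_of_notMem h, indicator_of_notMem (show t ∉ s ∩ Icc 0 1 from fun hh => h hh.1)]
      simp

lemma T_const_mul (S : Setting Ω P v g) {Φ : XX d → ℝ} (hΦ : ContDiff ℝ (⊤ : ℕ∞) Φ) (c : ℝ)
    {t : ℝ} (ht : t ∈ Icc (0:ℝ) 1) :
    T P v g (fun x => c * Φ x) t = c * T P v g Φ t :=
  S.T_time hΦ (b := fun _ => c) contDiff_const ht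

lemma T_le (S : Setting Ω P v g) {Φ Ψ : XX d → ℝ} (hΦ : ContDiff ℝ (⊤ : ℕ∞) Φ)
    (hΨ : ContDiff ℝ (⊤ : ℕ∞) Ψ)
    (h0 : ∀ x : XX d, x.1 ∈ Ioo (0:ℝ) 1 → x.2 ∈ Ω → Φ x ≤ Ψ x) {t : ℝ} (ht : t ∈ Icc (0:ℝ) 1) :
    T P v g Φ t ≤ T P v g Ψ t := by
  have h1 := S.T_nonneg (Φ := fun x => Ψ x + (-1) * Φ x) (hΨ.add (contDiff_const.mul hΦ))
    (fun x hx hx' => by have := h0 x hx hx'; linarith) ht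
  rw [S.T_add hΨ (contDiff_const.mul hΦ) ht, S.T_const_mul hΦ _ ht] at h1
  linarith

lemma T_prim (S : Setting Ω P v g) {Φ : XX d → ℝ} (t : ℝ) :
    T P v g Φ t = T P v g Φ 0 + ∫ x in {x : XX d | x.1 < t}, Lop v g Φ x ∂P := by
  unfold T Tr
  have : ∫ x in {x : XX d | x.1 < 0}, Lop v g Φ x ∂P = 0 := by
    apply setIntegral_measure_zero
    refine measure_mono_null ?_ S.conc
    intro x hx hx'
    have := hx'.1.1
    exact absurd hx (by simp; linarith)
  rw [this]; ring

lemma T_zero_of_testT (S : Setting Ω P v g) {Φ : XX d → ℝ} (hΦ : TestT Φ) : T P v g Φ 0 = 0 := by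
  obtain ⟨hs, l, u, hl, hu, h0⟩ := hΦ
  have hb : ContDiff ℝ (⊤ : ℕ∞) (fun t : ℝ => Real.smoothTransition (l⁻¹ * t)) :=
    Real.smoothTransition.contDiff.comp (by fun_prop)
  have := S.T_time hs hb (t := 0) (by simp)
  rw [mul_zero, Real.smoothTransition.zero, zero_mul] at this
  rw [← this]
  congr 1
  funext x
  rcases le_total x.1 l with h | h
  · rw [h0 x (Or.inl h), mul_zero]
  · rw [Real.smoothTransition.one_of_one_le, one_mul]
    rw [inv_mul_eq_div, le_div_iff₀ hl]; linarith

lemma T_testT (S : Setting Ω P v g) {Φ : XX d → ℝ} (hΦ : TestT Φ) (t : ℝ) :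
    T P v g Φ t = ∫ x in {x : XX d | x.1 < t}, Lop v g Φ x ∂P := by
  rw [S.T_prim, S.T_zero_of_testT hΦ, zero_add]

end Setting

/-- smooth positive part minus `ε/2` -/
def Hp (ε y : ℝ) : ℝ := (y + Real.sqrt (y ^ 2 + ε ^ 2)) / 2 - ε / 2

lemma Hp_contDiff {ε : ℝ} (hε : 0 < ε) : ContDiff ℝ (⊤ : ℕ∞) (Hp ε) := by
  unfold Hp
  have : ContDiff ℝ (⊤ : ℕ∞) fun y : ℝ => Real.sqrt (y ^ 2 + ε ^ 2) :=
    ContDiff.sqrt (by fun_prop) (fun y => by positivity)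
  fun_prop

lemma Hp_deriv {ε : ℝ} (hε : 0 < ε) (y : ℝ) :
    deriv (Hp ε) y = (1 + y / Real.sqrt (y ^ 2 + ε ^ 2)) / 2 := by
  have h0 : y ^ 2 + ε ^ 2 ≠ 0 := by positivity
  have h1 : HasDerivAt (fun y : ℝ => y ^ 2 + ε ^ 2) (2 * y) y := by
    simpa using (hasDerivAt_pow 2 y).add_const (ε ^ 2)
  have h2 := (((hasDerivAt_id y).add (h1.sqrt h0)).div_const 2).sub_const (ε / 2)
  have h3 : HasDerivAt (Hp ε) ((1 + 2 * y / (2 * Real.sqrt (y ^ 2 + ε ^ 2))) / 2) y := h2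
  rw [h3.deriv, mul_div_mul_left _ _ two_ne_zero]

lemma Hp_zero {ε : ℝ} (hε : 0 < ε) : Hp ε 0 = 0 := by
  unfold Hp; simp [Real.sqrt_sq hε.le]

lemma Hp_ge {ε : ℝ} (y : ℝ) : max y 0 ≤ Hp ε y + ε / 2 := by
  unfold Hp
  have h1 : |y| ≤ Real.sqrt (y ^ 2 + ε ^ 2) := by
    rw [← Real.sqrt_sq_eq_abs]
    exact Real.sqrt_le_sqrt (by nlinarith [sq_nonneg ε])
  have := le_abs_self y
  have := neg_abs_le y
  apply max_le <;> linarith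

lemma Hp_deriv_mem {ε : ℝ} (hε : 0 < ε) (y : ℝ) : deriv (Hp ε) y ∈ Icc (0:ℝ) 1 := by
  rw [Hp_deriv hε]
  have h0 : 0 < Real.sqrt (y ^ 2 + ε ^ 2) := Real.sqrt_pos.2 (by positivity)
  have h1 : |y| ≤ Real.sqrt (y ^ 2 + ε ^ 2) := by
    rw [← Real.sqrt_sq_eq_abs]
    exact Real.sqrt_le_sqrt (by nlinarith [sq_nonneg ε])
  have h2 : |y / Real.sqrt (y ^ 2 + ε ^ 2)| ≤ 1 := by
    rw [abs_div, abs_of_pos h0, div_le_one h0]; exact h1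
  have := abs_le.1 h2
  constructor <;> linarith

lemma Hp_err {ε : ℝ} (hε : 0 < ε) (y : ℝ) : |Hp ε y - y * deriv (Hp ε) y| ≤ ε / 2 := by
  rw [Hp_deriv hε]
  have h0 : 0 < Real.sqrt (y ^ 2 + ε ^ 2) := Real.sqrt_pos.2 (by positivity)
  have hs : Real.sqrt (y ^ 2 + ε ^ 2) ^ 2 = y ^ 2 + ε ^ 2 := Real.sq_sqrt (by positivity)
  have h1 : ε ≤ Real.sqrt (y ^ 2 + ε ^ 2) := by
    apply Real.le_sqrt_of_sq_le; nlinarith [sq_nonneg y]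
  have e : Hp ε y - y * ((1 + y / Real.sqrt (y ^ 2 + ε ^ 2)) / 2)
      = (ε * (ε / Real.sqrt (y ^ 2 + ε ^ 2)) - ε) / 2 := by
    unfold Hp
    set q := Real.sqrt (y ^ 2 + ε ^ 2)
    field_simp
    linear_combination hs
  rw [e]
  have h2 : 0 ≤ ε / Real.sqrt (y ^ 2 + ε ^ 2) := by positivity
  have h3 : ε / Real.sqrt (y ^ 2 + ε ^ 2) ≤ 1 := by rw [div_le_one h0]; exact h1
  rw [abs_le]
  constructor <;> nlinarith

lemma TestT.add {φ ψ : XX d → ℝ} (h : TestT φ) (h' : TestT ψ) : TestT (fun x => φ x + ψ x) := by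
  obtain ⟨hs, l, u, hl, hu, h0⟩ := h
  obtain ⟨hs', l', u', hl', hu', h0'⟩ := h'
  refine ⟨hs.add hs', min l l', max u u', lt_min hl hl', max_lt hu hu', ?_⟩
  intro x hx
  change φ x + ψ x = 0
  rw [h0, h0', add_zero]
  · exact hx.imp (fun h => h.trans (min_le_right _ _)) (fun h => (le_max_right _ _).trans h)
  · exact hx.imp (fun h => h.trans (min_le_left _ _)) (fun h => (le_max_left _ _).trans h)

lemma TestT.const_mul {φ : XX d → ℝ} (h : TestT φ) (c : ℝ) : TestT (fun x => c * φ x) := by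
  obtain ⟨hs, l, u, hl, hu, h0⟩ := h
  exact ⟨contDiff_const.mul hs, l, u, hl, hu, fun x hx => by simp [h0 x hx]⟩

lemma TestT.mul_left {φ η : XX d → ℝ} (h : TestT φ) (hη : ContDiff ℝ (⊤ : ℕ∞) η) :
    TestT (fun x => η x * φ x) := by
  obtain ⟨hs, l, u, hl, hu, h0⟩ := h
  exact ⟨hη.mul hs, l, u, hl, hu, fun x hx => by simp [h0 x hx]⟩

/-- the space of test functions -/
def VT (d : ℕ) : Submodule ℝ (XX d → ℝ) where
  carrier := {φ | TestT φ}
  add_mem' h h' := TestT.add h h'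
  zero_mem' := ⟨contDiff_const, 1/2, 1/2, by norm_num, by norm_num, fun _ _ => rfl⟩
  smul_mem' c _ h := TestT.const_mul h c

namespace Setting
variable {Ω : Set (Euc d)} {P : Measure (XX d)} {v : XX d → Euc d} {g : XX d → ℝ}

lemma key_ineq (S : Setting Ω P v g) {t0 : ℝ} (ht0 : t0 ∈ Icc (0:ℝ) 1) {η : XX d → ℝ}
    (hη : ContDiff ℝ (⊤ : ℕ∞) η)
    (h01 : ∀ x : XX d, x.1 ∈ Ioo (0:ℝ) 1 → x.2 ∈ Ω → η x ∈ Icc (0:ℝ) 1)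
    {φ : XX d → ℝ} (hφ : TestT φ) :
    T P v g (fun x => η x * φ x) t0 ≤ ∫ x in {x : XX d | x.1 < t0}, max (Lop v g φ x) 0 ∂P ∧
    T P v g (fun x => η x * φ x) t0 ≤ ∫ x in {x : XX d | x.1 < t0}ᶜ, max (-Lop v g φ x) 0 ∂P := by
  have := S.fin
  have hm : MeasurableSet {x : XX d | x.1 < t0} := measurable_fst measurableSet_Iio
  have ig : Integrable g P := S.g2.integrable (by norm_num)
  have iL := S.integrable_Lop hφ.1
  set K := (∫ x, |g x| ∂P) + T P v g (fun _ => 1) t0 with hK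
  have main : ∀ ε : ℝ, 0 < ε →
      T P v g (fun x => η x * φ x) t0 ≤ (∫ x in {x : XX d | x.1 < t0}, max (Lop v g φ x) 0 ∂P) + ε / 2 * K ∧
      T P v g (fun x => η x * φ x) t0 ≤ (∫ x in {x : XX d | x.1 < t0}ᶜ, max (-Lop v g φ x) 0 ∂P) + ε / 2 * K := by
    intro ε hε
    have hψ : TestT (fun x => Hp ε (φ x)) := by
      obtain ⟨hs, l, u, hl, hu, h0⟩ := hφ
      exact ⟨(Hp_contDiff hε).comp hs, l, u, hl, hu, fun x hx => by
        simp only [h0 x hx, Hp_zero hε]⟩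
    have a1 : T P v g (fun x => η x * φ x) t0 ≤
        T P v g (fun x => Hp ε (φ x)) t0 + ε / 2 * T P v g (fun _ => 1) t0 := by
      rw [← S.T_const_mul contDiff_const _ ht0, ← S.T_add hψ.1 contDiff_const ht0]
      refine S.T_le (hη.mul hφ.1) (hψ.1.add contDiff_const) ?_ ht0
      intro x hx hx'
      have h1 := h01 x hx hx'
      have h2 := Hp_ge (ε := ε) (φ x)
      rw [mul_one]
      refine le_trans ?_ h2
      rcases le_total 0 (φ x) with h | h
      · exact le_trans (mul_le_of_le_one_left h h1.2) (le_max_left _ _)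
      · exact le_trans (mul_nonpos_of_nonneg_of_nonpos h1.1 h) (le_max_right _ _)
    have eL : ∀ x, Lop v g (fun x => Hp ε (φ x)) x = deriv (Hp ε) (φ x) * Lop v g φ x
        + g x * (Hp ε (φ x) - φ x * deriv (Hp ε) (φ x)) := fun x => Lop_comp (Hp_contDiff hε) hφ.1 x
    have er : ∀ x, |g x * (Hp ε (φ x) - φ x * deriv (Hp ε) (φ x))| ≤ ε / 2 * |g x| := by
      intro x
      rw [abs_mul, mul_comm (ε / 2)]
      exact mul_le_mul_of_nonneg_left (Hp_err hε _) (abs_nonneg _)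
    have iψ := S.integrable_Lop hψ.1
    have gs : ∀ s : Set (XX d), ∫ x in s, |g x| ∂P ≤ ∫ x, |g x| ∂P := fun s =>
      setIntegral_le_integral ig.abs (ae_of_all _ fun x => abs_nonneg _)
    constructor
    · refine a1.trans ?_
      rw [S.T_testT hψ]
      have : ∫ x in {x : XX d | x.1 < t0}, Lop v g (fun x => Hp ε (φ x)) x ∂P ≤
          ∫ x in {x : XX d | x.1 < t0}, (max (Lop v g φ x) 0 + ε / 2 * |g x|) ∂P := by
        refine integral_mono iψ.integrableOn (iL.pos_part.add (ig.abs.const_mul _)).integrableOn ?_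
        intro x
        simp only []
        rw [eL]
        have d1 := Hp_deriv_mem hε (φ x)
        have d2 := (abs_le.1 (er x)).2
        refine add_le_add ?_ d2
        rcases le_total 0 (Lop v g φ x) with h | h
        · exact le_trans (mul_le_of_le_one_left h d1.2) (le_max_left _ _)
        · exact le_trans (mul_nonpos_of_nonneg_of_nonpos d1.1 h) (le_max_right _ _)
      rw [integral_add iL.pos_part.integrableOn (ig.abs.const_mul _).integrableOn,
        integral_const_mul] at this
      have g1 := gs {x : XX d | x.1 < t0}
      have : ε / 2 * ∫ x in {x : XX d | x.1 < t0}, |g x| ∂P ≤ ε / 2 * ∫ x, |g x| ∂P := by gcongr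
      rw [hK, mul_add]
      linarith
    · refine a1.trans ?_
      rw [S.T_testT hψ]
      have tot := integral_add_compl hm iψ
      rw [S.ceT hψ] at tot
      have e1 : ∫ x in {x : XX d | x.1 < t0}, Lop v g (fun x => Hp ε (φ x)) x ∂P
          = ∫ x in {x : XX d | x.1 < t0}ᶜ, -Lop v g (fun x => Hp ε (φ x)) x ∂P := by
        rw [integral_neg]; linarith
      rw [e1]
      have : ∫ x in {x : XX d | x.1 < t0}ᶜ, -Lop v g (fun x => Hp ε (φ x)) x ∂P ≤
          ∫ x in {x : XX d | x.1 < t0}ᶜ, (max (-Lop v g φ x) 0 + ε / 2 * |g x|) ∂P := by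
        refine integral_mono iψ.neg.integrableOn (iL.neg.pos_part.add (ig.abs.const_mul _)).integrableOn ?_
        intro x
        simp only []
        rw [eL, neg_add]
        have d1 := Hp_deriv_mem hε (φ x)
        have d2 := (abs_le.1 (er x)).1
        refine add_le_add ?_ (by linarith)
        rw [← mul_neg]
        rcases le_total 0 (-Lop v g φ x) with h | h
        · exact le_trans (mul_le_of_le_one_left h d1.2) (le_max_left _ _)
        · exact le_trans (mul_nonpos_of_nonneg_of_nonpos d1.1 h) (le_max_right _ _)
      have e2 := integral_add (μ := P.restrict {x : XX d | x.1 < t0}ᶜ) (f := fun x => max (-Lop v g φ x) 0)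
        (g := fun x => ε / 2 * |g x|) iL.neg.pos_part.integrableOn (ig.abs.const_mul _).integrableOn
      rw [e2, integral_const_mul] at this
      have g1 := gs {x : XX d | x.1 < t0}ᶜ
      have : ε / 2 * ∫ x in {x : XX d | x.1 < t0}ᶜ, |g x| ∂P ≤ ε / 2 * ∫ x, |g x| ∂P := by gcongr
      rw [hK, mul_add]
      linarith
  have lim : ∀ c : ℝ, Tendsto (fun ε : ℝ => c + ε / 2 * K) (𝓝[>] 0) (𝓝 c) := by
    intro c
    have : Continuous fun ε : ℝ => c + ε / 2 * K := by fun_prop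
    have := (this.tendsto 0).mono_left (nhdsWithin_le_nhds (s := Ioi 0))
    simpa using this
  exact ⟨ge_of_tendsto (lim _) (eventually_nhdsWithin_of_forall fun ε hε => (main ε hε).1),
    ge_of_tendsto (lim _) (eventually_nhdsWithin_of_forall fun ε hε => (main ε hε).2)⟩

end Setting

lemma hb_abstract {X : Type*} [MeasurableSpace X] (P : Measure X) [IsFiniteMeasure P]
    {W : Type*} [AddCommGroup W] [Module ℝ W] (Λ : W →ₗ[ℝ] Lp ℝ 2 P) (ℓ : W →ₗ[ℝ] ℝ)
    (h : ∀ w, ℓ w ≤ ∫ x, max (Λ w x) 0 ∂P) :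
    ∃ f : X → ℝ, Measurable f ∧ (∀ x, 0 ≤ f x) ∧ (∀ x, f x ≤ 1) ∧
      ∀ w, ∫ x, f x * Λ w x ∂P = ℓ w := by
  have int : ∀ u : Lp ℝ 2 P, Integrable u P := fun u => (Lp.memLp u).integrable (by norm_num)
  set N : Lp ℝ 2 P → ℝ := fun u => ∫ x, max (u x) 0 ∂P with hN
  have N_hom : ∀ c : ℝ, 0 < c → ∀ u, N (c • u) = c * N u := by
    intro c hc u
    simp only [hN]
    rw [← integral_const_mul]
    refine integral_congr_ae ?_
    filter_upwards [Lp.coeFn_smul c u] with x hx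
    rw [hx, mul_max_of_nonneg _ _ hc.le]
    simp
  have N_add : ∀ u w, N (u + w) ≤ N u + N w := by
    intro u w
    simp only [hN]
    rw [← integral_add (int u).pos_part (int w).pos_part]
    refine integral_mono_ae (int _).pos_part ((int u).pos_part.add (int w).pos_part) ?_
    filter_upwards [Lp.coeFn_add u w] with x hx
    rw [hx]
    apply max_le
    · exact add_le_add (le_max_left _ _) (le_max_left _ _)
    · exact add_nonneg (le_max_right _ _) (le_max_right _ _)
  obtain ⟨s, hs⟩ := LinearMap.exists_rightInverse_of_surjective Λ.rangeRestrict
    Λ.range_rangeRestrict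
  have hs' : ∀ u : LinearMap.range Λ, Λ (s u) = u := by
    intro u
    have := congrArg Subtype.val (LinearMap.congr_fun hs u)
    simpa using this
  have N0 : N 0 = 0 := by
    simp only [hN]
    rw [← integral_zero X ℝ (μ := P)]
    refine integral_congr_ae ?_
    filter_upwards [Lp.coeFn_zero ℝ 2 P] with x hx
    rw [hx]; simp
  have hker : ∀ w, Λ w = 0 → ℓ w = 0 := by
    intro w hw
    have h1 := h w
    have h2 := h (-w)
    rw [map_neg] at h2
    have e1 : ∫ x, max (Λ w x) 0 ∂P = N 0 := by rw [hw]
    have e2 : ∫ x, max (Λ (-w) x) 0 ∂P = N 0 := by rw [map_neg, hw, neg_zero]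
    rw [map_neg] at e2
    rw [e1, N0] at h1
    rw [map_neg, e2, N0] at h2
    linarith
  obtain ⟨F, hF1, hF2⟩ := exists_extension_of_le_sublinear
    (⟨LinearMap.range Λ, ℓ.comp s⟩ : Lp ℝ 2 P →ₗ.[ℝ] ℝ) N N_hom N_add (by
      intro u
      change ℓ (s u) ≤ N u
      rw [← hs' u]
      exact h _)
  have hF : ∀ w, F (Λ w) = ℓ w := by
    intro w
    have h1 : F (Λ w) = ℓ (s ⟨Λ w, LinearMap.mem_range_self Λ w⟩) := hF1 ⟨Λ w, LinearMap.mem_range_self Λ w⟩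
    rw [h1]
    have h2 := hker (s ⟨Λ w, LinearMap.mem_range_self Λ w⟩ - w) (by rw [map_sub, hs', sub_self])
    rw [map_sub] at h2
    linarith
  set one : Lp ℝ 2 P := (memLp_const (1:ℝ)).toLp _ with hone
  have hone' : ∀ᵐ x ∂P, one x = 1 := (memLp_const (1:ℝ)).coeFn_toLp
  have hNle : ∀ u, N u ≤ ‖one‖ * ‖u‖ := by
    intro u
    have h1 : N u ≤ inner ℝ one |u| := by
      rw [L2.inner_def]
      refine integral_mono_ae (int u).pos_part (L2.integrable_inner _ _) ?_
      filter_upwards [hone', Lp.coeFn_abs u] with x h1 h2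
      rw [h1, h2]
      simp only [RCLike.inner_apply, conj_trivial, mul_one]
      exact max_le (le_abs_self _) (abs_nonneg _)
    refine h1.trans ((real_inner_le_norm _ _).trans ?_)
    rw [norm_abs_eq_norm]
  let Fc : Lp ℝ 2 P →L[ℝ] ℝ := F.mkContinuous ‖one‖ (by
    intro u
    rw [Real.norm_eq_abs, abs_le]
    constructor
    · have := (hF2 (-u)).trans (hNle (-u))
      rw [map_neg, norm_neg] at this
      linarith
    · exact (hF2 u).trans (hNle u))
  set f0 : Lp ℝ 2 P := (InnerProductSpace.toDual ℝ (Lp ℝ 2 P)).symm Fc with hf0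
  have hf0i : ∀ u, ∫ x, f0 x * u x ∂P = F u := by
    intro u
    have : inner ℝ f0 u = Fc u := InnerProductSpace.toDual_symm_apply
    rw [L2.inner_def] at this
    have h2 : Fc u = F u := rfl
    rw [← h2, ← this]
    refine integral_congr_ae (ae_of_all _ fun x => ?_)
    simp [RCLike.inner_apply, mul_comm]
  have hind : ∀ s, MeasurableSet s → ∀ c : ℝ, c * ∫ x in s, f0 x ∂P ≤ ∫ x in s, max c 0 ∂P := by
    intro s hs c
    set u : Lp ℝ 2 P := indicatorConstLp 2 hs (measure_ne_top P s) c
    have hu : u =ᵐ[P] s.indicator fun _ => c := indicatorConstLp_coeFn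
    have h1 := hF2 u
    rw [← hf0i u] at h1
    have e1 : ∫ x, f0 x * u x ∂P = c * ∫ x in s, f0 x ∂P := by
      rw [← integral_const_mul, ← integral_indicator hs]
      refine integral_congr_ae ?_
      filter_upwards [hu] with x hx
      rw [hx]
      by_cases hxs : x ∈ s <;> simp [hxs, mul_comm]
    have e2 : N u = ∫ x in s, max c 0 ∂P := by
      rw [← integral_indicator hs]
      refine integral_congr_ae ?_
      filter_upwards [hu] with x hx
      rw [hx]
      by_cases hxs : x ∈ s <;> simp [hxs]
    rw [e1, e2] at h1
    exact h1
  have ge0 : 0 ≤ᵐ[P] f0 := by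
    refine ae_nonneg_of_forall_setIntegral_nonneg (int f0) ?_
    intro s hs _
    have := hind s hs (-1)
    simp at this
    exact this
  have le1 : f0 ≤ᵐ[P] fun _ => 1 := by
    refine ae_le_of_forall_setIntegral_le (int f0) (integrable_const _) ?_
    intro s hs _
    have := hind s hs 1
    simpa using this
  set f1 := (Lp.aestronglyMeasurable f0).aemeasurable.mk f0
  have hf1 : f0 =ᵐ[P] f1 := (Lp.aestronglyMeasurable f0).aemeasurable.ae_eq_mk
  have hf1m : Measurable f1 := (Lp.aestronglyMeasurable f0).aemeasurable.measurable_mk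
  refine ⟨fun x => max 0 (min (f1 x) 1), by fun_prop, fun x => le_max_left _ _,
    fun x => max_le zero_le_one (min_le_right _ _), ?_⟩
  intro w
  rw [← hF w, ← hf0i]
  refine integral_congr_ae ?_
  filter_upwards [ge0, le1, hf1] with x h1 h2 h3
  rw [← h3, min_eq_left (show f0 x ≤ 1 from h2), max_eq_right (show (0:ℝ) ≤ f0 x from h1)]

namespace Setting
variable {Ω : Set (Euc d)} {P : Measure (XX d)} {v : XX d → Euc d} {g : XX d → ℝ}

lemma memLp_ind (S : Setting Ω P v g) (s : Set (XX d)) (hs : MeasurableSet s) {Φ : XX d → ℝ}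
    (hΦ : ContDiff ℝ (⊤ : ℕ∞) Φ) : MemLp (s.indicator (Lop v g Φ)) 2 P :=
  (S.memLp_Lop hΦ).indicator hs

/-- localized operator as a map into `L²` -/
def LamMap (S : Setting Ω P v g) (s : Set (XX d)) (hs : MeasurableSet s) :
    VT d →ₗ[ℝ] Lp ℝ 2 P where
  toFun φ := (S.memLp_ind s hs φ.2.1).toLp _
  map_add' φ ψ := by
    rw [← MemLp.toLp_add]
    apply MemLp.toLp_congr
    refine ae_of_all _ fun x => ?_
    have := Lop_add (v := v) (g := g) φ.2.1 ψ.2.1 x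
    by_cases h : x ∈ s
    · simp only [Pi.add_apply, indicator_of_mem h]; exact this
    · simp [h]
  map_smul' c φ := by
    rw [RingHom.id_apply, ← MemLp.toLp_const_smul]
    apply MemLp.toLp_congr
    refine ae_of_all _ fun x => ?_
    have := Lop_const_mul (v := v) (g := g) c φ.2.1 x
    by_cases h : x ∈ s
    · simp only [Pi.smul_apply, indicator_of_mem h]; exact this
    · simp [h]

lemma LamMap_coe (S : Setting Ω P v g) (s : Set (XX d)) (hs : MeasurableSet s) (φ : VT d) :
    S.LamMap s hs φ =ᵐ[P] s.indicator (Lop v g φ.1) := (S.memLp_ind s hs φ.2.1).coeFn_toLp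

/-- trace functional -/
def ellMap (S : Setting Ω P v g) {t0 : ℝ} (ht0 : t0 ∈ Icc (0:ℝ) 1) {η : XX d → ℝ}
    (hη : ContDiff ℝ (⊤ : ℕ∞) η) : VT d →ₗ[ℝ] ℝ where
  toFun φ := T P v g (fun x => η x * φ.1 x) t0
  map_add' φ ψ := by
    rw [← S.T_add (hη.mul φ.2.1) (hη.mul ψ.2.1) ht0]
    congr 1; funext x; simp [mul_add]
  map_smul' c φ := by
    rw [RingHom.id_apply, smul_eq_mul, ← S.T_const_mul (hη.mul φ.2.1) c ht0]
    congr 1; funext x; simp; ring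

lemma split (S : Setting Ω P v g) {t0 : ℝ} (ht0 : t0 ∈ Icc (0:ℝ) 1) {η : XX d → ℝ}
    (hη : ContDiff ℝ (⊤ : ℕ∞) η)
    (h01 : ∀ x : XX d, x.1 ∈ Ioo (0:ℝ) 1 → x.2 ∈ Ω → η x ∈ Icc (0:ℝ) 1) :
    ∃ f : XX d → ℝ, Measurable f ∧ (∀ x, 0 ≤ f x) ∧ (∀ x, f x ≤ 1) ∧
      (∀ φ, TestT φ → ∫ x, f x * Lop v g φ x ∂P = 0) ∧
      (∀ φ, TestT φ → ∫ x in {x : XX d | x.1 < t0}, f x * Lop v g φ x ∂P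
        = T P v g (fun x => η x * φ x) t0) := by
  have := S.fin
  set s := {x : XX d | x.1 < t0} with hsdef
  have hs : MeasurableSet s := measurable_fst measurableSet_Iio
  let Λ : VT d × VT d →ₗ[ℝ] Lp ℝ 2 P := (S.LamMap s hs).coprod (S.LamMap sᶜ hs.compl)
  let ℓ : VT d × VT d →ₗ[ℝ] ℝ := (S.ellMap ht0 hη).coprod (-(S.ellMap ht0 hη))
  have hΛ : ∀ w : VT d × VT d, Λ w =ᵐ[P] fun x => s.indicator (Lop v g w.1.1) x
      + sᶜ.indicator (Lop v g w.2.1) x := by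
    intro w
    have e : Λ w = S.LamMap s hs w.1 + S.LamMap sᶜ hs.compl w.2 := rfl
    rw [e]
    filter_upwards [Lp.coeFn_add (S.LamMap s hs w.1) (S.LamMap sᶜ hs.compl w.2),
      S.LamMap_coe s hs w.1, S.LamMap_coe sᶜ hs.compl w.2] with x h1 h2 h3
    rw [h1, Pi.add_apply, h2, h3]
  have hℓ : ∀ w : VT d × VT d, ℓ w = T P v g (fun x => η x * w.1.1 x) t0
      - T P v g (fun x => η x * w.2.1 x) t0 := by
    intro w
    simp only [ℓ, LinearMap.coprod_apply, LinearMap.neg_apply]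
    rfl
  obtain ⟨f, h1, h2, h3, h4⟩ := hb_abstract P Λ ℓ (by
    intro w
    rw [hℓ w]
    have k1 := (S.key_ineq ht0 hη h01 w.1.2).1
    have hneg : TestT (fun x => (-1) * w.2.1 x) := TestT.const_mul w.2.2 (-1)
    have k2 := (S.key_ineq ht0 hη h01 hneg).2
    have e2 : T P v g (fun x => η x * (-1 * w.2.1 x)) t0 = - T P v g (fun x => η x * w.2.1 x) t0 := by
      have e0 := S.T_const_mul (hη.mul w.2.2.1) (-1) ht0
      rw [neg_one_mul] at e0
      rw [← e0]
      congr 1; funext x; ring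
    rw [e2] at k2
    have e3 : ∀ x, -Lop v g (fun x => -1 * w.2.1 x) x = Lop v g w.2.1 x := by
      intro x; rw [Lop_const_mul _ w.2.2.1]; ring
    simp only [e3] at k2
    have e4 : ∫ x, max (Λ w x) 0 ∂P = (∫ x in s, max (Lop v g w.1.1 x) 0 ∂P)
        + ∫ x in sᶜ, max (Lop v g w.2.1 x) 0 ∂P := by
      have i1 := (S.integrable_Lop w.1.2.1).pos_part
      have i2 := (S.integrable_Lop w.2.2.1).pos_part
      rw [← integral_indicator hs, ← integral_indicator hs.compl,
        ← integral_add (i1.indicator hs) (i2.indicator hs.compl)]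
      refine integral_congr_ae ?_
      filter_upwards [hΛ w] with x hx
      rw [hx]
      by_cases hxs : x ∈ s <;> simp [hxs]
    rw [e4]
    linarith)
  have h5 : ∀ φ, TestT φ → ∀ ψ, TestT ψ → (∫ x in s, f x * Lop v g φ x ∂P)
      + ∫ x in sᶜ, f x * Lop v g ψ x ∂P = T P v g (fun x => η x * φ x) t0
      - T P v g (fun x => η x * ψ x) t0 := by
    intro φ hφ ψ hψ
    have := h4 (⟨φ, hφ⟩, ⟨ψ, hψ⟩)
    rw [hℓ] at this
    rw [← this]
    have ii : ∀ φ, TestT φ → Integrable (fun x => f x * Lop v g φ x) P := fun φ hφ =>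
      (S.integrable_Lop hφ.1).bdd_mul h1.aestronglyMeasurable (c := 1) (ae_of_all _ fun x => by
        rw [Real.norm_of_nonneg (h2 x)]; exact h3 x)
    rw [← integral_indicator hs, ← integral_indicator hs.compl,
      ← integral_add ((ii φ hφ).indicator hs) ((ii ψ hψ).indicator hs.compl)]
    refine integral_congr_ae ?_
    filter_upwards [hΛ (⟨φ, hφ⟩, ⟨ψ, hψ⟩)] with x hx
    rw [hx]
    by_cases hxs : x ∈ s <;> simp [hxs]
  have h0T : TestT (fun _ : XX d => (0:ℝ)) := (VT d).zero_mem
  have hz : ∀ x, Lop v g (fun _ : XX d => (0:ℝ)) x = 0 := by intro x; simp [Lop]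
  have hT0 : T P v g (fun _ => 0) t0 = 0 := by
    have := S.T_const_mul (Φ := η) hη 0 ht0
    simpa using this
  have h6 : ∀ φ, TestT φ → ∫ x in s, f x * Lop v g φ x ∂P
        = T P v g (fun x => η x * φ x) t0 := by
    intro φ hφ
    have := h5 φ hφ _ h0T
    simpa [hz, hT0] using this
  refine ⟨f, h1, h2, h3, ?_, h6⟩
  intro φ hφ
  have := h5 φ hφ φ hφ
  rw [sub_self] at this
  rw [← this]
  refine (integral_add_compl hs ?_).symm
  exact (S.integrable_Lop hφ.1).bdd_mul h1.aestronglyMeasurable (c := 1) (ae_of_all _ fun x => by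
        rw [Real.norm_of_nonneg (h2 x)]; exact h3 x)

end Setting

/-- the energy ball -/
def Ball (α β δ : ℝ) (Ω : Set (Euc d)) : Set (Mtriple d) :=
  {p | ConcS Ω p.1 ∧ ConcV Ω p.2.1 ∧ ConcS Ω p.2.2 ∧ JSigned α β δ p.1 p.2.1 p.2.2 ≤ 1}

lemma compact_of_domain {Ω : Set (Euc d)} (h : IsClosureOfBoundedDomain Ω) :
    IsCompact Ω ∧ Ω.Nonempty := by
  obtain ⟨U, _, hne, _, hb, rfl⟩ := h
  exact ⟨hb.isCompact_closure, hne.closure⟩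

lemma Rep.conc {p : Mtriple d} {P : Measure (XX d)} {v : XX d → Euc d} {g : XX d → ℝ}
    (h : Rep p P v g) {Ω : Set (Euc d)} (hΩ : IsCompact Ω) (hc : ConcS Ω p.1) :
    P (Ioo (0:ℝ) 1 ×ˢ Ω)ᶜ = 0 := by
  have := h.fin
  have hm : MeasurableSet (Ioo (0:ℝ) 1 ×ˢ Ω)ᶜ :=
    (measurableSet_Ioo.prod hΩ.isClosed.measurableSet).compl
  have h1 := hc _ hm subset_rfl
  rw [h.h1 _ hm] at h1
  exact (measureReal_eq_zero_iff).1 h1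

lemma Rep.conc_of {p : Mtriple d} {P : Measure (XX d)} {v : XX d → Euc d} {g : XX d → ℝ}
    (h : Rep p P v g) {Ω : Set (Euc d)} (hc : P (Ioo (0:ℝ) 1 ×ˢ Ω)ᶜ = 0) :
    ConcS Ω p.1 ∧ ConcV Ω p.2.1 ∧ ConcS Ω p.2.2 := by
  refine ⟨?_, ?_, ?_⟩
  · intro s hs hss
    rw [h.h1 s hs, Measure.real, measure_mono_null hss hc]; rfl
  · intro s hs hss
    rw [h.h2 s hs]; exact setIntegral_measure_zero _ (measure_mono_null hss hc)
  · intro s hs hss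
    rw [h.h3 s hs]; exact setIntegral_measure_zero _ (measure_mono_null hss hc)

/-- total energy density -/
def en (α β δ : ℝ) (v : XX d → Euc d) (g : XX d → ℝ) (x : XX d) : ℝ := β * eden δ v g x + α

lemma en_pos {α β : ℝ} (hα : 0 < α) (hβ : 0 < β) (δ : ℝ) (v : XX d → Euc d) (g : XX d → ℝ)
    (x : XX d) : 0 < en α β δ v g x := by
  have := mul_nonneg hβ.le (eden_nonneg δ v g x)
  unfold en; linarith

lemma en_measurable {α β δ : ℝ} {v : XX d → Euc d} {g : XX d → ℝ} (hv : Measurable v)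
    (hg : Measurable g) : Measurable (en α β δ v g) :=
  ((eden_measurable hv hg).const_mul β).add_const α

lemma Rep.en_facts {p : Mtriple d} {P : Measure (XX d)} {v : XX d → Euc d} {g : XX d → ℝ}
    (h : Rep p P v g) {α β δ : ℝ} (hα : 0 < α) (hβ : 0 < β)
    (hJ : JSigned α β δ p.1 p.2.1 p.2.2 ≠ ⊤) :
    CE P v g ∧ Integrable (en α β δ v g) P ∧
      JSigned α β δ p.1 p.2.1 p.2.2 = ENNReal.ofReal (∫ x, en α β δ v g x ∂P) := by
  classical
  have e := h.J_eq hα hβ δ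
  by_cases hce : CE P v g
  · rw [if_pos hce] at e
    have hi : Integrable (en α β δ v g) P := by
      refine ⟨(en_measurable h.mv h.mg).aestronglyMeasurable, ?_⟩
      rw [hasFiniteIntegral_iff_ofReal (ae_of_all _ fun x => (en_pos hα hβ δ v g x).le)]
      rw [e] at hJ
      exact lt_top_iff_ne_top.2 hJ
    refine ⟨hce, hi, ?_⟩
    rw [e, ofReal_integral_eq_lintegral_ofReal hi (ae_of_all _ fun x => (en_pos hα hβ δ v g x).le)]
    rfl
  · rw [if_neg hce] at e; exact absurd e hJ

lemma Rep.setting {p : Mtriple d} {P : Measure (XX d)} {v : XX d → Euc d} {g : XX d → ℝ}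
    (h : Rep p P v g) {α β δ : ℝ} (hα : 0 < α) (hβ : 0 < β) (hδ : 0 < δ)
    (hJ : JSigned α β δ p.1 p.2.1 p.2.2 ≠ ⊤) {Ω : Set (Euc d)} (hΩ : IsCompact Ω)
    (hc : ConcS Ω p.1) : Setting Ω P v g := by
  obtain ⟨hce, hi, -⟩ := h.en_facts hα hβ hJ
  refine ⟨h.fin, h.mv, h.mg, hΩ, h.conc hΩ hc, ?_, ?_, hce⟩
  · rw [memLp_two_iff_integrable_sq_norm h.mv.aestronglyMeasurable]
    refine (hi.const_mul (2 / β)).mono' (by have := h.mv; fun_prop) (ae_of_all _ fun x => ?_)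
    rw [Real.norm_of_nonneg (by positivity), en, eden]
    have : 2 / β * (β * ((‖v x‖ ^ 2 + δ ^ 2 * g x ^ 2) / 2) + α)
      = ‖v x‖ ^ 2 + δ ^ 2 * g x ^ 2 + 2 / β * α := by field_simp
    rw [this]
    have : 0 ≤ δ ^ 2 * g x ^ 2 + 2 / β * α := by positivity
    linarith
  · rw [memLp_two_iff_integrable_sq h.mg.aestronglyMeasurable]
    refine (hi.const_mul (2 / (β * δ ^ 2))).mono' (by have := h.mg; fun_prop)
      (ae_of_all _ fun x => ?_)
    rw [Real.norm_of_nonneg (by positivity), en, eden]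
    have : 2 / (β * δ ^ 2) * (β * ((‖v x‖ ^ 2 + δ ^ 2 * g x ^ 2) / 2) + α)
      = ‖v x‖ ^ 2 / δ ^ 2 + g x ^ 2 + 2 / (β * δ ^ 2) * α := by field_simp
    rw [this]
    have : 0 ≤ ‖v x‖ ^ 2 / δ ^ 2 + 2 / (β * δ ^ 2) * α := by positivity
    linarith

lemma Rep.scale_mem {p : Mtriple d} {P : Measure (XX d)} {v : XX d → Euc d} {g : XX d → ℝ}
    (h : Rep p P v g) {f : XX d → ℝ} (hf : Measurable f) (h0 : ∀ x, 0 ≤ f x) {C : ℝ}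
    (hC : ∀ x, f x ≤ C) {α β δ : ℝ} (hα : 0 < α) (hβ : 0 < β)
    (hi : Integrable (en α β δ v g) P) {Ω : Set (Euc d)} (hc : P (Ioo (0:ℝ) 1 ×ˢ Ω)ᶜ = 0)
    (hce : ∀ φ, IsTest φ → ∫ x, f x * Lop v g φ x ∂P = 0)
    (h1 : ∫ x, f x * en α β δ v g x ∂P ≤ 1) : scale P v g f ∈ Ball α β δ Ω := by
  classical
  have hr := h.scale_rep hf h0 hC
  obtain ⟨c1, c2, c3⟩ := hr.conc_of (Ω := Ω) (withDensity_absolutelyContinuous _ _ hc)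
  refine ⟨c1, c2, c3, ?_⟩
  rw [h.scale_J hf h0 hC hα hβ, if_pos hce]
  have e : ∀ x, ENNReal.ofReal (f x) * ENNReal.ofReal (β * eden δ v g x + α)
    = ENNReal.ofReal (f x * en α β δ v g x) := fun x => (ENNReal.ofReal_mul (h0 x)).symm
  simp only [e]
  rw [← ofReal_integral_eq_lintegral_ofReal]
  · exact ENNReal.ofReal_le_one.2 h1
  · exact hi.bdd_mul (c := C) hf.aestronglyMeasurable (ae_of_all _ fun x => by
      rw [Real.norm_of_nonneg (h0 x)]; exact hC x)
  · exact ae_of_all _ fun x => mul_nonneg (h0 x) (en_pos hα hβ δ v g x).le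

lemma Rep.eq_scale {p : Mtriple d} {P : Measure (XX d)} {v : XX d → Euc d} {g : XX d → ℝ}
    (h : Rep p P v g) {f1 f2 : XX d → ℝ} (hf1 : Measurable f1) (hf2 : Measurable f2)
    (h01 : ∀ x, 0 ≤ f1 x) (h02 : ∀ x, 0 ≤ f2 x) {C1 C2 : ℝ}
    (hC1 : ∀ x, f1 x ≤ C1) (hC2 : ∀ x, f2 x ≤ C2) {a b : ℝ}
    (hab : ∀ x, a * f1 x + b * f2 x = 1) :
    a • scale P v g f1 + b • scale P v g f2 = p := by
  have := h.fin
  have b1 : ∀ᵐ x ∂P, ‖f1 x‖ ≤ C1 := ae_of_all _ fun x => by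
    rw [Real.norm_of_nonneg (h01 x)]; exact hC1 x
  have b2 : ∀ᵐ x ∂P, ‖f2 x‖ ≤ C2 := ae_of_all _ fun x => by
    rw [Real.norm_of_nonneg (h02 x)]; exact hC2 x
  have i1 : Integrable f1 P := Integrable.of_bound hf1.aestronglyMeasurable C1 b1
  have i2 : Integrable f2 P := Integrable.of_bound hf2.aestronglyMeasurable C2 b2
  have v1 : Integrable (fun x => f1 x • v x) P := h.iv.bdd_smul C1 hf1.aestronglyMeasurable b1
  have v2 : Integrable (fun x => f2 x • v x) P := h.iv.bdd_smul C2 hf2.aestronglyMeasurable b2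
  have g1 : Integrable (fun x => f1 x * g x) P :=
    h.ig.bdd_mul (c := C1) hf1.aestronglyMeasurable b1
  have g2 : Integrable (fun x => f2 x * g x) P :=
    h.ig.bdd_mul (c := C2) hf2.aestronglyMeasurable b2
  refine Prod.ext ?_ (Prod.ext ?_ ?_)
  · ext s hs
    rw [h.h1 s hs]
    simp only [scale, Prod.fst_add, Prod.smul_fst, VectorMeasure.add_apply,
      VectorMeasure.smul_apply, smul_eq_mul]
    rw [withDensityᵥ_apply i1 hs, withDensityᵥ_apply i2 hs, ← integral_const_mul,
      ← integral_const_mul, ← integral_add (i1.integrableOn.const_mul a)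
        (i2.integrableOn.const_mul b)]
    simp [hab]
  · ext1 s hs
    rw [h.h2 s hs]
    simp only [scale, Prod.fst_add, Prod.smul_fst, Prod.snd_add, Prod.smul_snd,
      VectorMeasure.add_apply, VectorMeasure.smul_apply]
    rw [withDensityᵥ_apply v1 hs, withDensityᵥ_apply v2 hs, ← integral_smul,
      ← integral_smul, ← integral_add
        (show IntegrableOn (fun x => a • f1 x • v x) s P from v1.integrableOn.smul a)
        (show IntegrableOn (fun x => b • f2 x • v x) s P from v2.integrableOn.smul b)]
    refine integral_congr_ae (ae_of_all _ fun x => ?_)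
    simp only [smul_smul, ← add_smul, hab, one_smul]
  · ext s hs
    rw [h.h3 s hs]
    simp only [scale, Prod.snd_add, Prod.smul_snd, VectorMeasure.add_apply,
      VectorMeasure.smul_apply, smul_eq_mul]
    rw [withDensityᵥ_apply g1 hs, withDensityᵥ_apply g2 hs, ← integral_const_mul,
      ← integral_const_mul, ← integral_add (g1.integrableOn.const_mul a)
        (g2.integrableOn.const_mul b)]
    refine integral_congr_ae (ae_of_all _ fun x => ?_)
    simp only [← mul_assoc, ← add_mul, hab, one_mul]

lemma scale_inj {p : Mtriple d} {P : Measure (XX d)} {v : XX d → Euc d} {g : XX d → ℝ}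
    (h : Rep p P v g) {f : XX d → ℝ} (hi : Integrable f P) (e : scale P v g f = p) :
    f =ᵐ[P] fun _ => 1 := by
  have := h.fin
  refine hi.ae_eq_of_forall_setIntegral_eq _ _ (integrable_const _) ?_
  intro s hs _
  have h1 := h.h1 s hs
  rw [← e] at h1
  simp only [scale] at h1
  rw [withDensityᵥ_apply hi hs] at h1
  rw [h1]; simp

lemma const_of_extreme {α β δ : ℝ} (hα : 0 < α) (hβ : 0 < β) {Ω : Set (Euc d)}
    (hΩ : IsCompact Ω) {p : Mtriple d} (hp : p ∈ extremePoints ℝ (Ball α β δ Ω))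
    {P : Measure (XX d)} {v : XX d → Euc d} {g : XX d → ℝ}
    (h : Rep p P v g) {f : XX d → ℝ} (hf : Measurable f) (h0 : ∀ x, 0 ≤ f x)
    (hC : ∀ x, f x ≤ 1) (hce : ∀ φ, IsTest φ → ∫ x, f x * Lop v g φ x ∂P = 0)
    (hiL : ∀ φ, IsTest φ → Integrable (Lop v g φ) P) :
    f =ᵐ[P] fun _ => ∫ x, f x * en α β δ v g x ∂P := by
  rw [mem_extremePoints] at hp
  obtain ⟨⟨c1, c2, c3, hJ⟩, hext⟩ := hp
  have hfin := h.fin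
  have hc := h.conc hΩ c1
  obtain ⟨hCE, hi, eJ⟩ := h.en_facts hα hβ (ne_top_of_le_ne_top ENNReal.one_ne_top hJ)
  rw [eJ, ENNReal.ofReal_le_one] at hJ
  have hb : ∀ᵐ x ∂P, ‖f x‖ ≤ 1 := ae_of_all _ fun x => by
    rw [Real.norm_of_nonneg (h0 x)]; exact hC x
  have hfe : Integrable (fun x => f x * en α β δ v g x) P :=
    hi.bdd_mul (c := 1) hf.aestronglyMeasurable hb
  have iff : Integrable f P := Integrable.of_bound hf.aestronglyMeasurable 1 hb
  set a := ∫ x, f x * en α β δ v g x ∂P with ha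
  have hpos : ∀ x, 0 ≤ f x * en α β δ v g x := fun x =>
    mul_nonneg (h0 x) (en_pos hα hβ δ v g x).le
  have hpos' : ∀ x, 0 ≤ (1 - f x) * en α β δ v g x := fun x =>
    mul_nonneg (by linarith [hC x]) (en_pos hα hβ δ v g x).le
  have hfe' : Integrable (fun x => (1 - f x) * en α β δ v g x) P := by
    refine (hi.sub hfe).congr (ae_of_all _ fun x => ?_)
    simp only [Pi.sub_apply]; ring
  have ha' : ∫ x, (1 - f x) * en α β δ v g x ∂P = (∫ x, en α β δ v g x ∂P) - a := by
    rw [ha, ← integral_sub hi hfe]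
    exact integral_congr_ae (ae_of_all _ fun x => by ring)
  have a0 : 0 ≤ a := integral_nonneg hpos
  have a1 : 0 ≤ (∫ x, en α β δ v g x ∂P) - a := by
    rw [← ha']; exact integral_nonneg hpos'
  rcases a0.eq_or_lt with a0 | a0
  · have := (integral_eq_zero_iff_of_nonneg hpos hfe).1 a0.symm
    filter_upwards [this] with x hx
    rw [← a0]
    exact (mul_eq_zero.1 hx).resolve_right (en_pos hα hβ δ v g x).ne'
  rcases (show a ≤ 1 by linarith).eq_or_lt with a2 | a2
  · have e0 : ∫ x, (1 - f x) * en α β δ v g x ∂P = 0 := by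
      rw [ha']; linarith
    have := (integral_eq_zero_iff_of_nonneg hpos' hfe').1 e0
    filter_upwards [this] with x hx
    have := (mul_eq_zero.1 hx).resolve_right (en_pos hα hβ δ v g x).ne'
    linarith
  have p1 : ∀ x, 0 ≤ f x / a := fun x => div_nonneg (h0 x) a0.le
  have p1' : ∀ x, f x / a ≤ 1 / a := fun x => div_le_div_of_nonneg_right (hC x) a0.le
  have a3 : 0 < 1 - a := by linarith
  have p2 : ∀ x, 0 ≤ (1 - f x) / (1 - a) := fun x => div_nonneg (by linarith [hC x]) a3.le
  have p2' : ∀ x, (1 - f x) / (1 - a) ≤ 1 / (1 - a) := fun x =>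
    div_le_div_of_nonneg_right (by linarith [h0 x]) a3.le
  have m1 : scale P v g (fun x => f x / a) ∈ Ball α β δ Ω := by
    refine h.scale_mem (hf.div_const a) p1 p1' hα hβ hi hc ?_ ?_
    · intro φ hφ
      have : ∀ x, f x / a * Lop v g φ x = a⁻¹ * (f x * Lop v g φ x) := fun x => by ring
      simp only [this]
      rw [integral_const_mul, hce φ hφ, mul_zero]
    · have : ∀ x, f x / a * en α β δ v g x = a⁻¹ * (f x * en α β δ v g x) := fun x => by ring
      simp only [this]
      rw [integral_const_mul, ← ha, inv_mul_cancel₀ a0.ne']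
  have m2 : scale P v g (fun x => (1 - f x) / (1 - a)) ∈ Ball α β δ Ω := by
    refine h.scale_mem ((hf.const_sub 1).div_const (1 - a)) p2 p2' hα hβ hi hc ?_ ?_
    · intro φ hφ
      have : ∀ x, (1 - f x) / (1 - a) * Lop v g φ x
        = (1 - a)⁻¹ * (Lop v g φ x - f x * Lop v g φ x) := fun x => by ring
      simp only [this]
      rw [integral_const_mul, integral_sub (hiL φ hφ)
        ((hiL φ hφ).bdd_mul (c := 1) hf.aestronglyMeasurable hb), hce φ hφ, hCE φ hφ]
      simp
    · have : ∀ x, (1 - f x) / (1 - a) * en α β δ v g x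
        = (1 - a)⁻¹ * ((1 - f x) * en α β δ v g x) := fun x => by ring
      simp only [this]
      rw [integral_const_mul, ha', inv_mul_le_iff₀ a3]
      linarith
  have e := (hext _ m1 _ m2 ⟨a, 1 - a, a0, a3, by ring,
    h.eq_scale (hf.div_const a) ((hf.const_sub 1).div_const (1 - a)) p1 p2 p1' p2' (fun x => by
      field_simp; ring)⟩).1
  have := scale_inj h (iff.div_const a) e
  filter_upwards [this] with x hx
  rw [div_eq_iff a0.ne'] at hx
  linarith

lemma rep_zero_of {p : Mtriple d} {P : Measure (XX d)} {v : XX d → Euc d} {g : XX d → ℝ}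
    (h : Rep p P v g) (hP : P = 0) : p = 0 := by
  subst hP
  refine Prod.ext ?_ (Prod.ext ?_ ?_)
  · ext s hs; rw [h.h1 s hs]; simp
  · ext1 s hs; rw [h.h2 s hs]; simp
  · ext s hs; rw [h.h3 s hs]; simp

lemma J_one_of_extreme {α β δ : ℝ} (hα : 0 < α) (hβ : 0 < β) {Ω : Set (Euc d)}
    (hΩ : IsCompact Ω) {p : Mtriple d} (hp : p ∈ extremePoints ℝ (Ball α β δ Ω)) (hp0 : p ≠ 0)
    {P : Measure (XX d)} {v : XX d → Euc d} {g : XX d → ℝ}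
    (h : Rep p P v g) (hiL : ∀ φ, IsTest φ → Integrable (Lop v g φ) P) :
    JSigned α β δ p.1 p.2.1 p.2.2 = 1 := by
  have hJ := hp.1.2.2.2
  obtain ⟨hCE, hi, eJ⟩ := h.en_facts hα hβ (ne_top_of_le_ne_top ENNReal.one_ne_top hJ)
  have := const_of_extreme hα hβ hΩ hp h (f := fun _ => 1) measurable_const (by simp) (by simp)
    (by simpa [CE] using hCE) hiL
  simp only [one_mul] at this
  have hne : NeBot (ae P) := by
    rw [ae_neBot]
    intro h0; exact hp0 (rep_zero_of h h0)
  obtain ⟨x, hx⟩ := this.exists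
  rw [eJ, ← show (1:ℝ) = ∫ x, en α β δ v g x ∂P from hx]; simp

lemma ac_of_dist_le {F H : ℝ → ℝ} {a b K : ℝ}
    (hH : AbsolutelyContinuousOnInterval H a b)
    (h : ∀ x ∈ uIcc a b, ∀ y ∈ uIcc a b, dist (F x) (F y) ≤ K * dist (H x) (H y)) :
    AbsolutelyContinuousOnInterval F a b := by
  rw [absolutelyContinuousOnInterval_iff] at hH ⊢
  intro ε hε
  obtain ⟨η, hη, H'⟩ := hH (ε / (|K| + 1)) (by positivity)
  refine ⟨η, hη, fun E hE hlt => ?_⟩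
  have h1 := H' E hE hlt
  have h2 : ∑ i ∈ Finset.range E.1, dist (F (E.2 i).1) (F (E.2 i).2)
      ≤ (|K| + 1) * ∑ i ∈ Finset.range E.1, dist (H (E.2 i).1) (H (E.2 i).2) := by
    rw [Finset.mul_sum]
    refine Finset.sum_le_sum fun i hi => ?_
    obtain ⟨k1, k2⟩ := hE.1 i hi
    refine (h _ k1 _ k2).trans ?_
    gcongr
    linarith [le_abs_self K]
  rw [lt_div_iff₀ (by positivity)] at h1
  linarith

lemma ac_prim {f f' : ℝ → ℝ} (hi : IntegrableOn f' (Icc (0:ℝ) 1))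
    (hf : ∀ t ∈ Icc (0:ℝ) 1, f t = f 0 + ∫ s in (0:ℝ)..t, f' s) :
    AbsolutelyContinuousOnInterval f 0 1 := by
  have ii : IntervalIntegrable f' volume 0 1 :=
    (intervalIntegrable_iff_integrableOn_Icc_of_le zero_le_one).2 hi
  refine ac_of_dist_le (K := 1)
    (ii.absolutelyContinuousOnInterval_intervalIntegral (c := 0) (by simp)) ?_
  intro x hx y hy
  rw [uIcc_of_le zero_le_one] at hx hy
  rw [hf x hx, hf y hy]
  simp

lemma ae_deriv_prim {E : Type*} [NormedAddCommGroup E] [NormedSpace ℝ E] [CompleteSpace E]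
    {f f' : ℝ → E} (hi : IntegrableOn f' (Icc (0:ℝ) 1))
    (hf : ∀ t ∈ Icc (0:ℝ) 1, f t = f 0 + ∫ s in (0:ℝ)..t, f' s) :
    ∀ᵐ t, t ∈ Ioo (0:ℝ) 1 → HasDerivAt f (f' t) t := by
  have ii : IntervalIntegrable f' volume 0 1 :=
    (intervalIntegrable_iff_integrableOn_Icc_of_le zero_le_one).2 hi
  filter_upwards [ii.ae_hasDerivAt_integral] with t ht ht1
  rw [uIcc_of_le zero_le_one] at ht
  have h1 := (ht (Ioo_subset_Icc_self ht1) 0 (by simp)).const_add (f 0)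
  refine h1.congr_of_eventuallyEq ?_
  filter_upwards [Ioo_mem_nhds ht1.1 ht1.2] with s hs
  exact hf s (Ioo_subset_Icc_self hs)

lemma ftc_ac {F F' : ℝ → ℝ} (hF : AbsolutelyContinuousOnInterval F 0 1)
    (hd : ∀ᵐ t, t ∈ Ioo (0:ℝ) 1 → HasDerivAt F (F' t) t) {t : ℝ} (ht : t ∈ Icc (0:ℝ) 1) :
    F t = F 0 + ∫ s in (0:ℝ)..t, F' s := by
  have h1 := (hF.mono (c := 0) (d := t) (by
    rw [uIcc_of_le ht.1, uIcc_of_le zero_le_one]; exact Icc_subset_Icc_right ht.2)).integral_deriv_eq_sub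
  have h2 : ∫ s in (0:ℝ)..t, F' s = ∫ s in (0:ℝ)..t, deriv F s := by
    apply intervalIntegral.integral_congr_ae
    have hne : ∀ᵐ s : ℝ, s ≠ 1 := by simp [ae_iff, measure_singleton]
    filter_upwards [hd, hne] with s hs hs1 hst
    rw [uIoc_of_le ht.1] at hst
    exact (hs ⟨hst.1, lt_of_le_of_ne (hst.2.trans ht.2) hs1⟩).deriv.symm
  rw [h2, h1]; ring

lemma inv_sqrt_lip {ε x y : ℝ} (hε : 0 < ε) (hx : 0 ≤ x) (hy : 0 ≤ y) :
    dist (Real.sqrt (x + ε))⁻¹ (Real.sqrt (y + ε))⁻¹ ≤ (ε * Real.sqrt ε)⁻¹ * dist x y := by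
  set s := Real.sqrt (x + ε)
  set r := Real.sqrt (y + ε)
  set e := Real.sqrt ε
  have he : 0 < e := Real.sqrt_pos.2 hε
  have hs : e ≤ s := Real.sqrt_le_sqrt (by linarith)
  have hr : e ≤ r := Real.sqrt_le_sqrt (by linarith)
  have hs0 : 0 < s := he.trans_le hs
  have hr0 : 0 < r := he.trans_le hr
  have e2 : e * e = ε := Real.mul_self_sqrt hε.le
  have hxs : x - y = (s - r) * (s + r) := by
    have h1 : s * s = x + ε := Real.mul_self_sqrt (by linarith)
    have h2 : r * r = y + ε := Real.mul_self_sqrt (by linarith)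
    nlinarith
  rw [Real.dist_eq, Real.dist_eq, hxs, ← e2]
  have : s⁻¹ - r⁻¹ = (r - s) / (s * r) := by field_simp
  rw [this, abs_div, abs_of_pos (mul_pos hs0 hr0), abs_mul, abs_of_pos (add_pos hs0 hr0),
    abs_sub_comm, div_le_iff₀ (mul_pos hs0 hr0), inv_mul_eq_div, div_mul_eq_mul_div,
    le_div_iff₀ (by positivity)]
  have k1 : e * e ≤ s * r := mul_le_mul hs hr he.le hs0.le
  have k2 : e ≤ s + r := by linarith
  have k3 : e * e * e ≤ (s + r) * (s * r) := by
    rw [mul_comm (s + r)]; exact mul_le_mul k1 k2 he.le (by positivity)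
  nlinarith [mul_le_mul_of_nonneg_left k3 (abs_nonneg (s - r))]

lemma theta_bound {h ε : ℝ} (hh : 0 ≤ h) (hε : 0 < ε) :
    0 ≤ Real.sqrt h / Real.sqrt (h + ε) ∧ Real.sqrt h / Real.sqrt (h + ε) ≤ 1 := by
  refine ⟨by positivity, div_le_one_of_le₀ (Real.sqrt_le_sqrt (by linarith)) (by positivity)⟩

lemma theta_lim {h : ℝ} (hh : 0 < h) :
    Tendsto (fun n : ℕ => Real.sqrt h / Real.sqrt (h + 1 / ((n:ℝ) + 1))) atTop (𝓝 1) := by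
  have h1 : Tendsto (fun n : ℕ => Real.sqrt (h + 1 / ((n:ℝ) + 1))) atTop (𝓝 (Real.sqrt h)) := by
    have := (tendsto_const_nhds (x := h)).add (tendsto_one_div_add_atTop_nhds_zero_nat (𝕜 := ℝ))
    rw [add_zero] at this
    exact (Real.continuous_sqrt.tendsto h).comp this
  have h2 := (tendsto_const_nhds (x := Real.sqrt h)).div h1 (Real.sqrt_pos.2 hh).ne'
  rwa [div_self (Real.sqrt_pos.2 hh).ne'] at h2

lemma sqrt_ac {h γ a b : ℝ → ℝ} (mh : Measurable h) (mγ : Measurable γ) (ma : Measurable a)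
    (mb : Measurable b) {C M : ℝ} (h0 : ∀ t ∈ Icc (0:ℝ) 1, 0 ≤ h t)
    (hM : ∀ t ∈ Icc (0:ℝ) 1, h t ≤ M) (hγ : ∀ t ∈ Icc (0:ℝ) 1, |γ t| ≤ C)
    (ia : IntegrableOn (fun t => a t ^ 2 * h t) (Icc (0:ℝ) 1))
    (ib : IntegrableOn (fun t => b t ^ 2 * h t) (Icc (0:ℝ) 1))
    (hh : ∀ t ∈ Icc (0:ℝ) 1, h t = h 0 + ∫ s in (0:ℝ)..t, a s * h s)
    (hm : ∀ t ∈ Icc (0:ℝ) 1, h t * γ t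
      = h 0 * γ 0 + ∫ s in (0:ℝ)..t, (b s + γ s * a s) * h s) :
    IntegrableOn (fun t => (b t + γ t * a t / 2) * Real.sqrt (h t)) (Icc (0:ℝ) 1) ∧
    IntegrableOn (fun t => ((b t + γ t * a t / 2) * Real.sqrt (h t)) ^ 2) (Icc (0:ℝ) 1) ∧
    ∀ t ∈ Icc (0:ℝ) 1, Real.sqrt (h t) * γ t = Real.sqrt (h 0) * γ 0
      + ∫ s in (0:ℝ)..t, (b s + γ s * a s / 2) * Real.sqrt (h s) := by
  have mem : ∀ᵐ t ∂(volume.restrict (Icc (0:ℝ) 1)), t ∈ Icc (0:ℝ) 1 :=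
    ae_restrict_mem measurableSet_Icc
  have C0 : 0 ≤ C := (abs_nonneg _).trans (hγ 0 (by simp))
  have i1 : IntegrableOn (fun _ : ℝ => (1:ℝ)) (Icc (0:ℝ) 1) := by simp
  have iM : IntegrableOn (fun _ : ℝ => M) (Icc (0:ℝ) 1) := by simp
  have iah : IntegrableOn (fun t => a t * h t) (Icc (0:ℝ) 1) := by
    refine (ia.add iM).mono' (by fun_prop) ?_
    filter_upwards [mem] with t ht
    simp only [Pi.add_apply]
    rw [Real.norm_eq_abs, abs_mul, abs_of_nonneg (h0 t ht)]
    have := h0 t ht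
    have := hM t ht
    rw [← sq_abs]
    nlinarith [mul_nonneg (h0 t ht) (sq_nonneg (|a t| - 1))]
  have ibh : IntegrableOn (fun t => b t * h t) (Icc (0:ℝ) 1) := by
    refine (ib.add iM).mono' (by fun_prop) ?_
    filter_upwards [mem] with t ht
    simp only [Pi.add_apply]
    rw [Real.norm_eq_abs, abs_mul, abs_of_nonneg (h0 t ht)]
    have := h0 t ht
    have := hM t ht
    rw [← sq_abs]
    nlinarith [mul_nonneg (h0 t ht) (sq_nonneg (|b t| - 1))]
  have imh : IntegrableOn (fun t => (b t + γ t * a t) * h t) (Icc (0:ℝ) 1) := by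
    have k := iah.bdd_mul (c := C) (f := γ) mγ.aestronglyMeasurable
      (by filter_upwards [mem] with t ht using hγ t ht)
    refine (ibh.add k).congr (ae_of_all _ fun t => ?_)
    simp only [Pi.add_apply]; ring
  -- square integrability of the dominating function
  have iS : IntegrableOn (fun t => (|b t| + 2 * C * |a t|) ^ 2 * h t) (Icc (0:ℝ) 1) := by
    refine ((ib.const_mul 2).add (ia.const_mul (8 * C ^ 2))).mono' (by fun_prop) ?_
    filter_upwards [mem] with t ht
    simp only [Pi.add_apply]
    rw [Real.norm_of_nonneg (mul_nonneg (sq_nonneg _) (h0 t ht)), ← sq_abs (a t), ← sq_abs (b t)]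
    nlinarith [mul_nonneg (h0 t ht) (sq_nonneg (|b t| - 2 * C * |a t|))]
  have iD : IntegrableOn (fun t => (|b t| + 2 * C * |a t|) * Real.sqrt (h t)) (Icc (0:ℝ) 1) := by
    refine (iS.add i1).mono' (by fun_prop) ?_
    filter_upwards [mem] with t ht
    simp only [Pi.add_apply]
    have hs := Real.mul_self_sqrt (h0 t ht)
    have : 0 ≤ |b t| + 2 * C * |a t| := by positivity
    rw [Real.norm_of_nonneg (mul_nonneg this (Real.sqrt_nonneg _))]
    set D := (|b t| + 2 * C * |a t|)
    have e : D ^ 2 * h t = (D * Real.sqrt (h t)) ^ 2 := by rw [mul_pow, Real.sq_sqrt (h0 t ht)]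
    rw [e]
    nlinarith [sq_nonneg (D * Real.sqrt (h t) - 1), sq_nonneg (D * Real.sqrt (h t))]
  have bd : ∀ t ∈ Icc (0:ℝ) 1, |b t + γ t * a t / 2| ≤ |b t| + 2 * C * |a t| := by
    intro t ht
    refine (abs_add_le _ _).trans ?_
    rw [abs_div, abs_mul, abs_two]
    have := mul_le_mul_of_nonneg_right (hγ t ht) (abs_nonneg (a t))
    have := mul_nonneg C0 (abs_nonneg (a t))
    linarith
  refine ⟨?_, ?_, ?_⟩
  · refine iD.mono' (by fun_prop) ?_
    filter_upwards [mem] with t ht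
    rw [Real.norm_eq_abs, abs_mul, abs_of_nonneg (Real.sqrt_nonneg _)]
    exact mul_le_mul_of_nonneg_right (bd t ht) (Real.sqrt_nonneg _)
  · refine iS.mono' (by fun_prop) ?_
    filter_upwards [mem] with t ht
    rw [Real.norm_of_nonneg (sq_nonneg _), mul_pow, Real.sq_sqrt (h0 t ht)]
    refine mul_le_mul_of_nonneg_right ?_ (h0 t ht)
    rw [← sq_abs]
    exact pow_le_pow_left₀ (abs_nonneg _) (bd t ht) 2
  -- the approximations
  have ach := ac_prim iah hh
  have acm := ac_prim (f := fun t => h t * γ t) imh hm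
  have dh := ae_deriv_prim iah hh
  have dm := ae_deriv_prim (f := fun t => h t * γ t) imh hm
  set θ : ℕ → ℝ → ℝ := fun n t => Real.sqrt (h t) / Real.sqrt (h t + 1 / ((n:ℝ) + 1)) with hθ
  have key : ∀ n : ℕ, ∀ t ∈ Icc (0:ℝ) 1, Real.sqrt (h t) * θ n t * γ t
      = Real.sqrt (h 0) * θ n 0 * γ 0 + ∫ s in (0:ℝ)..t,
        ((b s + γ s * a s) * θ n s - γ s * a s / 2 * θ n s ^ 3) * Real.sqrt (h s) := by
    intro n
    set ε : ℝ := 1 / ((n:ℝ) + 1) with hε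
    have ε0 : 0 < ε := by positivity
    have ac2 : AbsolutelyContinuousOnInterval (fun t => (Real.sqrt (h t + ε))⁻¹) 0 1 := by
      refine ac_of_dist_le ach (K := (ε * Real.sqrt ε)⁻¹) ?_
      intro x hx y hy
      rw [uIcc_of_le zero_le_one] at hx hy
      exact inv_sqrt_lip ε0 (h0 x hx) (h0 y hy)
    have ac3 := acm.fun_mul ac2
    have eqn : ∀ t ∈ Icc (0:ℝ) 1, h t * γ t * (Real.sqrt (h t + ε))⁻¹
        = Real.sqrt (h t) * θ n t * γ t := by
      intro t ht
      simp only [hθ]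
      rw [← hε]
      nth_rewrite 1 [← Real.mul_self_sqrt (h0 t ht)]
      rw [div_eq_mul_inv]; ring
    have d3 : ∀ᵐ t, t ∈ Ioo (0:ℝ) 1 →
        HasDerivAt (fun t => h t * γ t * (Real.sqrt (h t + ε))⁻¹)
          (((b t + γ t * a t) * θ n t - γ t * a t / 2 * θ n t ^ 3) * Real.sqrt (h t)) t := by
      filter_upwards [dh, dm] with t k1 k2 ht
      have hpos : 0 ≤ h t := h0 t (Ioo_subset_Icc_self ht)
      have hne : h t + ε ≠ 0 := by positivity
      have q0 : 0 < Real.sqrt (h t + ε) := Real.sqrt_pos.2 (by positivity)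
      have q1 := ((k1 ht).add_const ε).sqrt hne
      have q2 := (k2 ht).mul (show HasDerivAt (fun y => (Real.sqrt (h y + ε))⁻¹) _ t from
        q1.inv q0.ne')
      refine q2.congr_deriv ?_
      simp only [hθ]
      rw [← hε]
      set s := Real.sqrt (h t + ε)
      have hr := Real.mul_self_sqrt hpos
      set r := Real.sqrt (h t)
      rw [← hr]
      field_simp
      ring
    intro t ht
    have := ftc_ac ac3 d3 ht
    rw [eqn t ht, eqn 0 (by simp)] at this
    exact this
  intro t ht
  have lim1 : ∀ t ∈ Icc (0:ℝ) 1, Tendsto (fun n => Real.sqrt (h t) * θ n t * γ t) atTop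
      (𝓝 (Real.sqrt (h t) * γ t)) := by
    intro t ht
    rcases (h0 t ht).eq_or_lt with e | e
    · simp [← e]
    · have := ((theta_lim e).const_mul (Real.sqrt (h t))).mul_const (γ t)
      rwa [mul_one] at this
  have lim2 : Tendsto (fun n => ∫ s in (0:ℝ)..t,
        ((b s + γ s * a s) * θ n s - γ s * a s / 2 * θ n s ^ 3) * Real.sqrt (h s)) atTop
      (𝓝 (∫ s in (0:ℝ)..t, (b s + γ s * a s / 2) * Real.sqrt (h s))) := by
    refine intervalIntegral.tendsto_integral_filter_of_dominated_convergence
      (fun t => (|b t| + 2 * C * |a t|) * Real.sqrt (h t)) ?_ ?_ ?_ ?_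
    · refine Eventually.of_forall fun n => ?_
      have : Measurable (θ n) := by simp only [hθ]; fun_prop
      fun_prop
    · refine Eventually.of_forall fun n => ae_of_all _ fun s hs => ?_
      rw [uIoc_of_le ht.1] at hs
      have hs' : s ∈ Icc (0:ℝ) 1 := ⟨hs.1.le, hs.2.trans ht.2⟩
      rw [Real.norm_eq_abs, abs_mul, abs_of_nonneg (Real.sqrt_nonneg _)]
      refine mul_le_mul_of_nonneg_right ?_ (Real.sqrt_nonneg _)
      obtain ⟨t0, t1⟩ := theta_bound (h0 s hs') (show (0:ℝ) < 1 / ((n:ℝ) + 1) by positivity)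
      change 0 ≤ θ n s at t0
      change θ n s ≤ 1 at t1
      refine (abs_sub _ _).trans ?_
      rw [abs_mul, abs_mul, abs_of_nonneg t0, abs_of_nonneg (pow_nonneg t0 3), abs_div, abs_two,
        abs_mul]
      have q1 : |b s + γ s * a s| ≤ |b s| + C * |a s| := by
        refine (abs_add_le _ _).trans ?_
        rw [abs_mul]
        gcongr
        exact hγ s hs'
      have q2 : |γ s| * |a s| ≤ C * |a s| := mul_le_mul_of_nonneg_right (hγ s hs') (abs_nonneg _)
      have q3 : |b s + γ s * a s| * θ n s ≤ |b s + γ s * a s| :=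
        mul_le_of_le_one_right (abs_nonneg _) t1
      have q4 : |γ s| * |a s| / 2 * θ n s ^ 3 ≤ |γ s| * |a s| / 2 :=
        mul_le_of_le_one_right (by positivity) (pow_le_one₀ t0 t1)
      have := mul_nonneg C0 (abs_nonneg (a s))
      linarith
    · rw [intervalIntegrable_iff_integrableOn_Icc_of_le ht.1]
      exact iD.mono_set (Icc_subset_Icc_right ht.2)
    · refine ae_of_all _ fun s hs => ?_
      rw [uIoc_of_le ht.1] at hs
      have hs' : s ∈ Icc (0:ℝ) 1 := ⟨hs.1.le, hs.2.trans ht.2⟩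
      rcases (h0 s hs').eq_or_lt with e | e
      · simp [← e]
      · have l := theta_lim e
        have := (((l.const_mul (b s + γ s * a s)).sub
          ((l.pow 3).const_mul (γ s * a s / 2))).mul_const (Real.sqrt (h s)))
        refine this.trans (le_of_eq ?_)
        congr 1
        ring
  refine tendsto_nhds_unique (lim1 t ht) ?_
  simp only [key _ t ht]
  exact (lim1 0 (by simp)).add lim2

lemma IsTest.testT {φ : XX d → ℝ} (h : IsTest φ) : TestT φ := by
  obtain ⟨hs, hc, ht⟩ := h
  refine ⟨hs, ?_⟩
  have hK : IsCompact (Prod.fst '' tsupport φ) := hc.isCompact.image continuous_fst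
  by_cases hne : (Prod.fst '' tsupport φ).Nonempty
  · obtain ⟨a, ha, hamin⟩ := hK.exists_isLeast hne
    obtain ⟨b, hb, hbmax⟩ := hK.exists_isGreatest hne
    have hsub : ∀ t ∈ Prod.fst '' tsupport φ, t ∈ Ioo (0:ℝ) 1 := by
      rintro _ ⟨x, hx, rfl⟩; exact (ht hx).1
    have h1 := hsub a ha
    have h2 := hsub b hb
    refine ⟨a / 2, (b + 1) / 2, by linarith [h1.1], by linarith [h2.2], ?_⟩
    intro x hx
    by_contra hne
    have hxs : x ∈ tsupport φ := subset_tsupport _ hne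
    have k1 := hamin (mem_image_of_mem Prod.fst hxs)
    have k2 := hbmax (mem_image_of_mem Prod.fst hxs)
    rcases hx with hx | hx
    · linarith [h1.1]
    · linarith [h2.2]
  · refine ⟨1/2, 1/2, by norm_num, by norm_num, fun x _ => ?_⟩
    by_contra hx
    exact hne ⟨_, mem_image_of_mem Prod.fst (subset_tsupport _ hx)⟩

/-- only constants split the triple -/
def Indec (P : Measure (XX d)) (v : XX d → Euc d) (g : XX d → ℝ) : Prop :=
  ∀ f : XX d → ℝ, Measurable f → (∀ x, 0 ≤ f x) → (∀ x, f x ≤ 1) →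
    (∀ φ, TestT φ → ∫ x, f x * Lop v g φ x ∂P = 0) → ∃ c : ℝ, f =ᵐ[P] fun _ => c

namespace Setting
variable {Ω : Set (Euc d)} {P : Measure (XX d)} {v : XX d → Euc d} {g : XX d → ℝ}

lemma coord_contDiff (i : Fin d) : ContDiff ℝ (⊤ : ℕ∞) (fun x : XX d => x.2 i) := by
  fun_prop

lemma exists_bump {t0 : ℝ} (ht0 : t0 ∈ Ioo (0:ℝ) 1) : ∃ b, IsTest1 b ∧ b t0 = 1 := by
  obtain ⟨r, hr, hrs⟩ := Metric.nhds_basis_closedBall.mem_iff.1 (Ioo_mem_nhds ht0.1 ht0.2)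
  let χ : ContDiffBump t0 := ⟨r / 2, r, by linarith, by linarith⟩
  refine ⟨χ, ⟨χ.contDiff, χ.hasCompactSupport, ?_⟩, χ.one_of_mem_closedBall (Metric.mem_closedBall_self (by simp [χ]; linarith))⟩
  rw [χ.tsupport_eq]
  exact hrs

lemma indec_mul (S : Setting Ω P v g) (hI : Indec P v g) {t0 : ℝ} (ht0 : t0 ∈ Ioo (0:ℝ) 1)
    {η : XX d → ℝ} (hη : ContDiff ℝ (⊤ : ℕ∞) η)
    (h01 : ∀ x : XX d, x.1 ∈ Ioo (0:ℝ) 1 → x.2 ∈ Ω → η x ∈ Icc (0:ℝ) 1) :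
    ∃ c : ℝ, ∀ ψ : XX d → ℝ, ContDiff ℝ (⊤ : ℕ∞) ψ →
      T P v g (fun x => η x * ψ x) t0 = c * T P v g ψ t0 := by
  have ht0' := Ioo_subset_Icc_self ht0
  obtain ⟨f, h1, h2, h3, h4, h5⟩ := S.split ht0' hη h01
  obtain ⟨c, hc⟩ := hI f h1 h2 h3 h4
  obtain ⟨b, hb, hb1⟩ := exists_bump ht0
  refine ⟨c, fun ψ hψ => ?_⟩
  have hT := testT_mul hb hψ
  have k1 := h5 _ hT
  have k2 : ∫ x in {x : XX d | x.1 < t0}, f x * Lop v g (fun x => b x.1 * ψ x) x ∂P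
      = c * T P v g (fun x => b x.1 * ψ x) t0 := by
    rw [S.T_testT hT, ← integral_const_mul]
    refine integral_congr_ae ?_
    filter_upwards [ae_restrict_of_ae hc] with x hx
    rw [hx]
  rw [k2, S.T_time hψ hb.1 ht0', hb1, one_mul] at k1
  rw [k1]
  have : (fun x => η x * (b x.1 * ψ x)) = fun x => b x.1 * (η x * ψ x) := by funext x; ring
  rw [this, S.T_time (hη.mul hψ) hb.1 ht0', hb1, one_mul]

lemma coord_bound (S : Setting Ω P v g) : ∃ R : ℝ, 0 < R ∧ ∀ y ∈ Ω, ∀ i, |y i| ≤ R := by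
  obtain ⟨R, hR0, hR⟩ := S.cpt.isBounded.subset_closedBall_lt 0 (0 : Euc d)
  refine ⟨R, hR0, fun y hy i => ?_⟩
  have := hR hy
  rw [mem_closedBall_zero_iff] at this
  exact (PiLp.norm_apply_le y i).trans this

/-- total mass -/
def hh (P : Measure (XX d)) (v : XX d → Euc d) (g : XX d → ℝ) : ℝ → ℝ := T P v g (fun _ => 1)

/-- first moments -/
def mm (P : Measure (XX d)) (v : XX d → Euc d) (g : XX d → ℝ) (i : Fin d) : ℝ → ℝ :=
  T P v g (fun x => x.2 i)

/-- second moments -/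
def qq (P : Measure (XX d)) (v : XX d → Euc d) (g : XX d → ℝ) (i : Fin d) : ℝ → ℝ :=
  T P v g (fun x => x.2 i * x.2 i)

lemma one_contDiff : ContDiff ℝ (⊤ : ℕ∞) (fun _ : XX d => (1:ℝ)) := contDiff_const

lemma var_zero (S : Setting Ω P v g) (hI : Indec P v g) {t0 : ℝ} (ht0 : t0 ∈ Ioo (0:ℝ) 1)
    (i : Fin d) : qq P v g i t0 * hh P v g t0 = mm P v g i t0 * mm P v g i t0 := by
  obtain ⟨R, hR0, hR⟩ := S.coord_bound
  have ht0' := Ioo_subset_Icc_self ht0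
  have hη : ContDiff ℝ (⊤ : ℕ∞) (fun x : XX d => (2 * R)⁻¹ * (x.2 i + R * 1)) := by fun_prop
  obtain ⟨c, hc⟩ := S.indec_mul hI ht0 hη (by
    intro x _ hx
    have := abs_le.1 (hR x.2 hx i)
    constructor
    · exact mul_nonneg (by positivity) (by linarith)
    · rw [inv_mul_le_iff₀ (by positivity)]; linarith)
  have key : ∀ ψ : XX d → ℝ, ContDiff ℝ (⊤ : ℕ∞) ψ →
      T P v g (fun x => x.2 i * ψ x) t0 = (2 * R * c - R) * T P v g ψ t0 := by
    intro ψ hψ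
    have h1 := hc ψ hψ
    have e : (fun x : XX d => (2 * R)⁻¹ * (x.2 i + R * 1) * ψ x)
        = fun x => (2 * R)⁻¹ * (x.2 i * ψ x + R * ψ x) := by funext x; ring
    rw [e, S.T_const_mul (((coord_contDiff i).mul hψ).add (contDiff_const.mul hψ)) _ ht0',
      S.T_add ((coord_contDiff i).mul hψ) (contDiff_const.mul hψ) ht0',
      S.T_const_mul hψ _ ht0'] at h1
    rw [inv_mul_eq_iff_eq_mul₀ (by positivity)] at h1
    linarith
  have k1 := key _ (one_contDiff (d := d))
  have k2 := key _ (coord_contDiff i)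
  simp only [mul_one] at k1
  unfold qq hh mm
  rw [k2, k1]; ring

lemma hh_nonneg (S : Setting Ω P v g) {t : ℝ} (ht : t ∈ Icc (0:ℝ) 1) : 0 ≤ hh P v g t :=
  S.T_nonneg one_contDiff (fun _ _ _ => zero_le_one) ht

lemma hh_cont (S : Setting Ω P v g) : Continuous (hh P v g) := S.T_continuous one_contDiff
lemma mm_cont (S : Setting Ω P v g) (i : Fin d) : Continuous (mm P v g i) :=
  S.T_continuous (coord_contDiff i)

lemma T_bd (S : Setting Ω P v g) {Φ : XX d → ℝ} (hΦ : ContDiff ℝ (⊤ : ℕ∞) Φ) :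
    ∃ C, ∀ t, |T P v g Φ t| ≤ C := by
  have := S.fin
  exact ⟨_, fun t => Tr_bound P (S.integrable_Lop hΦ) t⟩

lemma T_abs_le (S : Setting Ω P v g) {Φ : XX d → ℝ} (hΦ : ContDiff ℝ (⊤ : ℕ∞) Φ) {C : ℝ}
    (hC : ∀ x : XX d, x.1 ∈ Ioo (0:ℝ) 1 → x.2 ∈ Ω → |Φ x| ≤ C) {t : ℝ} (ht : t ∈ Icc (0:ℝ) 1) :
    |T P v g Φ t| ≤ C * hh P v g t := by
  have e : ∀ c : ℝ, T P v g (fun _ => c * 1) t = c * hh P v g t := fun c =>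
    S.T_const_mul one_contDiff c ht
  rw [abs_le]
  constructor
  · have := S.T_le (Φ := fun _ => (-C) * 1) contDiff_const hΦ (fun x h1 h2 => by
      have := (abs_le.1 (hC x h1 h2)).1; linarith) ht
    rw [e] at this; linarith
  · rw [← e]
    exact S.T_le hΦ contDiff_const (fun x h1 h2 => by
      have := (abs_le.1 (hC x h1 h2)).2; linarith) ht

lemma ae_hh_pos (S : Setting Ω P v g) : ∀ᵐ x ∂P, 0 < hh P v g x.1 := by
  have := S.fin
  set s : Set ℝ := {t | hh P v g t ≤ 0} with hs
  have ms : MeasurableSet s := S.hh_cont.measurable measurableSet_Iic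
  have h1 := S.T_set one_contDiff ms
  have h2 : ∫ t in s ∩ Ioo 0 1, T P v g (fun _ => 1) t ≤ 0 :=
    setIntegral_nonpos (ms.inter measurableSet_Ioo) fun t ht => ht.1
  rw [← h1] at h2
  simp only [integral_const, smul_eq_mul, mul_one, measureReal_restrict_apply_univ] at h2
  have h3 : P.real (Prod.fst ⁻¹' s) = 0 := le_antisymm h2 measureReal_nonneg
  rw [measureReal_eq_zero_iff] at h3
  rw [ae_iff]
  convert h3 using 2
  ext x; simp [hs]

/-- the curve -/
def gam (x0 : Euc d) (P : Measure (XX d)) (v : XX d → Euc d) (g : XX d → ℝ) (t : ℝ) : Euc d :=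
  open Classical in
  if 0 < hh P v g t then WithLp.toLp 2 (fun i => mm P v g i t / hh P v g t) else x0

lemma gam_apply {x0 : Euc d} {t : ℝ} (h : 0 < hh P v g t) (i : Fin d) :
    gam x0 P v g t i = mm P v g i t / hh P v g t := by
  unfold gam; rw [if_pos h]

lemma gam_measurable (S : Setting Ω P v g) (x0 : Euc d) : Measurable (gam x0 P v g) := by
  unfold gam
  have h1 := S.hh_cont.measurable
  have h2 := fun i => (S.mm_cont i).measurable
  refine Measurable.ite (measurableSet_lt measurable_const h1) ?_ measurable_const
  have : Measurable (fun t => fun i => mm P v g i t / hh P v g t) :=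
    measurable_pi_lambda _ fun i => (h2 i).div h1
  fun_prop

lemma gam_continuousAt (S : Setting Ω P v g) (x0 : Euc d) {t : ℝ} (h : 0 < hh P v g t) :
    ContinuousAt (gam x0 P v g) t := by
  have h1 : ContinuousAt (fun t => (WithLp.toLp 2 (fun i => mm P v g i t / hh P v g t) : Euc d)) t := by
    refine (PiLp.continuous_toLp 2 _).continuousAt.comp (f := fun t i => mm P v g i t / hh P v g t) ?_
    rw [continuousAt_pi]
    intro i
    exact (S.mm_cont i).continuousAt.div S.hh_cont.continuousAt h.ne'
  refine h1.congr ?_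
  filter_upwards [S.hh_cont.continuousAt.eventually (lt_mem_nhds h)] with s hs
  unfold gam; rw [if_pos hs]

lemma ae_graph (S : Setting Ω P v g) (hI : Indec P v g) (x0 : Euc d) :
    ∀ᵐ x ∂P, x.2 = gam x0 P v g x.1 := by
  have := S.fin
  have h1 : ∀ i : Fin d, ∀ᵐ x ∂P, hh P v g x.1 * x.2 i = mm P v g i x.1 := by
    intro i
    obtain ⟨C1, hC1⟩ := S.T_bd (one_contDiff (d := d))
    obtain ⟨C2, hC2⟩ := S.T_bd (coord_contDiff i)
    have c1 := S.hh_cont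
    have c2 := S.mm_cont i
    have z1 := S.T_fun (one_contDiff (d := d)) (w := fun t => mm P v g i t ^ 2) (by fun_prop)
      (C := C2 ^ 2) (fun t => by rw [abs_pow]; exact pow_le_pow_left₀ (abs_nonneg _) (hC2 t) 2)
    have z2 := S.T_fun (coord_contDiff i) (w := fun t => hh P v g t * mm P v g i t) (by fun_prop)
      (C := C1 * C2) (fun t => by
        rw [abs_mul]
        exact mul_le_mul (hC1 t) (hC2 t) (abs_nonneg _) ((abs_nonneg _).trans (hC1 t)))
    have z3 := S.T_fun ((coord_contDiff i).mul (coord_contDiff i))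
      (w := fun t => hh P v g t ^ 2) (by fun_prop)
      (C := C1 ^ 2) (fun t => by rw [abs_pow]; exact pow_le_pow_left₀ (abs_nonneg _) (hC1 t) 2)
    have i1 : Integrable (fun x : XX d => mm P v g i x.1 ^ 2 * 1) P :=
      S.integrable_cont (by fun_prop)
    have i2 : Integrable (fun x : XX d => hh P v g x.1 * mm P v g i x.1 * x.2 i) P :=
      S.integrable_cont (by fun_prop)
    have i3 : Integrable (fun x : XX d => hh P v g x.1 ^ 2 * (x.2 i * x.2 i)) P :=
      S.integrable_cont (by fun_prop)
    have i4 : Integrable (fun x : XX d => (hh P v g x.1 * x.2 i - mm P v g i x.1) ^ 2) P :=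
      S.integrable_cont (by fun_prop)
    have e : ∫ x, (hh P v g x.1 * x.2 i - mm P v g i x.1) ^ 2 ∂P = 0 := by
      have e1 : ∀ x : XX d, (hh P v g x.1 * x.2 i - mm P v g i x.1) ^ 2
          = hh P v g x.1 ^ 2 * (x.2 i * x.2 i) - 2 * (hh P v g x.1 * mm P v g i x.1 * x.2 i)
            + mm P v g i x.1 ^ 2 * 1 := fun x => by ring
      simp only [e1]
      rw [integral_add (show Integrable (fun x : XX d => hh P v g x.1 ^ 2 * (x.2 i * x.2 i) -
        2 * (hh P v g x.1 * mm P v g i x.1 * x.2 i)) P from i3.sub (i2.const_mul 2)) i1, integral_sub i3 (i2.const_mul 2),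
        integral_const_mul, z1, z2, z3, ← integral_const_mul, ← integral_sub, ← integral_add]
      · refine setIntegral_eq_zero_of_forall_eq_zero fun t ht => ?_
        have := S.var_zero hI ht i
        unfold qq at this
        have e2 : T P v g (fun x => x.2 i) t = mm P v g i t := rfl
        have e3 : T P v g (fun _ => 1) t = hh P v g t := rfl
        simp only [e2, e3]
        linear_combination hh P v g t * this
      all_goals
        have c3 := S.T_continuous ((coord_contDiff i).mul (coord_contDiff i))
        have c4 := S.T_continuous (coord_contDiff i)
        have c5 := S.T_continuous (one_contDiff (d := d))
        refine IntegrableOn.mono_set (t := Icc 0 1) (Continuous.integrableOn_Icc ?_)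
          Ioo_subset_Icc_self
        fun_prop
    rw [integral_eq_zero_iff_of_nonneg (fun x => sq_nonneg _) i4] at e
    filter_upwards [e] with x hx
    have := pow_eq_zero_iff (two_ne_zero) |>.1 hx
    linarith
  filter_upwards [ae_all_iff.2 h1, S.ae_hh_pos] with x hx hpos
  ext i
  rw [gam_apply hpos, eq_div_iff hpos.ne', mul_comm]
  exact hx i

lemma measure_eq (S : Setting Ω P v g) (hI : Indec P v g) (x0 : Euc d) :
    P = Measure.map (fun t => (t, gam x0 P v g t))
      ((volume.restrict (Ioo (0:ℝ) 1)).withDensity fun t => ENNReal.ofReal (hh P v g t)) := by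
  have := S.fin
  have mG : Measurable (fun t => (t, gam x0 P v g t)) := measurable_id.prodMk (S.gam_measurable x0)
  have ih : IntegrableOn (hh P v g) (Ioo (0:ℝ) 1) :=
    (S.hh_cont.integrableOn_Icc).mono_set Ioo_subset_Icc_self
  have h0 : 0 ≤ᵐ[volume.restrict (Ioo (0:ℝ) 1)] hh P v g := by
    filter_upwards [ae_restrict_mem measurableSet_Ioo] with t ht
    exact S.hh_nonneg (Ioo_subset_Icc_self ht)
  ext s hs
  rw [Measure.map_apply mG hs, withDensity_apply _ (mG hs)]
  have e1 : P s = P (Prod.fst ⁻¹' ((fun t => (t, gam x0 P v g t)) ⁻¹' s)) := by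
    apply measure_congr
    filter_upwards [S.ae_graph hI x0] with x hx
    have : x = (x.1, gam x0 P v g x.1) := Prod.ext rfl hx
    refine propext ?_
    constructor
    · intro h; change (x.1, gam x0 P v g x.1) ∈ s; rwa [← this]
    · intro h; change (x.1, gam x0 P v g x.1) ∈ s at h; rwa [← this] at h
  have e2 := S.T_set (one_contDiff (d := d)) (mG hs)
  simp only [integral_const, smul_eq_mul, mul_one, measureReal_restrict_apply_univ] at e2
  rw [Measure.restrict_restrict (mG hs), ← ofReal_integral_eq_lintegral_ofReal]
  · rw [e1, ← ENNReal.ofReal_toReal (measure_ne_top P _)]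
    congr 1
  · exact ih.mono_set inter_subset_right
  · rw [← Measure.restrict_restrict (mG hs)]
    exact ae_restrict_of_ae h0

end Setting

namespace Setting
variable {Ω : Set (Euc d)} {P : Measure (XX d)} {v : XX d → Euc d} {g : XX d → ℝ}

lemma mG (S : Setting Ω P v g) (x0 : Euc d) : Measurable (fun t => (t, gam x0 P v g t)) :=
  measurable_id.prodMk (S.gam_measurable x0)

lemma hh_ae (S : Setting Ω P v g) : 0 ≤ᵐ[volume.restrict (Ioo (0:ℝ) 1)] hh P v g := by
  filter_upwards [ae_restrict_mem measurableSet_Ioo] with t ht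
  exact S.hh_nonneg (Ioo_subset_Icc_self ht)

lemma push_int (S : Setting Ω P v g) (hI : Indec P v g) (x0 : Euc d) {E : Type*}
    [NormedAddCommGroup E] [NormedSpace ℝ E] [MeasurableSpace E] [BorelSpace E]
    [SecondCountableTopology E] {A : XX d → E} (hA : Measurable A)
    {s : Set (XX d)} (hs : MeasurableSet s) :
    ∫ x in s, A x ∂P = ∫ t in Ioo (0:ℝ) 1, indicator {u | (u, gam x0 P v g u) ∈ s}
      (fun u => hh P v g u • A (u, gam x0 P v g u)) t := by
  have e := S.measure_eq hI x0
  have m := S.mG x0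
  conv_lhs => rw [e]
  rw [setIntegral_map hs hA.aestronglyMeasurable m.aemeasurable,
    setIntegral_withDensity_ofReal _ _ S.hh_cont.measurable S.hh_ae _ _ (m hs),
    ← integral_indicator (m hs)]
  rfl

lemma push_integrable (S : Setting Ω P v g) (hI : Indec P v g) (x0 : Euc d) {E : Type*}
    [NormedAddCommGroup E] [NormedSpace ℝ E] [MeasurableSpace E] [BorelSpace E]
    [SecondCountableTopology E] {A : XX d → E} (hA : Measurable A) (iA : Integrable A P) :
    IntegrableOn (fun t => hh P v g t • A (t, gam x0 P v g t)) (Icc (0:ℝ) 1) := by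
  have e := S.measure_eq hI x0
  have m := S.mG x0
  rw [e, integrable_map_measure hA.aestronglyMeasurable m.aemeasurable,
    integrable_withDensity_ofReal _ _ S.hh_cont.measurable S.hh_ae] at iA
  rw [integrableOn_Icc_iff_integrableOn_Ioo]
  exact iA

lemma push_prim (S : Setting Ω P v g) (hI : Indec P v g) (x0 : Euc d) {A : XX d → ℝ}
    (hA : Measurable A) {t : ℝ} (ht : t ∈ Icc (0:ℝ) 1) :
    ∫ x in {x : XX d | x.1 < t}, A x ∂P
      = ∫ s in (0:ℝ)..t, hh P v g s * A (s, gam x0 P v g s) := by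
  rw [S.push_int hI x0 hA (measurableSet_lt measurable_fst measurable_const)]
  have : {u : ℝ | (u, gam x0 P v g u) ∈ {x : XX d | x.1 < t}} = Iio t := rfl
  rw [this, integral_indicator measurableSet_Iio, Measure.restrict_restrict measurableSet_Iio,
    intervalIntegral.integral_of_le ht.1, integral_Ioc_eq_integral_Ioo]
  have : Iio t ∩ Ioo 0 1 = Ioo 0 t := by
    ext u; simp only [mem_inter_iff, mem_Iio, mem_Ioo]
    exact ⟨fun h => ⟨h.2.1, h.1⟩, fun h => ⟨h.2, h.1, h.2.trans_le ht.2⟩⟩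
  rw [this]; rfl

lemma push_ae (S : Setting Ω P v g) (hI : Indec P v g) (x0 : Euc d) {q : XX d → Prop}
    (h : ∀ᵐ x ∂P, q x) :
    ∀ᵐ t ∂(volume.restrict (Ioo (0:ℝ) 1)), 0 < hh P v g t → q (t, gam x0 P v g t) := by
  rw [S.measure_eq hI x0] at h
  have h1 := ae_of_ae_map (S.mG x0).aemeasurable h
  rw [ae_withDensity_iff (by have := S.hh_cont.measurable; fun_prop)] at h1
  filter_upwards [h1] with t ht h0
  exact ht (by simpa using h0)

lemma gam_mem (S : Setting Ω P v g) (hI : Indec P v g) {x0 : Euc d} (hx0 : x0 ∈ Ω)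
    {t : ℝ} (ht : t ∈ Icc (0:ℝ) 1) : gam x0 P v g t ∈ Ω := by
  by_cases h : 0 < hh P v g t
  swap
  · unfold gam; rw [if_neg h]; exact hx0
  have h1 := S.push_ae hI x0 S.ae_mem
  refine S.cpt.isClosed.mem_of_frequently_of_tendsto ?_ (S.gam_continuousAt x0 h)
  intro hev
  have hev2 := hev.and (S.hh_cont.continuousAt.eventually (lt_mem_nhds h))
  obtain ⟨U, hU, hUo, htU⟩ := eventually_nhds_iff.1 hev2
  have hne : (U ∩ Ioo 0 1).Nonempty := by
    have : t ∈ closure (Ioo (0:ℝ) 1) := by rw [closure_Ioo (by norm_num)]; exact ht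
    exact mem_closure_iff.1 this U hUo htU
  have hpos := (hUo.inter isOpen_Ioo).measure_pos volume hne
  refine hpos.ne' ?_
  rw [ae_restrict_iff' measurableSet_Ioo] at h1
  refine measure_mono_null ?_ h1
  rintro s ⟨hs1, hs2⟩ hs3
  have := hU s hs1
  exact this.1 (hs3 hs2 this.2).2

lemma Lop_one (x : XX d) : Lop v g (fun _ => 1) x = g x := by
  unfold Lop; simp

lemma Lop_coord (i : Fin d) (x : XX d) : Lop v g (fun x => x.2 i) x = v x i + x.2 i * g x := by
  unfold Lop
  have : fderiv ℝ (fun x : XX d => x.2 i) x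
      = (EuclideanSpace.proj i : Euc d →L[ℝ] ℝ).comp (ContinuousLinearMap.snd ℝ ℝ (Euc d)) :=
    ((EuclideanSpace.proj i : Euc d →L[ℝ] ℝ).comp (ContinuousLinearMap.snd ℝ ℝ (Euc d))).fderiv
  rw [this]
  simp

lemma hh_ode (S : Setting Ω P v g) (hI : Indec P v g) (x0 : Euc d) {t : ℝ}
    (ht : t ∈ Icc (0:ℝ) 1) : hh P v g t = hh P v g 0 +
      ∫ s in (0:ℝ)..t, hh P v g s * g (s, gam x0 P v g s) := by
  rw [← S.push_prim hI x0 S.mg ht]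
  have := S.T_prim (Φ := fun _ => 1) t
  simp only [Lop_one] at this
  exact this

lemma mm_eq (S : Setting Ω P v g) (x0 : Euc d) (i : Fin d) {t : ℝ} (ht : t ∈ Icc (0:ℝ) 1) :
    hh P v g t * gam x0 P v g t i = mm P v g i t := by
  by_cases h : 0 < hh P v g t
  · rw [gam_apply h, mul_div_cancel₀ _ h.ne']
  · have h0 : hh P v g t = 0 := le_antisymm (not_lt.1 h) (S.hh_nonneg ht)
    obtain ⟨R, hR0, hR⟩ := S.coord_bound
    have := S.T_abs_le (coord_contDiff i) (C := R) (fun x _ hx => hR x.2 hx i) ht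
    rw [h0, mul_zero] at this
    rw [h0, zero_mul]
    exact (abs_nonpos_iff.1 this).symm

lemma mm_ode (S : Setting Ω P v g) (hI : Indec P v g) (x0 : Euc d) (i : Fin d) {t : ℝ}
    (ht : t ∈ Icc (0:ℝ) 1) : hh P v g t * gam x0 P v g t i = hh P v g 0 * gam x0 P v g 0 i +
      ∫ s in (0:ℝ)..t, hh P v g s *
        (v (s, gam x0 P v g s) i + gam x0 P v g s i * g (s, gam x0 P v g s)) := by
  have mv := S.mv
  have mg := S.mg
  rw [S.mm_eq x0 i ht, S.mm_eq x0 i (by simp : (0:ℝ) ∈ Icc (0:ℝ) 1),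
    ← S.push_prim (A := fun x => v x i + x.2 i * g x) hI x0 (by fun_prop) ht]
  have := S.T_prim (Φ := fun x => x.2 i) t
  simp only [Lop_coord] at this
  exact this

lemma mass_pos (S : Setting Ω P v g) {U : Set ℝ} (hU : IsOpen U) {t : ℝ} (ht : t ∈ Icc (0:ℝ) 1)
    (htU : t ∈ U) (h : 0 < hh P v g t) : P (Prod.fst ⁻¹' U) ≠ 0 := by
  have := S.fin
  intro h0
  have h1 := S.T_set (one_contDiff (d := d)) hU.measurableSet
  rw [setIntegral_measure_zero _ h0] at h1
  have hm : MeasurableSet (U ∩ Ioo 0 1) := hU.measurableSet.inter measurableSet_Ioo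
  have h2 := (setIntegral_eq_zero_iff_of_nonneg_ae (μ := volume) (s := U ∩ Ioo 0 1)
    (f := hh P v g) ?_ ?_).1 h1.symm
  · rw [EventuallyEq, ae_restrict_iff' hm] at h2
    have hV : IsOpen (U ∩ {s | 0 < hh P v g s}) :=
      hU.inter (isOpen_lt continuous_const S.hh_cont)
    have hne : ((U ∩ {s | 0 < hh P v g s}) ∩ Ioo 0 1).Nonempty := by
      have : t ∈ closure (Ioo (0:ℝ) 1) := by rw [closure_Ioo (by norm_num)]; exact ht
      exact mem_closure_iff.1 this _ hV ⟨htU, h⟩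
    refine ((hV.inter isOpen_Ioo).measure_pos volume hne).ne' (measure_mono_null ?_ h2)
    rintro s ⟨⟨hs1, hs2⟩, hs3⟩ hs
    exact (ne_of_gt hs2) (hs ⟨hs1, hs3⟩)
  · rw [EventuallyLE, ae_restrict_iff' hm]
    exact ae_of_all _ fun s hs => S.hh_nonneg (Ioo_subset_Icc_self hs.2)
  · exact (S.hh_cont.integrableOn_Icc).mono_set (inter_subset_right.trans Ioo_subset_Icc_self)

lemma hh_conn (S : Setting Ω P v g) (hI : Indec P v g) :
    IsPreconnected {t | t ∈ Icc (0:ℝ) 1 ∧ 0 < hh P v g t} := by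
  rw [isPreconnected_iff_ordConnected]
  refine ⟨fun a ha b hb t ht => ?_⟩
  have ht01 : t ∈ Icc (0:ℝ) 1 := ⟨ha.1.1.trans ht.1, ht.2.trans hb.1.2⟩
  refine ⟨ht01, ?_⟩
  by_contra hne
  have h0 : hh P v g t = 0 := le_antisymm (not_lt.1 hne) (S.hh_nonneg ht01)
  have hat : a < t := lt_of_le_of_ne ht.1 (by rintro rfl; exact hne ha.2)
  have htb : t < b := lt_of_le_of_ne ht.2 (by rintro rfl; exact hne hb.2)
  have ms : MeasurableSet {x : XX d | x.1 < t} := measurableSet_lt measurable_fst measurable_const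
  obtain ⟨c, hc⟩ := hI (indicator {x : XX d | x.1 < t} fun _ => 1)
    (measurable_const.indicator ms) (fun x => indicator_nonneg (fun _ _ => zero_le_one) x)
    (fun x => indicator_le_self' (fun _ _ => zero_le_one) x) (by
      intro φ hφ
      have e : ∀ x, (indicator {x : XX d | x.1 < t} (fun _ => (1:ℝ))) x * Lop v g φ x
          = indicator {x : XX d | x.1 < t} (Lop v g φ) x := by
        intro x
        by_cases hx : x ∈ {x : XX d | x.1 < t}
        · rw [indicator_of_mem hx, indicator_of_mem hx, one_mul]
        · rw [indicator_of_notMem hx, indicator_of_notMem hx, zero_mul]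
      simp only [e]
      rw [integral_indicator ms, ← S.T_testT hφ]
      obtain ⟨C, _, hC⟩ := S.exists_bound hφ.1.continuous
      have := S.T_abs_le hφ.1 (C := C) (fun x h1 h2 => hC x (Ioo_subset_Icc_self h1) h2) ht01
      rw [h0, mul_zero] at this
      exact abs_nonpos_iff.1 this)
  have k1 := S.mass_pos isOpen_Iio ha.1 hat ha.2
  have k2 := S.mass_pos isOpen_Ioi hb.1 htb hb.2
  obtain ⟨x, hx1, hx2⟩ := ((frequently_ae_mem_iff.2 k1).and_eventually hc).exists
  obtain ⟨y, hy1, hy2⟩ := ((frequently_ae_mem_iff.2 k2).and_eventually hc).exists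
  rw [indicator_of_mem (show x ∈ {x : XX d | x.1 < t} from hx1)] at hx2
  rw [indicator_of_notMem (show y ∉ {x : XX d | x.1 < t} from fun hlt => lt_asymm (show y.1 < t from hlt) hy1)] at hy2
  exact zero_ne_one (hy2.trans hx2.symm)

end Setting

namespace Setting
variable {Ω : Set (Euc d)} {P : Measure (XX d)} {v : XX d → Euc d} {g : XX d → ℝ}

lemma char_repr (S : Setting Ω P v g) (hI : Indec P v g) {x0 : Euc d} (hx0 : x0 ∈ Ω)
    {p : Mtriple d} (hR : Rep p P v g) :
    CharRepr Ω (gam x0 P v g) (hh P v g) (fun t => v (t, gam x0 P v g t))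
      (fun t => hh P v g t * g (t, gam x0 P v g t)) p := by
  have := S.fin
  have mv := S.mv
  have mg := S.mg
  set γ := gam x0 P v g with hγdef
  set h := hh P v g with hhdef
  set a : ℝ → ℝ := fun t => g (t, γ t) with ha
  set w : ℝ → Euc d := fun t => v (t, γ t) with hw
  have mγ : Measurable γ := S.gam_measurable x0
  have ch : Continuous h := S.hh_cont
  have mh : Measurable h := ch.measurable
  have ma : Measurable a := by fun_prop
  have mw : Measurable w := by fun_prop
  have h0 : ∀ t ∈ Icc (0:ℝ) 1, 0 ≤ h t := fun t ht => S.hh_nonneg ht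
  have hγΩ : ∀ t ∈ Icc (0:ℝ) 1, γ t ∈ Ω := fun t ht => S.gam_mem hI hx0 ht
  obtain ⟨M, hM⟩ := S.T_bd (one_contDiff (d := d))
  have hM' : ∀ t ∈ Icc (0:ℝ) 1, h t ≤ M := fun t _ => (le_abs_self _).trans (hM t)
  have M0 : 0 ≤ M := (abs_nonneg _).trans (hM 0)
  obtain ⟨R, hR0, hRb⟩ := S.coord_bound
  have i1 : IntegrableOn (fun t => h t * a t) (Icc (0:ℝ) 1) :=
    S.push_integrable hI x0 mg hR.ig
  have i2 : IntegrableOn (fun t => a t ^ 2 * h t) (Icc (0:ℝ) 1) := by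
    have := S.push_integrable hI x0 (mg.pow_const 2) S.g2.integrable_sq
    refine this.congr (ae_of_all _ fun t => ?_)
    simp only [smul_eq_mul]; exact mul_comm _ _
  have i3 : ∀ i, IntegrableOn (fun t => w t i ^ 2 * h t) (Icc (0:ℝ) 1) := by
    intro i
    have k : MemLp (fun x => v x i) 2 P := S.v2.mono (by fun_prop)
      (ae_of_all _ fun x => PiLp.norm_apply_le (v x) i)
    have := S.push_integrable hI x0 (A := fun x => v x i ^ 2) (by fun_prop) k.integrable_sq
    refine this.congr (ae_of_all _ fun t => ?_)
    simp only [smul_eq_mul]; exact mul_comm _ _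
  have ode1 : ∀ t ∈ Icc (0:ℝ) 1, h t = h 0 + ∫ s in (0:ℝ)..t, h s * a s := fun t ht =>
    S.hh_ode hI x0 ht
  have ode1' : ∀ t ∈ Icc (0:ℝ) 1, h t = h 0 + ∫ s in (0:ℝ)..t, a s * h s := by
    intro t ht
    simp only [mul_comm (a _)]
    exact ode1 t ht
  have ode2 : ∀ i, ∀ t ∈ Icc (0:ℝ) 1, h t * γ t i = h 0 * γ 0 i +
      ∫ s in (0:ℝ)..t, (w s i + γ s i * a s) * h s := by
    intro i t ht
    have := S.mm_ode hI x0 i ht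
    simp only [mul_comm (h _)] at this ⊢
    simp only [mul_comm _ (h _)] at this ⊢
    exact this
  have s1 := sqrt_ac (γ := fun _ => 1) (b := fun _ => 0) mh measurable_const ma
    measurable_const h0 hM' (C := 1) (by simp) i2 (by simp) ode1' (by
      intro t ht; simpa using ode1' t ht)
  have s2 := fun i => sqrt_ac (γ := fun t => γ t i) (b := fun t => w t i) mh (by fun_prop) ma
    (by fun_prop) h0 hM' (C := R) (fun t ht => hRb _ (hγΩ t ht) i) i2 (i3 i) ode1' (ode2 i)
  -- vector primitives
  have hMd : ∀ᵐ t, t ∈ Ioo (0:ℝ) 1 →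
      HasDerivAt (fun t => h t • γ t) (h t • (w t + a t • γ t)) t := by
    have iM : IntegrableOn (fun t => h t • (w t + a t • γ t)) (Icc (0:ℝ) 1) := by
      refine integrable_euc fun i => ?_
      have := S.push_integrable hI x0 (A := fun x => Lop v g (fun x => x.2 i) x)
        (by simp only [Lop_coord]; fun_prop) (S.integrable_Lop (coord_contDiff i))
      refine this.congr (ae_of_all _ fun t => ?_)
      simp only [Lop_coord, smul_eq_mul, PiLp.smul_apply, PiLp.add_apply]
      rw [mul_comm (a t)]
    refine ae_deriv_prim iM fun t ht => ?_
    ext i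
    have c := (EuclideanSpace.proj i : Euc d →L[ℝ] ℝ).intervalIntegral_comp_comm
      (μ := volume) (a := 0) (b := t) (f := fun t => h t • (w t + a t • γ t))
      ((intervalIntegrable_iff_integrableOn_Icc_of_le ht.1).2
        (iM.mono_set (Icc_subset_Icc_right ht.2)))
    simp only [PiLp.proj_apply] at c
    rw [PiLp.add_apply, ← c]
    simp only [smul_eq_mul, PiLp.smul_apply, PiLp.add_apply]
    rw [ode2 i t ht]
    congr 1
    refine intervalIntegral.integral_congr fun s _ => ?_
    simp only; ring
  have hhd := ae_deriv_prim i1 ode1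
  refine ⟨fun t ht => ⟨h0 t ht, hγΩ t ht⟩, ⟨_, i1, ?_, ode1⟩, ⟨_, s1.1, ?_, ?_⟩,
    ⟨fun t => Real.sqrt (h t) • (w t + (a t / 2) • γ t), ?_, ?_, ?_⟩, ?_, ⟨?_, ?_⟩, ?_, ?_, ?_⟩
  · refine Integrable.mono (i2.const_mul M) (by fun_prop) ?_
    filter_upwards [ae_restrict_mem measurableSet_Icc] with t ht
    rw [Real.norm_of_nonneg (by positivity), Real.norm_of_nonneg (mul_nonneg M0
      (mul_nonneg (sq_nonneg _) (h0 t ht))), Real.norm_eq_abs, sq_abs]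
    have := mul_le_mul_of_nonneg_right (hM' t ht) (mul_nonneg (sq_nonneg (a t)) (h0 t ht))
    nlinarith
  · simpa only [Real.norm_eq_abs, sq_abs] using s1.2.1
  · intro t ht; simpa using s1.2.2 t ht
  · refine integrable_euc fun i => (s2 i).1.congr (ae_of_all _ fun t => ?_)
    simp only [PiLp.smul_apply, PiLp.add_apply, smul_eq_mul]; ring
  · simp only [EuclideanSpace.real_norm_sq_eq]
    refine integrable_finsetSum _ fun i _ => (s2 i).2.1.congr (ae_of_all _ fun t => ?_)
    simp only [PiLp.smul_apply, PiLp.add_apply, smul_eq_mul]; ring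
  · intro t ht
    ext i
    have iM : IntegrableOn (fun t => Real.sqrt (h t) • (w t + (a t / 2) • γ t)) (Icc (0:ℝ) 1) := by
      refine integrable_euc fun i => (s2 i).1.congr (ae_of_all _ fun t => ?_)
      simp only [PiLp.smul_apply, PiLp.add_apply, smul_eq_mul]; ring
    have c := (EuclideanSpace.proj i : Euc d →L[ℝ] ℝ).intervalIntegral_comp_comm
      (μ := volume) (a := 0) (b := t) (f := fun t => Real.sqrt (h t) • (w t + (a t / 2) • γ t))
      ((intervalIntegrable_iff_integrableOn_Icc_of_le ht.1).2
        (iM.mono_set (Icc_subset_Icc_right ht.2)))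
    simp only [PiLp.proj_apply] at c
    rw [PiLp.add_apply, ← c]
    simp only [smul_eq_mul, PiLp.smul_apply, PiLp.add_apply]
    rw [(s2 i).2.2 t ht]
    congr 1
    refine intervalIntegral.integral_congr fun s _ => ?_
    simp only; ring
  · intro φ hφ t ht
    by_cases hpos : 0 < h t
    · exact (ch.continuousAt.mul (hφ.continuousAt.comp
        (S.gam_continuousAt x0 hpos))).continuousWithinAt
    · have hz : h t = 0 := le_antisymm (not_lt.1 hpos) (h0 t ht)
      obtain ⟨C, hC⟩ := S.cpt.exists_bound_of_continuousOn hφ.continuousOn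
      have k : Tendsto (fun s => C * h s) (𝓝[Icc 0 1] t) (𝓝 0) := by
        have this : ContinuousWithinAt (fun s => C * h s) (Icc (0:ℝ) 1) t :=
          ((continuous_const (y := C)).mul ch).continuousWithinAt
        have e : C * h t = 0 := by rw [hz, mul_zero]
        rw [ContinuousWithinAt, e] at this
        exact this
      rw [ContinuousWithinAt, hz, zero_mul]
      refine squeeze_zero_norm' ?_ k
      filter_upwards [self_mem_nhdsWithin] with s hs
      rw [norm_mul, Real.norm_of_nonneg (h0 s hs), mul_comm]
      exact mul_le_mul_of_nonneg_right (hC _ (hγΩ s hs)) (h0 s hs)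
  · rw [ae_restrict_iff' measurableSet_Ioo]; exact hhd
  · have ms : MeasurableSet {t | t ∈ Ioo (0:ℝ) 1 ∧ 0 < h t} :=
      measurableSet_Ioo.inter (measurableSet_lt measurable_const mh)
    rw [ae_restrict_iff' ms]
    filter_upwards [hhd, hMd] with t ht1 ht2 ht
    have d1 := ht1 ht.1
    have d2 := ht2 ht.1
    have hne : h t ≠ 0 := ne_of_gt ht.2
    have d3 := (d1.fun_inv hne).smul d2
    have e : (fun s => (h s)⁻¹ • (h s • γ s)) =ᶠ[𝓝 t] γ := by
      filter_upwards [ch.continuousAt.eventually (lt_mem_nhds ht.2)] with s hs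
      rw [smul_smul, inv_mul_cancel₀ (ne_of_gt hs), one_smul]
    have d4 := d3.congr_of_eventuallyEq e.symm
    have e5 : (h t)⁻¹ • h t • (w t + a t • γ t) + (-(h t * a t) / h t ^ 2) • h t • γ t = w t := by
      ext i
      simp only [PiLp.smul_apply, PiLp.add_apply, smul_eq_mul]
      field_simp
      ring
    rw [e5] at d4
    exact d4
  · intro s hs
    rw [hR.h1 s hs]
    have := S.push_int hI x0 (A := fun _ => (1:ℝ)) measurable_const hs
    simp only [smul_eq_mul, mul_one, integral_const, measureReal_restrict_apply_univ] at this
    exact this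
  · intro s hs
    rw [hR.h2 s hs]
    exact S.push_int hI x0 mv hs
  · intro s hs
    rw [hR.h3 s hs]
    exact S.push_int hI x0 mg hs

end Setting

lemma extreme_subset {α β δ : ℝ} (hα : 0 < α) (hβ : 0 < β) (hδ : 0 < δ) {Ω : Set (Euc d)}
    (hΩ : IsClosureOfBoundedDomain Ω) {p : Mtriple d}
    (hp : p ∈ extremePoints ℝ (Ball α β δ Ω)) (hp0 : p ≠ 0) : MemC α β δ Ω p := by
  obtain ⟨hc, x0, hx0⟩ := compact_of_domain hΩ
  have hJ := ne_top_of_le_ne_top ENNReal.one_ne_top hp.1.2.2.2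
  obtain ⟨P, v, g, hR⟩ := exists_rep hα hβ hδ hJ
  have S := hR.setting hα hβ hδ hJ hc hp.1.1
  have hiL : ∀ φ, IsTest φ → Integrable (Lop v g φ) P := fun φ hφ => S.integrable_Lop hφ.1
  have hI : Indec P v g := fun f hf h0 h1 hce =>
    ⟨_, const_of_extreme hα hβ hc hp hR hf h0 h1 (fun φ hφ => hce φ hφ.testT) hiL⟩
  exact ⟨_, _, _, _, S.char_repr hI hx0 hR, S.hh_conn hI,
    J_one_of_extreme hα hβ hc hp hp0 hR hiL⟩

lemma comb_apply1 {x y : Mtriple d} {a b : ℝ} (s : Set (XX d)) :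
    (a • x + b • y).1 s = a * x.1 s + b * y.1 s := by
  simp

lemma comb_apply2 {x y : Mtriple d} {a b : ℝ} (s : Set (XX d)) :
    (a • x + b • y).2.1 s = a • x.2.1 s + b • y.2.1 s := by
  simp

lemma comb_apply3 {x y : Mtriple d} {a b : ℝ} (s : Set (XX d)) :
    (a • x + b • y).2.2 s = a * x.2.2 s + b * y.2.2 s := by
  simp

lemma comb_measure {p x y : Mtriple d} {a b : ℝ} (ha : 0 < a) (hb : 0 < b)
    (hp : a • x + b • y = p)
    {P P1 P2 : Measure (XX d)} {v v1 v2 : XX d → Euc d} {g g1 g2 : XX d → ℝ}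
    (h : Rep p P v g) (h1 : Rep x P1 v1 g1) (h2 : Rep y P2 v2 g2) :
    P = ENNReal.ofReal a • P1 + ENNReal.ofReal b • P2 := by
  have := h.fin
  have := h1.fin
  have := h2.fin
  ext s hs
  have e := h.h1 s hs
  rw [← hp, comb_apply1, h1.h1 s hs, h2.h1 s hs] at e
  rw [← ENNReal.ofReal_toReal (measure_ne_top P s)]
  change ENNReal.ofReal (P.real s) = _
  rw [← e, ENNReal.ofReal_add (by positivity) (by positivity), ENNReal.ofReal_mul ha.le,
    ENNReal.ofReal_mul hb.le, Measure.real, Measure.real,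
    ENNReal.ofReal_toReal (measure_ne_top _ s), ENNReal.ofReal_toReal (measure_ne_top _ s)]
  simp

lemma exists_real_density {X : Type*} [MeasurableSpace X] {P P1 : Measure X}
    [IsFiniteMeasure P] [IsFiniteMeasure P1]
    (h : P1 ≪ P) : ∃ f : X → ℝ, Measurable f ∧ (∀ x, 0 ≤ f x) ∧
      P1 = P.withDensity fun x => ENNReal.ofReal (f x) := by
  refine ⟨fun x => (P1.rnDeriv P x).toReal, (Measure.measurable_rnDeriv _ _).ennreal_toReal,
    fun x => ENNReal.toReal_nonneg, ?_⟩
  have e := Measure.withDensity_rnDeriv_eq P1 P h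
  refine e.symm.trans (withDensity_congr_ae ?_)
  filter_upwards [Measure.rnDeriv_lt_top P1 P] with x hx
  rw [ENNReal.ofReal_toReal hx.ne]

lemma convex_gap {E : Type*} [NormedAddCommGroup E] [InnerProductSpace ℝ E] {u u1 u2 : E}
    {r1 r2 : ℝ} (h2 : 0 ≤ r2) (h12 : r1 + r2 = 1) (hu : u = r1 • u1 + r2 • u2) :
    r1 * ‖u1 - u‖ ^ 2 ≤ r1 * ‖u1‖ ^ 2 + r2 * ‖u2‖ ^ 2 - ‖u‖ ^ 2 := by
  have e1 := norm_sub_sq_real u1 u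
  have e2 := norm_sub_sq_real u2 u
  have e3 : r1 * inner ℝ u1 u + r2 * inner ℝ u2 u = ‖u‖ ^ 2 := by
    rw [← real_inner_self_eq_norm_sq u]
    conv_rhs => arg 2; rw [hu]
    rw [inner_add_left, real_inner_smul_left, real_inner_smul_left]
  have e4 : 0 ≤ r2 * ‖u2 - u‖ ^ 2 := by positivity
  have e5 : r2 = 1 - r1 := by linarith
  rw [e1]
  rw [e2] at e4
  nlinarith

lemma conv_split {α β δ : ℝ} (hα : 0 < α) (hβ : 0 < β) (hδ : 0 < δ)
    {p x y : Mtriple d} {a b : ℝ} (ha : 0 < a) (hb : 0 < b) (hab : a + b = 1)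
    (hp : a • x + b • y = p)
    (Jp : JSigned α β δ p.1 p.2.1 p.2.2 = 1)
    (Jx : JSigned α β δ x.1 x.2.1 x.2.2 ≤ 1) (Jy : JSigned α β δ y.1 y.2.1 y.2.2 ≤ 1)
    {P : Measure (XX d)} {v : XX d → Euc d} {g : XX d → ℝ} (h : Rep p P v g) :
    ∃ P1, P1 ≪ P ∧ Rep x P1 v g := by
  have tx := ne_top_of_le_ne_top ENNReal.one_ne_top Jx
  have ty := ne_top_of_le_ne_top ENNReal.one_ne_top Jy
  obtain ⟨P1, v1, g1, h1⟩ := exists_rep hα hβ hδ tx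
  obtain ⟨P2, v2, g2, h2⟩ := exists_rep hα hβ hδ ty
  have := h.fin
  have := h1.fin
  have := h2.fin
  have eP := comb_measure ha hb hp h h1 h2
  have ac1 : P1 ≪ P := by
    intro s hs
    rw [eP] at hs
    simp only [Measure.add_apply, Measure.smul_apply, smul_eq_mul, add_eq_zero, mul_eq_zero,
      ENNReal.ofReal_eq_zero] at hs
    exact hs.1.resolve_left (not_le.2 ha)
  have ac2 : P2 ≪ P := by
    intro s hs
    rw [eP] at hs
    simp only [Measure.add_apply, Measure.smul_apply, smul_eq_mul, add_eq_zero, mul_eq_zero,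
      ENNReal.ofReal_eq_zero] at hs
    exact hs.2.resolve_left (not_le.2 hb)
  obtain ⟨f1, mf1, f10, e1⟩ := exists_real_density ac1
  obtain ⟨f2, mf2, f20, e2⟩ := exists_real_density ac2
  have z1 : 0 ≤ᵐ[P] f1 := ae_of_all _ f10
  have z2 : 0 ≤ᵐ[P] f2 := ae_of_all _ f20
  have tr1 : ∀ (A : XX d → ℝ) s, MeasurableSet s → ∫ x in s, A x ∂P1 = ∫ x in s, f1 x * A x ∂P := by
    intro A s hs; rw [e1, setIntegral_withDensity_ofReal _ _ mf1 z1 _ _ hs]; rfl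
  have tr2 : ∀ (A : XX d → ℝ) s, MeasurableSet s → ∫ x in s, A x ∂P2 = ∫ x in s, f2 x * A x ∂P := by
    intro A s hs; rw [e2, setIntegral_withDensity_ofReal _ _ mf2 z2 _ _ hs]; rfl
  have tv1 : ∀ (A : XX d → Euc d) s, MeasurableSet s →
      ∫ x in s, A x ∂P1 = ∫ x in s, f1 x • A x ∂P := by
    intro A s hs; rw [e1, setIntegral_withDensity_ofReal _ _ mf1 z1 _ _ hs]
  have tv2 : ∀ (A : XX d → Euc d) s, MeasurableSet s →
      ∫ x in s, A x ∂P2 = ∫ x in s, f2 x • A x ∂P := by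
    intro A s hs; rw [e2, setIntegral_withDensity_ofReal _ _ mf2 z2 _ _ hs]
  have ti1 : ∀ (A : XX d → ℝ), Integrable A P1 → Integrable (fun x => f1 x * A x) P := by
    intro A hA; rw [e1, integrable_withDensity_ofReal _ _ mf1 z1] at hA; exact hA
  have ti2 : ∀ (A : XX d → ℝ), Integrable A P2 → Integrable (fun x => f2 x * A x) P := by
    intro A hA; rw [e2, integrable_withDensity_ofReal _ _ mf2 z2] at hA; exact hA
  have tj1 : Integrable (fun x => f1 x • v1 x) P := by
    have hA := h1.iv
    rw [e1, integrable_withDensity_ofReal _ _ mf1 z1] at hA; exact hA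
  have tj2 : Integrable (fun x => f2 x • v2 x) P := by
    have hA := h2.iv
    rw [e2, integrable_withDensity_ofReal _ _ mf2 z2] at hA; exact hA
  have if1 : Integrable f1 P := by simpa using ti1 (fun _ => 1) (integrable_const _)
  have if2 : Integrable f2 P := by simpa using ti2 (fun _ => 1) (integrable_const _)
  have q1 : (fun _ => (1:ℝ)) =ᵐ[P] fun x => a * f1 x + b * f2 x := by
    refine Integrable.ae_eq_of_forall_setIntegral_eq _ _ (integrable_const _)
      ((if1.const_mul a).add (if2.const_mul b)) fun s hs _ => ?_
    have k1 := tr1 (fun _ => 1) s hs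
    have k2 := tr2 (fun _ => 1) s hs
    have k := h.h1 s hs
    rw [← hp, comb_apply1, h1.h1 s hs, h2.h1 s hs] at k
    simp only [smul_eq_mul, mul_one, integral_const, measureReal_restrict_apply_univ] at k1 k2 ⊢
    rw [integral_add (if1.const_mul a).integrableOn (if2.const_mul b).integrableOn,
      integral_const_mul, integral_const_mul, ← k1, ← k2, k]
  have q2 : v =ᵐ[P] fun x => a • f1 x • v1 x + b • f2 x • v2 x := by
    refine Integrable.ae_eq_of_forall_setIntegral_eq _ _ h.iv
      ((tj1.smul a).add (tj2.smul b)) fun s hs _ => ?_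
    have k := h.h2 s hs
    rw [← hp, comb_apply2, h1.h2 s hs, h2.h2 s hs, tv1 _ s hs, tv2 _ s hs] at k
    rw [integral_add (show Integrable (fun x => a • f1 x • v1 x) (P.restrict s) from
      (tj1.smul a).integrableOn) (show Integrable (fun x => b • f2 x • v2 x) (P.restrict s) from
      (tj2.smul b).integrableOn), integral_smul, integral_smul, k]
  have q3 : g =ᵐ[P] fun x => a * (f1 x * g1 x) + b * (f2 x * g2 x) := by
    have t1 := ti1 _ h1.ig
    have t2 := ti2 _ h2.ig
    refine Integrable.ae_eq_of_forall_setIntegral_eq _ _ h.ig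
      ((t1.const_mul a).add (t2.const_mul b)) fun s hs _ => ?_
    have k := h.h3 s hs
    rw [← hp, comb_apply3, h1.h3 s hs, h2.h3 s hs, tr1 _ s hs, tr2 _ s hs] at k
    rw [integral_add (t1.const_mul a).integrableOn (t2.const_mul b).integrableOn,
      integral_const_mul, integral_const_mul, k]
  obtain ⟨-, ien, eJ⟩ := h.en_facts hα hβ (by rw [Jp]; exact ENNReal.one_ne_top)
  obtain ⟨-, ien1, eJ1⟩ := h1.en_facts hα hβ tx
  obtain ⟨-, ien2, eJ2⟩ := h2.en_facts hα hβ ty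
  rw [eJ1] at Jx
  rw [eJ2] at Jy
  rw [eJ] at Jp
  have Jx' : ∫ x, f1 x * en α β δ v1 g1 x ∂P ≤ 1 := by
    have := tr1 (en α β δ v1 g1) univ MeasurableSet.univ
    simp only [Measure.restrict_univ] at this
    rw [← this]; rwa [ENNReal.ofReal_le_one] at Jx
  have Jy' : ∫ x, f2 x * en α β δ v2 g2 x ∂P ≤ 1 := by
    have := tr2 (en α β δ v2 g2) univ MeasurableSet.univ
    simp only [Measure.restrict_univ] at this
    rw [← this]; rwa [ENNReal.ofReal_le_one] at Jy
  have Jp' : ∫ x, en α β δ v g x ∂P = 1 := by rwa [ENNReal.ofReal_eq_one] at Jp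
  have i1 := ti1 _ ien1
  have i2 := ti2 _ ien2
  set D : XX d → ℝ := fun x => a * (f1 x * en α β δ v1 g1 x) + b * (f2 x * en α β δ v2 g2 x)
    - en α β δ v g x with hD
  have iD : Integrable D P := ((i1.const_mul a).add (i2.const_mul b)).sub ien
  have hDint : ∫ x, D x ∂P ≤ 0 := by
    rw [hD, integral_sub (show Integrable (fun x => a * (f1 x * en α β δ v1 g1 x)
      + b * (f2 x * en α β δ v2 g2 x)) P from (i1.const_mul a).add (i2.const_mul b)) ien,
      integral_add (i1.const_mul a) (i2.const_mul b), integral_const_mul, integral_const_mul, Jp']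
    nlinarith
  have hDge : ∀ᵐ x ∂P, 0 ≤ β / 2 * (a * f1 x * (‖v1 x - v x‖ ^ 2 + δ ^ 2 * (g1 x - g x) ^ 2)) ∧
      β / 2 * (a * f1 x * (‖v1 x - v x‖ ^ 2 + δ ^ 2 * (g1 x - g x) ^ 2)) ≤ D x := by
    filter_upwards [q1, q2, q3] with x w1 w2 w3
    have n1 := f10 x
    have n2 := f20 x
    refine ⟨by positivity, ?_⟩
    have c1 := convex_gap (u := v x) (u1 := v1 x) (u2 := v2 x) (r1 := a * f1 x) (r2 := b * f2 x)
      (by positivity) w1.symm (by rw [w2, mul_smul, mul_smul])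
    have c2 := convex_gap (u := g x) (u1 := g1 x) (u2 := g2 x) (r1 := a * f1 x) (r2 := b * f2 x)
      (by positivity) w1.symm (by rw [w3, smul_eq_mul, smul_eq_mul]; ring)
    simp only [Real.norm_eq_abs, sq_abs] at c2
    have c3 := mul_le_mul_of_nonneg_left c2 (sq_nonneg δ)
    have c4 := mul_le_mul_of_nonneg_left (add_le_add c1 c3) (by positivity : 0 ≤ β / 2)
    refine le_trans (le_of_eq (by ring)) (c4.trans (le_of_eq ?_))
    simp only [hD, en, eden]
    linear_combination α * w1
  have hD0 : D =ᵐ[P] 0 := by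
    have n : 0 ≤ᵐ[P] D := by filter_upwards [hDge] with x hx using hx.1.trans hx.2
    exact (integral_eq_zero_iff_of_nonneg_ae n iD).1
      (le_antisymm hDint (integral_nonneg_of_ae n))
  have hae : ∀ᵐ x ∂P1, v1 x = v x ∧ g1 x = g x := by
    rw [e1, ae_withDensity_iff (by fun_prop)]
    filter_upwards [hDge, hD0] with x w1 w2 hx
    have fp : 0 < f1 x := by simpa using hx
    rw [w2] at w1
    have w3 := le_antisymm w1.2 w1.1
    have hc : 0 < β / 2 * (a * f1 x) := by positivity
    rw [← mul_assoc] at w3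
    have w4 := (mul_eq_zero.1 w3).resolve_left hc.ne'
    have n1 : 0 ≤ ‖v1 x - v x‖ ^ 2 := by positivity
    have n2 : 0 ≤ δ ^ 2 * (g1 x - g x) ^ 2 := by positivity
    constructor
    · have : ‖v1 x - v x‖ ^ 2 = 0 := by linarith
      exact sub_eq_zero.1 (norm_eq_zero.1 (pow_eq_zero_iff two_ne_zero |>.1 this))
    · have : δ ^ 2 * (g1 x - g x) ^ 2 = 0 := by linarith
      have := (mul_eq_zero.1 this).resolve_left (by positivity)
      exact sub_eq_zero.1 (pow_eq_zero_iff two_ne_zero |>.1 this)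
  have av : v1 =ᵐ[P1] v := hae.mono fun x hx => hx.1
  have ag : g1 =ᵐ[P1] g := hae.mono fun x hx => hx.2
  refine ⟨P1, ac1, h1.fin, h.mv, h.mg, h1.iv.congr av, h1.ig.congr ag, h1.h1, ?_, ?_⟩
  · intro s hs
    rw [h1.h2 s hs]
    exact integral_congr_ae (ae_restrict_of_ae av)
  · intro s hs
    rw [h1.h3 s hs]
    exact integral_congr_ae (ae_restrict_of_ae ag)

lemma ratio_const {h k G : ℝ → ℝ} (ih : IntegrableOn (fun t => h t * G t) (Icc (0:ℝ) 1))
    (ik : IntegrableOn (fun t => k t * G t) (Icc (0:ℝ) 1))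
    (hh : ∀ t ∈ Icc (0:ℝ) 1, h t = h 0 + ∫ s in (0:ℝ)..t, h s * G s)
    (hk : ∀ t ∈ Icc (0:ℝ) 1, k t = k 0 + ∫ s in (0:ℝ)..t, k s * G s)
    (ch : Continuous h) {s t : ℝ} (hs : 0 ≤ s) (hst : s ≤ t) (ht : t ≤ 1)
    (hpos : ∀ u ∈ Icc s t, 0 < h u) : k s * h t = k t * h s := by
  have hsub : uIcc s t ⊆ uIcc (0:ℝ) 1 := by
    rw [uIcc_of_le hst, uIcc_of_le zero_le_one]; exact Icc_subset_Icc hs ht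
  have ach := (ac_prim ih hh).mono hsub
  have ack := (ac_prim ik hk).mono hsub
  obtain ⟨u0, hu0, hmin⟩ := isCompact_Icc.exists_isMinOn (nonempty_Icc.2 hst) ch.continuousOn
  have m0 := hpos u0 hu0
  have aci : AbsolutelyContinuousOnInterval (fun u => (h u)⁻¹) s t := by
    refine ac_of_dist_le (K := ((h u0) ^ 2)⁻¹) ach ?_
    intro x hx y hy
    rw [uIcc_of_le hst] at hx hy
    have hx0 := hpos x hx
    have hy0 := hpos y hy
    have l1 : h u0 ≤ h x := hmin hx
    have l2 : h u0 ≤ h y := hmin hy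
    rw [Real.dist_eq, Real.dist_eq, inv_sub_inv hx0.ne' hy0.ne', abs_div, abs_sub_comm,
      div_eq_inv_mul, abs_of_pos (mul_pos hx0 hy0)]
    gcongr
    nlinarith
  have acq := ack.fun_mul aci
  have d1 := ae_deriv_prim ih hh
  have d2 := ae_deriv_prim ik hk
  have hne : ∀ᵐ s : ℝ, s ≠ 1 := by simp [ae_iff, measure_singleton]
  have hne0 : ∀ᵐ s : ℝ, s ≠ 0 := by simp [ae_iff, measure_singleton]
  have cst := acq.const_of_ae_hasDerivAt_zero (by
    filter_upwards [d1, d2, hne, hne0] with x w1 w2 w3 w4 hx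
    have hx' := hsub hx
    rw [uIcc_of_le hst] at hx
    rw [uIcc_of_le zero_le_one] at hx'
    have hx'' : x ∈ Ioo (0:ℝ) 1 := ⟨lt_of_le_of_ne hx'.1 (Ne.symm w4), lt_of_le_of_ne hx'.2 w3⟩
    have p0 := hpos x hx
    have := (w2 hx'').fun_mul ((w1 hx'').fun_inv p0.ne')
    refine this.congr_deriv ?_
    have p1 := p0.ne'
    field_simp
    ring)
  obtain ⟨C, hC⟩ := cst
  have e1 := hC s left_mem_uIcc
  have e2 := hC t right_mem_uIcc
  have p1 := hpos s ⟨le_rfl, hst⟩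
  have p2 := hpos t ⟨hst, le_rfl⟩
  have e3 : k s = C * h s := by rw [← e1]; field_simp
  have e4 : k t = C * h t := by rw [← e2]; field_simp
  rw [e3, e4]; ring

namespace Setting
variable {Ω : Set (Euc d)} {P P1 : Measure (XX d)} {v : XX d → Euc d} {g : XX d → ℝ}

lemma graph_measure (S : Setting Ω P v g) {c : ℝ → Euc d} (mc : Measurable c)
    (hg : ∀ᵐ x ∂P, x.2 = c x.1) :
    P = Measure.map (fun t => (t, c t))
      ((volume.restrict (Ioo (0:ℝ) 1)).withDensity fun t => ENNReal.ofReal (hh P v g t)) := by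
  have := S.fin
  have mG : Measurable (fun t => (t, c t)) := measurable_id.prodMk mc
  have ih : IntegrableOn (hh P v g) (Ioo (0:ℝ) 1) :=
    (S.hh_cont.integrableOn_Icc).mono_set Ioo_subset_Icc_self
  ext s hs
  rw [Measure.map_apply mG hs, withDensity_apply _ (mG hs)]
  have e1 : P s = P (Prod.fst ⁻¹' ((fun t => (t, c t)) ⁻¹' s)) := by
    apply measure_congr
    filter_upwards [hg] with x hx
    have : x = (x.1, c x.1) := Prod.ext rfl hx
    refine propext ?_
    constructor
    · intro h; change (x.1, c x.1) ∈ s; rwa [← this]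
    · intro h; change (x.1, c x.1) ∈ s at h; rwa [← this] at h
  have e2 := S.T_set (one_contDiff (d := d)) (mG hs)
  simp only [integral_const, smul_eq_mul, mul_one, measureReal_restrict_apply_univ] at e2
  rw [Measure.restrict_restrict (mG hs), ← ofReal_integral_eq_lintegral_ofReal]
  · rw [e1, ← ENNReal.ofReal_toReal (measure_ne_top P _)]
    congr 1
  · exact ih.mono_set inter_subset_right
  · rw [← Measure.restrict_restrict (mG hs)]
    exact ae_restrict_of_ae S.hh_ae

lemma graph_ode (S : Setting Ω P v g) {c : ℝ → Euc d} (mc : Measurable c)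
    (hg : ∀ᵐ x ∂P, x.2 = c x.1) :
    IntegrableOn (fun t => hh P v g t * g (t, c t)) (Icc (0:ℝ) 1) ∧
    ∀ t ∈ Icc (0:ℝ) 1, hh P v g t = hh P v g 0 + ∫ s in (0:ℝ)..t, hh P v g s * g (s, c s) := by
  have := S.fin
  have e := S.graph_measure mc hg
  have m : Measurable (fun t => (t, c t)) := measurable_id.prodMk mc
  constructor
  · have iA : Integrable g P := S.g2.integrable (by norm_num)
    rw [e, integrable_map_measure S.mg.aestronglyMeasurable m.aemeasurable,
      integrable_withDensity_ofReal _ _ S.hh_cont.measurable S.hh_ae] at iA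
    rw [integrableOn_Icc_iff_integrableOn_Ioo]
    exact iA
  · intro t ht
    have h1 := S.T_prim (Φ := fun _ => 1) t
    simp only [Lop_one] at h1
    refine h1.trans ?_
    congr 1
    have hs : MeasurableSet {x : XX d | x.1 < t} := measurableSet_lt measurable_fst measurable_const
    have h2 : ∫ x in {x : XX d | x.1 < t}, g x ∂P
        = ∫ x in {x : XX d | x.1 < t}, g x ∂(Measure.map (fun t => (t, c t))
      ((volume.restrict (Ioo (0:ℝ) 1)).withDensity fun t => ENNReal.ofReal (hh P v g t))) := by
      rw [← e]
    rw [h2, setIntegral_map hs S.mg.aestronglyMeasurable m.aemeasurable,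
      setIntegral_withDensity_ofReal _ _ S.hh_cont.measurable S.hh_ae _ _ (m hs),
      Measure.restrict_restrict (m hs)]
    have h3 : (fun t => (t, c t)) ⁻¹' {x : XX d | x.1 < t} ∩ Ioo 0 1 = Ioo 0 t := by
      ext u; simp only [mem_inter_iff, mem_preimage, mem_setOf_eq, mem_Ioo]
      exact ⟨fun h => ⟨h.2.1, h.1⟩, fun h => ⟨h.2, h.1, h.2.trans_le ht.2⟩⟩
    rw [h3, intervalIntegral.integral_of_le ht.1, integral_Ioc_eq_integral_Ioo]
    rfl

lemma char_graph (S : Setting Ω P v g) {γ : ℝ → Euc d} {h : ℝ → ℝ} {γ' : ℝ → Euc d}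
    {h' : ℝ → ℝ} {p : Mtriple d} (hc : CharRepr Ω γ h γ' h' p) (R : Rep p P v g) :
    EqOn (hh P v g) h (Icc 0 1) ∧ ∃ c : ℝ → Euc d, Measurable c ∧ ∀ᵐ x ∂P, x.2 = c x.1 := by
  have := S.fin
  obtain ⟨hc1, -, -, -, hcont, -, hr, -⟩ := hc
  have ch : ContinuousOn h (Icc 0 1) := by
    simpa using hcont (fun _ => 1) continuous_const
  have cF : Continuous (IccExtend (zero_le_one (α := ℝ)) ((Icc (0:ℝ) 1).restrict h)) :=
    (continuousOn_iff_continuous_restrict.1 ch).Icc_extend'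
  have eh : EqOn (hh P v g) h (Icc 0 1) := by
    have h1 := S.T_unique (one_contDiff (d := d)) cF (by
      intro s hs
      have k := R.h1 (Prod.fst ⁻¹' s) (measurable_fst hs)
      rw [hr _ (measurable_fst hs)] at k
      simp only [integral_const, smul_eq_mul, mul_one, measureReal_restrict_apply_univ]
      rw [← k]
      have : {u : ℝ | (u, γ u) ∈ (Prod.fst ⁻¹' s : Set (XX d))} = s := rfl
      rw [this, integral_indicator hs, Measure.restrict_restrict hs]
      refine setIntegral_congr_fun (hs.inter measurableSet_Ioo) fun t ht => ?_
      simp only [IccExtend_of_mem zero_le_one _ (Ioo_subset_Icc_self ht.2)]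
      rfl)
    intro t ht
    rw [hh, h1 ht, IccExtend_of_mem zero_le_one _ ht]
    rfl
  refine ⟨eh, ?_⟩
  let F : Fin d → ℝ → ℝ := fun i => IccExtend (zero_le_one (α := ℝ))
    ((Icc (0:ℝ) 1).restrict fun t => h t * γ t i)
  have cFi : ∀ i, Continuous (F i) := fun i =>
    (continuousOn_iff_continuous_restrict.1 (hcont (fun y => y i) (by fun_prop))).Icc_extend'
  let c : ℝ → Euc d := fun t => WithLp.toLp 2 (fun i => F i t / hh P v g t)
  have mc : Measurable c := by
    have : Measurable (fun t => fun i => F i t / hh P v g t) :=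
      measurable_pi_lambda _ fun i => (cFi i).measurable.div S.hh_cont.measurable
    exact (WithLp.measurable_toLp 2 _).comp this
  have hcg : ∀ t ∈ Ioo (0:ℝ) 1, γ t ≠ c t → h t = 0 := by
    intro t ht hne
    by_contra h0
    refine hne ?_
    ext i
    have htI := Ioo_subset_Icc_self ht
    change γ t i = F i t / hh P v g t
    have : F i t = h t * γ t i := by
      simp only [F]; rw [IccExtend_of_mem zero_le_one _ htI]; rfl
    rw [this, eh htI]; field_simp
  refine ⟨c, mc, ?_⟩
  have ms : MeasurableSet {x : XX d | ¬ x.2 = c x.1} :=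
    (measurableSet_eq_fun measurable_snd (mc.comp measurable_fst)).compl
  have k := R.h1 _ ms
  rw [hr _ ms, setIntegral_eq_zero_of_forall_eq_zero] at k
  · rw [ae_iff]
    exact (measureReal_eq_zero_iff).1 k.symm
  · intro t ht
    by_cases hx : γ t = c t
    · exact indicator_of_notMem (by simpa using hx) _
    · rw [indicator_of_mem (by simpa using hx)]
      exact hcg t ht hx

lemma prop_measure (S : Setting Ω P v g) (S1 : Setting Ω P1 v g) (ac : P1 ≪ P)
    {c : ℝ → Euc d} (mc : Measurable c) (hg : ∀ᵐ x ∂P, x.2 = c x.1)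
    (conn : IsPreconnected {t | t ∈ Icc (0:ℝ) 1 ∧ 0 < hh P v g t}) :
    ∃ κ : ℝ, 0 ≤ κ ∧ P1 = ENNReal.ofReal κ • P := by
  by_cases hex : ∃ t ∈ Ioo (0:ℝ) 1, 0 < hh P v g t
  swap
  · push Not at hex
    have hP : P = 0 := by
      rw [← ae_eq_bot, ← Filter.eventually_false_iff_eq_bot]
      filter_upwards [S.ae_hh_pos, S.ae_time] with x h1 h2
      exact absurd h1 (not_lt.2 (hex _ h2))
    subst hP
    refine ⟨0, le_rfl, ?_⟩
    rw [Measure.absolutelyContinuous_zero_iff.1 ac]; simp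
  obtain ⟨t0, ht0, hp0⟩ := hex
  have hg1 := ac.ae_le hg
  obtain ⟨i1, o1⟩ := S.graph_ode mc hg
  obtain ⟨i2, o2⟩ := S1.graph_ode mc hg1
  have ord := isPreconnected_iff_ordConnected.1 conn
  obtain ⟨κ, hκ⟩ : ∃ κ, κ = hh P1 v g t0 / hh P v g t0 := ⟨_, rfl⟩
  have hκ0 : 0 ≤ κ := by
    rw [hκ]; exact div_nonneg (S1.hh_nonneg (Ioo_subset_Icc_self ht0)) hp0.le
  refine ⟨κ, hκ0, ?_⟩
  have key : ∀ t ∈ Ioo (0:ℝ) 1, 0 < hh P v g t →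
      hh P1 v g t = κ * hh P v g t := by
    intro t ht hpt
    have mt : t ∈ {t | t ∈ Icc (0:ℝ) 1 ∧ 0 < hh P v g t} := ⟨Ioo_subset_Icc_self ht, hpt⟩
    have mt0 : t0 ∈ {t | t ∈ Icc (0:ℝ) 1 ∧ 0 < hh P v g t} := ⟨Ioo_subset_Icc_self ht0, hp0⟩
    rw [hκ, div_mul_eq_mul_div, eq_div_iff hp0.ne']
    rcases le_total t t0 with hle | hle
    · exact ratio_const i1 i2 o1 o2 S.hh_cont ht.1.le hle ht0.2.le
        fun u hu => (ord.out mt mt0 hu).2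
    · exact (ratio_const i1 i2 o1 o2 S.hh_cont ht0.1.le hle ht.2.le
        fun u hu => (ord.out mt0 mt hu).2).symm
  have m : Measurable (fun t => (t, c t)) := measurable_id.prodMk mc
  have e := S.graph_measure mc hg
  have e1 := S1.graph_measure mc hg1
  have z := ac.ae_le S.ae_hh_pos
  rw [e1] at z
  have z1 := ae_of_ae_map m.aemeasurable z
  rw [ae_withDensity_iff (by have := S1.hh_cont.measurable; fun_prop)] at z1
  rw [e1]
  conv_rhs => rw [e]
  rw [← Measure.map_smul, ← withDensity_smul _ (by have := S.hh_cont.measurable; fun_prop)]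
  congr 1
  refine withDensity_congr_ae ?_
  filter_upwards [z1, ae_restrict_mem measurableSet_Ioo] with t w1 ht
  simp only [Pi.smul_apply, smul_eq_mul]
  by_cases hpt : 0 < hh P v g t
  · rw [key t ht hpt, ENNReal.ofReal_mul hκ0]
  · have : ENNReal.ofReal (hh P1 v g t) = 0 := by
      by_contra h0; exact hpt (w1 h0)
    rw [this, ENNReal.ofReal_of_nonpos (not_lt.1 hpt), mul_zero]

end Setting

lemma zero_mem_ball {α β δ : ℝ} (hα : 0 < α) (hβ : 0 < β) (Ω : Set (Euc d)) :
    (0 : Mtriple d) ∈ Ball α β δ Ω := by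
  have R : Rep (0 : Mtriple d) 0 0 0 := by
    refine ⟨inferInstance, measurable_const, measurable_const, ?_, ?_, ?_, ?_, ?_⟩ <;> simp
  obtain ⟨c1, c2, c3⟩ := R.conc_of (Ω := Ω) (by simp)
  refine ⟨c1, c2, c3, ?_⟩
  rw [R.J_eq hα hβ δ, if_pos]
  · simp
  · intro φ hφ; simp

lemma zero_extreme {α β δ : ℝ} (hα : 0 < α) (hβ : 0 < β) (hδ : 0 < δ) (Ω : Set (Euc d)) :
    (0 : Mtriple d) ∈ extremePoints ℝ (Ball α β δ Ω) := by
  have R : Rep (0 : Mtriple d) 0 0 0 := by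
    refine ⟨inferInstance, measurable_const, measurable_const, ?_, ?_, ?_, ?_, ?_⟩ <;> simp
  rw [mem_extremePoints]
  refine ⟨zero_mem_ball hα hβ Ω, ?_⟩
  rintro x hx y hy ⟨a, b, ha, hb, hab, hp⟩
  obtain ⟨P1, v1, g1, h1⟩ := exists_rep hα hβ hδ (ne_top_of_le_ne_top ENNReal.one_ne_top hx.2.2.2)
  obtain ⟨P2, v2, g2, h2⟩ := exists_rep hα hβ hδ (ne_top_of_le_ne_top ENNReal.one_ne_top hy.2.2.2)
  have e := comb_measure ha hb hp R h1 h2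
  have e' : ∀ s, P1 s = 0 ∧ P2 s = 0 := by
    intro s
    have := congrArg (fun m : Measure (XX d) => m s) e
    simp only [Measure.coe_zero, Pi.zero_apply, Measure.add_apply, Measure.smul_apply,
      smul_eq_mul] at this
    have := this.symm
    simp only [add_eq_zero, mul_eq_zero, ENNReal.ofReal_eq_zero] at this
    exact ⟨this.1.resolve_left (not_le.2 ha), this.2.resolve_left (not_le.2 hb)⟩
  refine ⟨rep_zero_of h1 ?_, rep_zero_of h2 ?_⟩
  · ext s hs; simpa using (e' s).1
  · ext s hs; simpa using (e' s).2

lemma MemC.mem_ball {α β δ : ℝ} {Ω : Set (Euc d)} {p : Mtriple d}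
    (hp : MemC α β δ Ω p) : p ∈ Ball α β δ Ω := by
  obtain ⟨γ, h, γ', h', hc, -, hJ⟩ := hp
  obtain ⟨hc1, -, -, -, -, -, r1, r2, r3⟩ := hc
  have key : ∀ s : Set (XX d), s ⊆ (Ioo (0:ℝ) 1 ×ˢ Ω)ᶜ → ∀ t ∈ Ioo (0:ℝ) 1,
      t ∉ {u : ℝ | (u, γ u) ∈ s} := by
    intro s hs t ht hts
    exact hs hts ⟨ht, (hc1 t (Ioo_subset_Icc_self ht)).2⟩
  refine ⟨?_, ?_, ?_, hJ.le⟩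
  · intro s hs hss
    rw [r1 s hs]
    exact setIntegral_eq_zero_of_forall_eq_zero fun t ht => indicator_of_notMem (key s hss t ht) _
  · intro s hs hss
    rw [r2 s hs]
    exact setIntegral_eq_zero_of_forall_eq_zero fun t ht => indicator_of_notMem (key s hss t ht) _
  · intro s hs hss
    rw [r3 s hs]
    exact setIntegral_eq_zero_of_forall_eq_zero fun t ht => indicator_of_notMem (key s hss t ht) _

lemma MemC.half {α β δ : ℝ} (hα : 0 < α) (hβ : 0 < β) (hδ : 0 < δ) {Ω : Set (Euc d)}
    (hΩ : IsCompact Ω) {p x y : Mtriple d} (hp : MemC α β δ Ω p)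
    (hx : x ∈ Ball α β δ Ω) (hy : y ∈ Ball α β δ Ω) {a b : ℝ} (ha : 0 < a) (hb : 0 < b)
    (hab : a + b = 1) (e : a • x + b • y = p)
    {P : Measure (XX d)} {v : XX d → Euc d} {g : XX d → ℝ} (R : Rep p P v g) :
    ∃ κ : ℝ, 0 ≤ κ ∧ κ ≤ 1 ∧ Rep x (ENNReal.ofReal κ • P) v g := by
  have hpB := hp.mem_ball
  obtain ⟨γ, h, γ', h', hc, conn, hJ⟩ := hp
  obtain ⟨P1, ac, R1⟩ := conv_split hα hβ hδ ha hb hab e hJ hx.2.2.2 hy.2.2.2 R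
  have jx := ne_top_of_le_ne_top ENNReal.one_ne_top hx.2.2.2
  have jp := ne_top_of_le_ne_top ENNReal.one_ne_top hpB.2.2.2
  have S := R.setting hα hβ hδ jp hΩ hpB.1
  have S1 := R1.setting hα hβ hδ jx hΩ hx.1
  obtain ⟨eh, c, mc, hg⟩ := S.char_graph hc R
  have es : {t | t ∈ Icc (0:ℝ) 1 ∧ 0 < h t} = {t | t ∈ Icc (0:ℝ) 1 ∧ 0 < Setting.hh P v g t} := by
    ext t
    simp only [mem_setOf_eq]
    exact and_congr_right fun ht => by rw [eh ht]
  rw [es] at conn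
  obtain ⟨κ, hκ, eP⟩ := S.prop_measure S1 ac mc hg conn
  subst eP
  refine ⟨κ, hκ, ?_, R1⟩
  obtain ⟨-, -, e1⟩ := R.en_facts hα hβ jp
  obtain ⟨-, -, e2⟩ := R1.en_facts hα hβ jx
  have k := hx.2.2.2
  rw [hJ] at e1
  have e1' := (ENNReal.ofReal_eq_one).1 e1.symm
  rw [e2, integral_smul_measure, e1', ENNReal.toReal_ofReal hκ, smul_eq_mul, mul_one,
    ENNReal.ofReal_le_one] at k
  exact k

lemma MemC.extreme {α β δ : ℝ} (hα : 0 < α) (hβ : 0 < β) (hδ : 0 < δ) {Ω : Set (Euc d)}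
    (hΩ : IsCompact Ω) {p : Mtriple d} (hp : MemC α β δ Ω p) :
    p ∈ extremePoints ℝ (Ball α β δ Ω) := by
  rw [mem_extremePoints]
  refine ⟨hp.mem_ball, ?_⟩
  rintro x hx y hy ⟨a, b, ha, hb, hab, e⟩
  have jp := ne_top_of_le_ne_top ENNReal.one_ne_top hp.mem_ball.2.2.2
  obtain ⟨P, v, g, R⟩ := exists_rep hα hβ hδ jp
  obtain ⟨κ1, k10, k11, R1⟩ := hp.half hα hβ hδ hΩ hx hy ha hb hab e R
  obtain ⟨κ2, k20, k21, R2⟩ := hp.half hα hβ hδ hΩ hy hx hb ha (by linarith)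
    (by rw [add_comm]; exact e) R
  have eP := comb_measure ha hb e R R1 R2
  have := R.fin
  have hP : P.real univ ≠ 0 := by
    intro h0
    have hP0 : P = 0 := by
      rw [← Measure.measure_univ_eq_zero]; exact (measureReal_eq_zero_iff).1 h0
    obtain ⟨-, -, e1⟩ := R.en_facts hα hβ jp
    obtain ⟨_, _, _, _, _, _, hJ⟩ := hp
    rw [hJ, hP0] at e1
    simp at e1
  have hm := congrArg (fun m : Measure (XX d) => (m univ).toReal) eP
  simp only [Measure.add_apply, Measure.smul_apply, smul_eq_mul] at hm
  rw [← mul_assoc, ← mul_assoc, ← add_mul, ← ENNReal.ofReal_mul ha.le, ← ENNReal.ofReal_mul hb.le,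
    ← ENNReal.ofReal_add (by positivity) (by positivity), ENNReal.toReal_mul,
    ENNReal.toReal_ofReal (by positivity)] at hm
  have hm' : a * κ1 + b * κ2 = 1 := by
    refine mul_right_cancel₀ hP ?_
    rw [one_mul]; exact hm.symm
  have q1 : κ1 = 1 := by nlinarith
  have q2 : κ2 = 1 := by nlinarith
  rw [q1, ENNReal.ofReal_one, one_smul] at R1
  rw [q2, ENNReal.ofReal_one, one_smul] at R2
  exact ⟨R1.ext R, R2.ext R⟩

/-- **Extremal points of the coercive Hellinger–Kantorovich energy ball.**
The extreme points of `𝓑 = {(ρ,m,μ) ∈ M_Ω : J_{α,β,δ}(ρ,m,μ) ≤ 1}` are exactly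
the zero triple together with the characteristic triples
`ρ = h dt ⊗ δ_γ`, `m = γ' ρ`, `μ = h' dt ⊗ δ_γ` with `H_Ω`-regularity,
connected positivity set `{h>0}`, and unit energy. -/
theorem extreme_points_HK_ball (d : ℕ) (hd : 1 ≤ d) (Ω : Set (Euc d))
    (hΩ : IsClosureOfBoundedDomain Ω)
    (α β δ : ℝ) (hα : 0 < α) (hβ : 0 < β) (hδ : 0 < δ) :
    Set.extremePoints ℝ
      {p : Mtriple d | ConcS Ω p.1 ∧ ConcV Ω p.2.1 ∧ ConcS Ω p.2.2 ∧
        JSigned α β δ p.1 p.2.1 p.2.2 ≤ 1}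
      = {p : Mtriple d | MemC α β δ Ω p} ∪ {0} := by
  have hc := (compact_of_domain hΩ).1
  change extremePoints ℝ (Ball α β δ Ω) = _
  ext p
  constructor
  · intro hp
    by_cases hp0 : p = 0
    · exact Or.inr hp0
    · exact Or.inl (extreme_subset hα hβ hδ hΩ hp hp0)
  · rintro (hp | hp)
    · exact MemC.extreme hα hβ hδ hc hp
    · rw [mem_singleton_iff.1 hp]
      exact zero_extreme hα hβ hδ Ω

end Paper
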